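/- Let E be an elliptic curve over ℚ without complex multiplication. If p ∉ {2, 3} is a prime number such that the image of ρ_{E,p} is conjugate in GL₂(F_p) to G(p), then p ≡ 2 (mod 3) and p ≢ −1 (mod 9) (hence p ≡ 2 or 5 (mod 9)). -/

import Mathlib

/-!
Setup: the mod-`p` Galois representation attached to an elliptic curve over `ℚ`,
the non-split Cartan subgroup and related subgroups of `GL₂(𝔽_p)`.
-/

open WeierstrassCurve WeierstrassCurve.Affine Matrix

noncomputable section

/-- A fixed algebraic closure `ℚ̄` of `ℚ`. -/
abbrev Qbar : Type := AlgebraicClosure ℚ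

/-- The thirteen rational CM `j`-invariants.  An elliptic curve over `ℚ` has complex
multiplication (equivalently, its geometric endomorphism ring is strictly larger than `ℤ`)
if and only if its `j`-invariant belongs to this set; thus `E.j ∉ CMjInvariants` expresses
that `E` is a non-CM elliptic curve over `ℚ`. -/
def CMjInvariants : Set ℚ :=
  {0, 1728, -3375, 8000, 54000, -32768, 287496, -884736, -12288000, 16581375, -884736000,
    -147197952000, -262537412640768000}

variable (E : WeierstrassCurve ℚ)

open scoped Classical in
/-- The action of `σ ∈ Gal(ℚ̄/ℚ)` on the group `E(ℚ̄)` of `ℚ̄`-points of `E`. -/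
def galAct (σ : Qbar ≃ₐ[ℚ] Qbar) :
    (E.baseChange Qbar).toAffine.Point →+ (E.baseChange Qbar).toAffine.Point :=
  Point.map (W' := E) σ.toAlgHom

open scoped Classical in
/-- The subgroup `E[p] ⊆ E(ℚ̄)` of `p`-torsion points. -/
def pTorsion (p : ℕ) : AddSubgroup ((E.baseChange Qbar).toAffine.Point) where
  carrier := {P | p • P = 0}
  zero_mem' := smul_zero p
  add_mem' := fun {a b} ha hb => by
    have h : p • (a + b) = p • a + p • b := smul_add p a b
    simp only [Set.mem_setOf_eq] at *
    rw [h, ha, hb, add_zero]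
  neg_mem' := fun {a} ha => by
    have h : p • (-a) = -(p • a) := smul_neg p a
    simp only [Set.mem_setOf_eq] at *
    rw [h, ha, neg_zero]

/-- `ρ` *is* the mod-`p` Galois representation `ρ_{E,p}` of `E`, written in some `𝔽_p`-basis of
`E[p]`: there is an additive (equivalently, `𝔽_p`-linear) isomorphism `e : E[p] ≃ 𝔽_p²` through
which the Galois action on `E[p]` corresponds to the matrix action of `ρ`. -/
def IsModPRep (p : ℕ) (ρ : (Qbar ≃ₐ[ℚ] Qbar) →* GL (Fin 2) (ZMod p)) : Prop :=
  ∃ e : pTorsion E p ≃+ (Fin 2 → ZMod p),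
    ∀ (σ : Qbar ≃ₐ[ℚ] Qbar) (P : pTorsion E p) (hP : galAct E σ P.1 ∈ pTorsion E p),
      e ⟨galAct E σ P.1, hP⟩ = Matrix.mulVec (ρ σ : Matrix (Fin 2) (Fin 2) (ZMod p)) (e P)

/-- The least positive integer which is a quadratic non-residue modulo `p`. -/
def leastNonResidue (p : ℕ) : ℕ :=
  sInf {n : ℕ | 0 < n ∧ ¬∃ x : ZMod p, x ^ 2 = (n : ZMod p)}

/-- `ε ∈ 𝔽_p`: the reduction mod `p` of the least positive quadratic non-residue. -/
def nsEps (p : ℕ) : ZMod p := (leastNonResidue p : ZMod p)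

/-- The non-split Cartan subgroup `C_ns(p) ⊆ GL₂(𝔽_p)` (as a set): invertible matrices of the
form `[[a, εb], [b, a]]`.  (Invertibility forces `(a, b) ≠ (0, 0)`.) -/
def Cns (p : ℕ) : Set (GL (Fin 2) (ZMod p)) :=
  {M | ∃ a b : ZMod p, (M : Matrix (Fin 2) (Fin 2) (ZMod p)) = !![a, nsEps p * b; b, a]}

/-- `C_ns⁺(p)`: the normaliser of the non-split Cartan subgroup in `GL₂(𝔽_p)`. -/
def CnsPlus (p : ℕ) : Subgroup (GL (Fin 2) (ZMod p)) :=
  Subgroup.setNormalizer (Cns p)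

/-- The subgroup `G(p) = {a³ : a ∈ C_ns(p)} ∪ {diag(1,-1)·a³ : a ∈ C_ns(p)}` of `GL₂(𝔽_p)`
(as a set). -/
def Gset (p : ℕ) : Set (GL (Fin 2) (ZMod p)) :=
  {M | (∃ a ∈ Cns p, M = a ^ 3) ∨
    ∃ a ∈ Cns p, (M : Matrix (Fin 2) (Fin 2) (ZMod p)) =
      !![1, 0; 0, -1] * ((a : Matrix (Fin 2) (Fin 2) (ZMod p)) ^ 3)}

/-- The image of `ρ` is conjugate in `GL₂(𝔽_p)` to the subset `S`. -/
def ImageConjTo {p : ℕ} (ρ : (Qbar ≃ₐ[ℚ] Qbar) →* GL (Fin 2) (ZMod p))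
    (S : Set (GL (Fin 2) (ZMod p))) : Prop :=
  ∃ g : GL (Fin 2) (ZMod p), Set.range ρ = (fun x => g * x * g⁻¹) '' S

end

section
/-- Abstract addition law on `x`-coordinates of `y² = x³ + A x + B`. -/
structure XSys {F G : Type*} [Field F] [AddCommGroup G] (A B : F) (X : G → F) : Prop where
  neg : ∀ P, X (-P) = X P
  inj : ∀ P Q, P ≠ 0 → Q ≠ 0 → X P = X Q → P = Q ∨ P = -Q
  add_sum : ∀ P Q, P ≠ 0 → Q ≠ 0 → P ≠ Q → P ≠ -Q →
    (X P - X Q) ^ 2 * (X (P + Q) + X (P - Q)) = 2 * ((X P + X Q) * (A + X P * X Q) + 2 * B)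
  add_prod : ∀ P Q, P ≠ 0 → Q ≠ 0 → P ≠ Q → P ≠ -Q →
    (X P - X Q) ^ 2 * (X (P + Q) * X (P - Q)) = (X P * X Q - A) ^ 2 - 4 * B * (X P + X Q)
  dbl : ∀ P, P ≠ 0 → P + P ≠ 0 → 4 * (X P ^ 3 + A * X P + B) * X (P + P) =
    (3 * X P ^ 2 + A) ^ 2 - 8 * X P * (X P ^ 3 + A * X P + B)
  f_ne : ∀ P, P ≠ 0 → P + P ≠ 0 → X P ^ 3 + A * X P + B ≠ 0
  sq : ∀ P, P ≠ 0 → ∃ w, w ^ 2 = 4 * (X P ^ 3 + A * X P + B)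

def VV {F : Type*} [Field F] (a : ℕ → F) (w : F) : ℕ → F
  | 0 => 0
  | 1 => 1
  | 2 => w
  | (n+3) => (a 1 - a (n+2)) * VV a w (n+2) ^ 2 / VV a w (n+1)

section
variable {F : Type*} [Field F] {a : ℕ → F} {w : F} {p : ℕ}

theorem VV_ne (hw : w ≠ 0) (hne : ∀ n m, 1 ≤ n → n < m → m + n < p → a n ≠ a m) :
    ∀ n, 1 ≤ n → n < p → VV a w n ≠ 0 := by
  intro n
  induction n using Nat.strong_induction_on with
  | _ n ih =>
    intro h1 h2
    match n, ih, h1, h2 with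
    | 1, _, _, _ => simp [VV]
    | 2, _, _, _ => simpa [VV] using hw
    | (n+3), ih, h1, h2 =>
      simp only [VV]
      refine div_ne_zero (mul_ne_zero ?_ (pow_ne_zero _ (ih (n+2) (by omega) (by omega) (by omega))))
        (ih (n+1) (by omega) (by omega) (by omega))
      exact sub_ne_zero.2 (hne 1 (n+2) le_rfl (by omega) (by omega))

theorem VV_one (hw : w ≠ 0) (hne : ∀ n m, 1 ≤ n → n < m → m + n < p → a n ≠ a m) (m : ℕ)
    (hm : 2 ≤ m) (hmp : m + 1 ≤ p) :
    (a 1 - a m) * VV a w m ^ 2 = VV a w (m+1) * VV a w (m-1) := by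
  obtain ⟨n, rfl⟩ : ∃ n, m = n + 2 := ⟨m - 2, by omega⟩
  have := VV_ne hw hne (n+1) (by omega) (by omega)
  simp only [VV, show n + 2 - 1 = n + 1 by omega]
  field_simp

theorem VV_main (hw : w ≠ 0) (hne : ∀ n m, 1 ≤ n → n < m → m + n < p → a n ≠ a m)
    (sym : ∀ n m, 2 ≤ n → n + 1 < m → m + n + 1 ≤ p →
      (a (n+1) - a m) * (a (n-1) - a m) * (a n - a 1) ^ 2
        = (a (m+1) - a n) * (a (m-1) - a n) * (a m - a 1) ^ 2)
    (s1 : ∀ m, 3 ≤ m → m + 2 ≤ p → w ^ 2 * (a 2 - a m) =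
      (a 1 - a (m+1)) * (a 1 - a (m-1)) * (a m - a 1) ^ 2) :
    ∀ n m, 1 ≤ n → n < m → m + n ≤ p →
      (a n - a m) * (VV a w m ^ 2 * VV a w n ^ 2) = VV a w (m+n) * VV a w (m-n) := by
  have hV := VV_ne (p := p) hw hne
  have h1 := VV_one (p := p) hw hne
  intro n
  induction n using Nat.strong_induction_on with
  | _ n ih =>
    intro m hn hnm hmp
    match n, ih, hn, hnm, hmp with
    | 1, _, _, hnm, hmp =>
      have := h1 m (by omega) (by omega)
      simpa [VV] using this
    | 2, _, _, hnm, hmp =>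
      obtain ⟨k, rfl⟩ : ∃ k, m = k + 3 := ⟨m - 3, by omega⟩
      have e := s1 (k+3) (by omega) (by omega)
      have e1 := h1 (k+4) (by omega) (by omega)
      have e2 := h1 (k+2) (by omega) (by omega)
      have e3 := h1 (k+3) (by omega) (by omega)
      simp only [show k + 4 - 1 = k + 3 by omega, show k + 2 - 1 = k + 1 by omega,
        show k + 3 - 1 = k + 2 by omega, show k + 3 + 1 = k + 4 by omega,
        show k + 4 + 1 = k + 5 by omega, show k + 2 + 1 = k + 3 by omega,
        show k + 3 + 2 = k + 5 by omega, show k + 3 - 2 = k + 1 by omega] at *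
      have v3 := hV (k+3) (by omega) (by omega)
      have v4 := hV (k+4) (by omega) (by omega)
      have v2 := hV (k+2) (by omega) (by omega)
      have : VV a w 2 = w := by simp [VV]
      rw [this]
      set x5 := VV a w (k+5)
      set x4 := VV a w (k+4)
      set x3 := VV a w (k+3)
      set x2 := VV a w (k+2)
      set x1 := VV a w (k+1)
      have E1 : a 1 - a (k+4) = x5 * x3 / x4 ^ 2 := by field_simp; linear_combination e1
      have E2 : a 1 - a (k+2) = x3 * x1 / x2 ^ 2 := by field_simp; linear_combination e2
      have E3 : a (k+3) - a 1 = -(x4 * x2 / x3 ^ 2) := by field_simp; linear_combination -e3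
      rw [E1, E2, E3] at e
      have : (a 2 - a (k + 3)) * (x3 ^ 2 * w ^ 2) = (w ^ 2 * (a 2 - a (k + 3))) * x3 ^ 2 := by ring
      rw [this, e]
      field_simp
    | (n+3), ih, _, hnm, hmp =>
      obtain ⟨k, rfl⟩ : ∃ k, m = n + 4 + k := ⟨m - (n+4), by omega⟩
      have e := sym (n+2) (n+4+k) (by omega) (by omega) (by omega)
      have e1 := ih (n+1) (by omega) (n+4+k) (by omega) (by omega) (by omega)
      have e2 := ih (n+2) (by omega) (n+4+k+1) (by omega) (by omega) (by omega)
      have e3 := ih (n+2) (by omega) (n+4+k-1) (by omega) (by omega) (by omega)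
      have e4 := h1 (n+2) (by omega) (by omega)
      have e5 := h1 (n+4+k) (by omega) (by omega)
      simp only [show n+4+k-1 = n+3+k by omega, show n+2-1 = n+1 by omega, show n+2+1=n+3 by omega,
        show n+4+k+1 = n+5+k by omega, show n+4+k+(n+1) = 2*n+k+5 by omega,
        show n+4+k-(n+1) = k+3 by omega, show n+5+k+(n+2) = 2*n+k+7 by omega,
        show n+5+k-(n+2) = k+3 by omega, show n+3+k+(n+2) = 2*n+k+5 by omega,
        show n+3+k-(n+2) = k+1 by omega, show n+4+k+(n+3) = 2*n+k+7 by omega,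
        show n+4+k-(n+3) = k+1 by omega] at *
      have v1 := hV (n+1) (by omega) (by omega)
      have v2 := hV (n+2) (by omega) (by omega)
      have v3 := hV (n+3) (by omega) (by omega)
      have u3 := hV (n+3+k) (by omega) (by omega)
      have u4 := hV (n+4+k) (by omega) (by omega)
      have u5 := hV (n+5+k) (by omega) (by omega)
      have t3 := hV (k+3) (by omega) (by omega)
      have t5 := hV (2*n+k+5) (by omega) (by omega)
      set x1 := VV a w (n+1)
      set x2 := VV a w (n+2)
      set x3 := VV a w (n+3)
      set y3 := VV a w (n+3+k)
      set y4 := VV a w (n+4+k)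
      set y5 := VV a w (n+5+k)
      set z3 := VV a w (k+3)
      set z1 := VV a w (k+1)
      set w5 := VV a w (2*n+k+5)
      set w7 := VV a w (2*n+k+7)
      have E1 : a (n+1) - a (n+4+k) = w5 * z3 / (y4^2 * x1^2) := by
        field_simp; linear_combination e1
      have E2 : a (n+5+k) - a (n+2) = - (w7 * z3 / (y5^2 * x2^2)) := by
        field_simp; linear_combination -e2
      have E3 : a (n+3+k) - a (n+2) = - (w5 * z1 / (y3^2 * x2^2)) := by
        field_simp; linear_combination -e3
      have E4 : a (n+2) - a 1 = -(x3 * x1 / x2 ^ 2) := by field_simp; linear_combination -e4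
      have E5 : a (n+4+k) - a 1 = -(y5 * y3 / y4 ^ 2) := by field_simp; linear_combination -e5
      rw [E1, E2, E3, E4, E5] at e
      have hz : w5 * z3 / (y4^2 * x1^2) * (-(x3 * x1 / x2 ^ 2)) ^ 2 ≠ 0 := by
        refine mul_ne_zero (div_ne_zero (mul_ne_zero t5 t3) (by positivity)) ?_
        refine pow_ne_zero _ (neg_ne_zero.2 (div_ne_zero (mul_ne_zero v3 v1) (by positivity)))
      have : a (n+3) - a (n+4+k) = w7 * z1 / (y4^2 * x3^2) := by
        apply mul_right_cancel₀ hz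
        rw [← mul_assoc, e]
        field_simp
      rw [this]; field_simp

/-- the sequence agrees with the elliptic divisibility sequence up to `p` -/
theorem VV_eds (hw : w ≠ 0) (hne : ∀ n m, 1 ≤ n → n < m → m + n < p → a n ≠ a m)
    (sym : ∀ n m, 2 ≤ n → n + 1 < m → m + n + 1 ≤ p →
      (a (n+1) - a m) * (a (n-1) - a m) * (a n - a 1) ^ 2
        = (a (m+1) - a n) * (a (m-1) - a n) * (a m - a 1) ^ 2)
    (s1 : ∀ m, 3 ≤ m → m + 2 ≤ p → w ^ 2 * (a 2 - a m) =
      (a 1 - a (m+1)) * (a 1 - a (m-1)) * (a m - a 1) ^ 2)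
    (c d : F) (h3 : VV a w 3 = c) (h4 : VV a w 4 = d * w) :
    ∀ n : ℕ, n ≤ p → VV a w n = normEDS w c d n := by
  have hm := VV_main hw hne sym s1
  have hV := VV_ne (p := p) hw hne
  have h1 := VV_one (p := p) hw hne
  intro n
  induction n using Nat.strong_induction_on with
  | _ n ih =>
    intro hnp
    by_cases hn : n < 5
    · interval_cases n
      · simp [VV]
      · simp [VV]
      · simp [VV]
      · simpa using h3
      · simpa using h4
    · obtain ⟨m, rfl | rfl⟩ : ∃ m, n = 2 * (m+3) ∨ n = 2 * (m + 2) + 1 := by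
        rcases Nat.even_or_odd' n with ⟨k, rfl | rfl⟩
        · exact ⟨k - 3, by omega⟩
        · exact ⟨k - 2, by omega⟩
      · have e := normEDS_even w c d ((m:ℤ) + 3)
        have i5 := ih (m+5) (by omega) (by omega)
        have i4 := ih (m+4) (by omega) (by omega)
        have i3 := ih (m+3) (by omega) (by omega)
        have i2 := ih (m+2) (by omega) (by omega)
        have i1 := ih (m+1) (by omega) (by omega)
        push_cast at *
        ring_nf at e i5 i4 i3 i2 i1 ⊢
        rw [← i5, ← i4, ← i3, ← i2, ← i1] at e
        have q := hm (2+m) (4+m) (by omega) (by omega) (by omega)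
        have q1 := h1 (2+m) (by omega) (by omega)
        have q2 := h1 (4+m) (by omega) (by omega)
        simp only [show 4+m+(2+m) = 6 + m*2 by omega, show 4+m-(2+m)=2 by omega,
          show 2+m+1 = 3+m by omega, show 2+m-1=1+m by omega, show 4+m+1 = 5+m by omega,
          show 4+m-1=3+m by omega] at q q1 q2
        apply mul_right_cancel₀ hw
        rw [e]
        have hw2 : VV a w 2 = w := by simp [VV]
        rw [hw2] at q
        rw [← q]
        linear_combination VV a w (2+m) ^ 2 * q2 - VV a w (4+m) ^ 2 * q1
      · have e := normEDS_odd w c d ((m:ℤ) + 2)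
        have i4 := ih (m+4) (by omega) (by omega)
        have i3 := ih (m+3) (by omega) (by omega)
        have i2 := ih (m+2) (by omega) (by omega)
        have i1 := ih (m+1) (by omega) (by omega)
        push_cast at *
        ring_nf at e i4 i3 i2 i1 ⊢
        rw [← i4, ← i3, ← i2, ← i1] at e
        have q := hm (2+m) (3+m) (by omega) (by omega) (by omega)
        have q1 := h1 (2+m) (by omega) (by omega)
        have q2 := h1 (3+m) (by omega) (by omega)
        simp only [show 3+m+(2+m) = 5 + m*2 by omega, show 3+m-(2+m)=1 by omega,
          show 2+m+1 = 3+m by omega, show 2+m-1=1+m by omega, show 3+m+1 = 4+m by omega,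
          show 3+m-1=2+m by omega] at q q1 q2
        rw [e]
        have hw2 : VV a w 1 = 1 := by simp [VV]
        rw [hw2] at q
        linear_combination -q + VV a w (2+m) ^ 2 * q2 - VV a w (3+m) ^ 2 * q1
end
end

section
theorem preΨ'_eval {R : Type*} [CommRing R] (A B x : R) (n : ℕ) :
    ((⟨0, 0, 0, A, B⟩ : WeierstrassCurve R).preΨ' n).eval x =
      preNormEDS' ((4 * (x ^ 3 + A * x + B)) ^ 2)
        (3 * x ^ 4 + 6 * A * x ^ 2 + 12 * B * x - A ^ 2)
        (2 * (x ^ 6 + 5 * A * x ^ 4 + 20 * B * x ^ 3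
          - 5 * A ^ 2 * x ^ 2 - 4 * A * B * x - 8 * B ^ 2 - A ^ 3)) n := by
  rw [WeierstrassCurve.preΨ', ← Polynomial.coe_evalRingHom, map_preNormEDS']
  congr 1
  · simp only [Polynomial.coe_evalRingHom, WeierstrassCurve.Ψ₂Sq, WeierstrassCurve.b₂,
      WeierstrassCurve.b₄, WeierstrassCurve.b₆]
    simp
    ring
  · simp only [Polynomial.coe_evalRingHom, WeierstrassCurve.Ψ₃, WeierstrassCurve.b₂,
      WeierstrassCurve.b₄, WeierstrassCurve.b₆, WeierstrassCurve.b₈]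
    simp
    ring
  · simp only [Polynomial.coe_evalRingHom, WeierstrassCurve.preΨ₄, WeierstrassCurve.b₂,
      WeierstrassCurve.b₄, WeierstrassCurve.b₆, WeierstrassCurve.b₈]
    simp
    ring

section
variable {F G : Type*} [Field F] [AddCommGroup G] {A B : F} {X : G → F}

theorem XSys.symm3 (h : XSys A B X) (P Q R : G) (hP : P ≠ 0) (hQ : Q ≠ 0) (hR : R ≠ 0)
    (h1 : R ≠ P) (h2 : R ≠ -P) (h3 : Q ≠ P) (h4 : Q ≠ -P) :
    (X (R + P) - X Q) * (X (R - P) - X Q) * (X R - X P) ^ 2 =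
      (X (Q + P) - X R) * (X (Q - P) - X R) * (X Q - X P) ^ 2 := by
  have a1 := h.add_sum R P hR hP h1 h2
  have a2 := h.add_prod R P hR hP h1 h2
  have b1 := h.add_sum Q P hQ hP h3 h4
  have b2 := h.add_prod Q P hQ hP h3 h4
  linear_combination a2 - X Q * a1 - b2 + X R * b1

theorem XSys.symm2 (h : XSys A B X) (P Q : G) (hP : P ≠ 0) (hP2 : P + P ≠ 0) (hQ : Q ≠ 0)
    (h3 : Q ≠ P) (h4 : Q ≠ -P) :
    4 * (X P ^ 3 + A * X P + B) * (X (P + P) - X Q) =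
      (X P - X (Q + P)) * (X P - X (Q - P)) * (X Q - X P) ^ 2 := by
  have a1 := h.dbl P hP hP2
  have b1 := h.add_sum Q P hQ hP h3 h4
  have b2 := h.add_prod Q P hQ hP h3 h4
  linear_combination a1 - b2 + X P * b1

theorem XSys.ne (h : XSys A B X) {P Q : G} (hP : P ≠ 0) (hQ : Q ≠ 0) (h1 : P - Q ≠ 0)
    (h2 : P + Q ≠ 0) : X P ≠ X Q := by
  intro e
  rcases h.inj P Q hP hQ e with r | r
  · exact h1 (by rw [r, sub_self])
  · exact h2 (by rw [r, neg_add_cancel])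

theorem XSys.triple (h : XSys A B X) (P : G) (hP : P ≠ 0) (hP2 : P + P ≠ 0) (hP3 : P + P + P ≠ 0)
    (h4 : (4:F) ≠ 0) :
    (X P - X (P + P + P)) * (3 * X P ^ 4 + 6 * A * X P ^ 2 + 12 * B * X P - A ^ 2) ^ 2 =
      4 * (X P ^ 3 + A * X P + B) * (2 * (X P ^ 6 + 5 * A * X P ^ 4 + 20 * B * X P ^ 3
        - 5 * A ^ 2 * X P ^ 2 - 4 * A * B * X P - 8 * B ^ 2 - A ^ 3)) := by
  have a1 := h.dbl P hP hP2
  have n1 : P + P ≠ P := fun e => hP (by simpa using e)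
  have n2 : P + P ≠ -P := fun e => hP3 (by rw [e, neg_add_cancel])
  have b1 := h.add_sum (P+P) P hP2 hP n1 n2
  rw [add_sub_cancel_right] at b1
  have hf := h.f_ne P hP hP2
  set f := X P ^ 3 + A * X P + B with hfd
  set x := X P
  set y := X (P + P)
  set z := X (P + P + P)
  have hff : 4 * f ≠ 0 := mul_ne_zero h4 hf
  have hy : y = ((3 * x ^ 2 + A) ^ 2 - 8 * x * f) / (4 * f) := by
    rw [eq_div_iff hff, ← a1]; ring
  have e1 : (x - z) * (y - x) ^ 2 = (2 * x) * (y-x)^2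
      - 2 * ((y + x) * (A + y * x) + 2 * B) := by linear_combination -b1
  have e2 : (3 * x ^ 4 + 6 * A * x ^ 2 + 12 * B * x - A ^ 2) = (x - y) * (4 * f) := by
    have : y * (4 * f) = ((3 * x ^ 2 + A) ^ 2 - 8 * x * f) := by rw [← a1]; ring
    rw [sub_mul, this, hfd]; ring
  have e3 : y * (4 * f) = ((3 * x ^ 2 + A) ^ 2 - 8 * x * f) := by rw [← a1]; ring
  have : (x - z) * (3 * x ^ 4 + 6 * A * x ^ 2 + 12 * B * x - A ^ 2) ^ 2 =
      2 * x * (y * (4*f) - x * (4 * f)) ^ 2 - 2 * ((y * (4 * f) + x * (4*f)) *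
        (A * (4 * f) + (y * (4 * f)) * x) + 2 * B * (4 *f)^2) := by
    rw [e2]; linear_combination (4*f)^2 * e1
  rw [this, e3, hfd]
  ring

theorem XSys.root (h : XSys A B X) (h4 : (4:F) ≠ 0) {p : ℕ} (hp : p.Prime) (hp5 : 5 ≤ p) (P : G)
    (hP : P ≠ 0) (hpP : p • P = 0) :
    ((⟨0, 0, 0, A, B⟩ : WeierstrassCurve F).preΨ' p).eval (X P) = 0 := by
  have key : ∀ k : ℕ, 0 < k → k < p → k • P ≠ 0 := by
    intro k hk hkp e
    have hd : addOrderOf P ∣ p := addOrderOf_dvd_of_nsmul_eq_zero hpP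
    have hd2 : addOrderOf P ∣ k := addOrderOf_dvd_of_nsmul_eq_zero e
    rcases (Nat.dvd_prime hp).1 hd with r | r
    · exact hP (AddMonoid.addOrderOf_eq_one_iff.1 r)
    · rw [r] at hd2; exact absurd (Nat.le_of_dvd hk hd2) (by omega)
  have key2 : ∀ m n : ℕ, n < m → m < p → m • P - n • P ≠ 0 := by
    intro m n hnm hm
    rw [sub_eq_add_neg, ← sub_nsmul _ hnm.le]
    exact key _ (by omega) (by omega)
  have key3 : ∀ m n : ℕ, 0 < m + n → m + n < p → m • P + n • P ≠ 0 := by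
    intro m n h1 h2
    rw [← add_nsmul]
    exact key _ (by omega) (by omega)
  obtain ⟨w, hw⟩ := h.sq P hP
  have hP2 : P + P ≠ 0 := by have := key 2 (by omega) (by omega); rwa [two_nsmul] at this
  have hP3 : P + P + P ≠ 0 := by
    have := key 3 (by omega) (by omega); rwa [succ_nsmul, two_nsmul] at this
  have hf := h.f_ne P hP hP2
  have hw0 : w ≠ 0 := by
    rintro rfl
    have := mul_ne_zero h4 hf
    rw [← hw] at this; simp at this
  have hne : ∀ n m, 1 ≤ n → n < m → m + n < p → X (n • P) ≠ X (m • P) := by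
    intro n m h1 h2 h3
    exact (h.ne (key m (by omega) (by omega)) (key n (by omega) (by omega))
      (key2 m n h2 (by omega)) (key3 m n (by omega) h3)).symm
  have neP : ∀ m : ℕ, 2 ≤ m → m + 1 < p → m • P ≠ P ∧ m • P ≠ -P := by
    intro m h1 h2
    have e1 := key2 m 1 (by omega) (by omega)
    have e2 := key3 m 1 (by omega) (by omega)
    rw [one_nsmul] at e1 e2
    exact ⟨fun e => e1 (by rw [e, sub_self]), fun e => e2 (by rw [e, neg_add_cancel])⟩
  have pred : ∀ m : ℕ, 1 ≤ m → m • P - P = (m - 1) • P := by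
    intro m hm
    rw [sub_nsmul _ hm, one_nsmul, sub_eq_add_neg]
  have sym : ∀ n m, 2 ≤ n → n + 1 < m → m + n + 1 ≤ p →
      (X ((n+1) • P) - X (m • P)) * (X ((n-1) • P) - X (m • P)) * (X (n • P) - X (1 • P)) ^ 2
        = (X ((m+1) • P) - X (n • P)) * (X ((m-1) • P) - X (n • P)) *
          (X (m • P) - X (1 • P)) ^ 2 := by
    intro n m h1 h2 h3
    have := h.symm3 P (m • P) (n • P) hP (key _ (by omega) (by omega)) (key _ (by omega) (by omega))
      (neP n (by omega) (by omega)).1 (neP n (by omega) (by omega)).2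
      (neP m (by omega) (by omega)).1 (neP m (by omega) (by omega)).2
    rw [pred n (by omega), pred m (by omega), ← succ_nsmul, ← succ_nsmul] at this
    rw [one_nsmul]; exact this
  have s1 : ∀ m, 3 ≤ m → m + 2 ≤ p → w ^ 2 * (X (2 • P) - X (m • P)) =
      (X (1 • P) - X ((m+1) • P)) * (X (1 • P) - X ((m-1) • P)) * (X (m • P) - X (1 • P)) ^ 2 := by
    intro m h1 h2
    have := h.symm2 P (m • P) hP hP2 (key _ (by omega) (by omega))
      (neP m (by omega) (by omega)).1 (neP m (by omega) (by omega)).2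
    rw [pred m (by omega), ← succ_nsmul] at this
    rw [one_nsmul, two_nsmul, hw]; exact this
  set c := 3 * X P ^ 4 + 6 * A * X P ^ 2 + 12 * B * X P - A ^ 2 with hc
  set d := (2 * (X P ^ 6 + 5 * A * X P ^ 4 + 20 * B * X P ^ 3
        - 5 * A ^ 2 * X P ^ 2 - 4 * A * B * X P - 8 * B ^ 2 - A ^ 3)) with hd
  have h3 : VV (fun n => X (n • P)) w 3 = c := by
    have := h.dbl P hP hP2
    simp only [VV, one_nsmul, two_nsmul, div_one, zero_add]
    rw [hw, hc]; linear_combination -this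
  have h44 : VV (fun n => X (n • P)) w 4 = d * w := by
    have := h.triple P hP hP2 hP3 h4
    rw [← hc, ← hd, ← hw] at this
    have e : VV (fun n => X (n • P)) w 4 =
      (X P - X (P + P + P)) * VV (fun n => X (n • P)) w 3 ^ 2 / w := by
      simp only [VV, one_nsmul, two_nsmul, zero_add]
      rw [show (3 : ℕ) • P = P + P + P by rw [succ_nsmul, two_nsmul]]
    rw [e, h3, this]
    field_simp
  have main := VV_eds hw0 hne sym s1 c d h3 h44 p le_rfl
  have hz : VV (fun n => X (n • P)) w p = 0 := by
    obtain ⟨k, rfl⟩ : ∃ k, p = k + 3 := ⟨p - 3, by omega⟩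
    have : (k+2) • P = - P := by
      rw [eq_neg_iff_add_eq_zero, ← succ_nsmul]; exact hpP
    simp only [VV, this, h.neg, one_nsmul, sub_self, zero_mul, zero_div]
  rw [hz, normEDS_ofNat] at main
  have hodd : ¬ Even p := by
    rw [Nat.not_even_iff_odd]; exact hp.odd_of_ne_two (by omega)
  rw [if_neg hodd, mul_one] at main
  rw [preΨ'_eval, main, show w ^ 4 = (w ^ 2) ^ 2 by ring, hw]
end
end

section
open WeierstrassCurve WeierstrassCurve.Affine

section
variable {F : Type*} [Field F] [DecidableEq F] (W : WeierstrassCurve F)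

def pxx : W.toAffine.Point → F
  | .zero => 0
  | .some x _ _ => x + W.b₂ / 12

def peta : W.toAffine.Point → F
  | .zero => 0
  | .some x y _ => 2 * y + W.a₁ * x + W.a₃

theorem pxx_neg (P : W.toAffine.Point) : pxx W (-P) = pxx W P := by
  rcases P with _ | ⟨x, y, h⟩
  · rfl
  · simp [Point.neg_some, pxx]

theorem peta_neg (P : W.toAffine.Point) : peta W (-P) = - peta W P := by
  rcases P with _ | ⟨x, y, h⟩
  · change (0:F) = -0; simp
  · simp [Point.neg_some, peta, negY]; ring

theorem peta_sq (h6 : (6:F) ≠ 0) (P : W.toAffine.Point) (hP : P ≠ 0) :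
    peta W P ^ 2 = 4 * (pxx W P ^ 3 + (-W.c₄ / 48) * pxx W P + (-W.c₆ / 864)) := by
  have h2 : (2:F) ≠ 0 := fun e => h6 (by rw [show (6:F) = 2 * 3 by norm_num, e, zero_mul])
  have h3 : (3:F) ≠ 0 := fun e => h6 (by rw [show (6:F) = 2 * 3 by norm_num, e, mul_zero])
  rcases P with _ | ⟨x, y, h⟩
  · exact absurd rfl hP
  · have e := (equation_iff _ _).1 h.1
    simp only [peta, pxx, c₄, c₆, b₂, b₄, b₆]
    rw [show (12:F) = 2^2*3 by norm_num, show (48:F) = 2^4*3 by norm_num,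
      show (864:F) = 2^5*3^3 by norm_num]
    field_simp
    linear_combination 6912 * e

theorem pxx_inj (P Q : W.toAffine.Point) (hP : P ≠ 0) (hQ : Q ≠ 0) (h : pxx W P = pxx W Q) :
    P = Q ∨ P = - Q := by
  rcases P with _ | ⟨x, y, hp⟩
  · exact absurd rfl hP
  rcases Q with _ | ⟨x', y', hq⟩
  · exact absurd rfl hQ
  simp only [pxx, add_left_inj] at h
  exact Point.X_eq_iff.1 h

theorem pxx_add (h6 : (6:F) ≠ 0) (P Q : W.toAffine.Point) (hP : P ≠ 0) (hQ : Q ≠ 0)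
    (h : pxx W P ≠ pxx W Q) :
    pxx W (P + Q) = ((peta W P - peta W Q) / (2 * (pxx W P - pxx W Q))) ^ 2 - pxx W P
      - pxx W Q := by
  have h2 : (2:F) ≠ 0 := fun e => h6 (by rw [show (6:F) = 2 * 3 by norm_num, e, zero_mul])
  have h3 : (3:F) ≠ 0 := fun e => h6 (by rw [show (6:F) = 2 * 3 by norm_num, e, mul_zero])
  rcases P with _ | ⟨x, y, hp⟩
  · exact absurd rfl hP
  rcases Q with _ | ⟨x', y', hq⟩
  · exact absurd rfl hQ
  simp only [pxx, ne_eq, add_left_inj] at h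
  rw [Point.add_of_X_ne h]
  simp only [pxx, peta, addX, slope_of_X_ne h, b₂]
  have h' : x - x' ≠ 0 := sub_ne_zero.2 h
  rw [show x + (W.a₁ ^ 2 + 4 * W.a₂) / 12 - (x' + (W.a₁ ^ 2 + 4 * W.a₂) / 12) = x - x' by ring]
  rw [show (12:F) = 2^2*3 by norm_num]
  field_simp
  ring

theorem pxx_dbl (h6 : (6:F) ≠ 0) (P : W.toAffine.Point) (hP : P ≠ 0) (h : P + P ≠ 0) :
    peta W P ≠ 0 ∧ 
    pxx W (P + P) = ((3 * pxx W P ^ 2 + (-W.c₄/48)) / peta W P) ^ 2 - 2 * pxx W P := by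
  have h2 : (2:F) ≠ 0 := fun e => h6 (by rw [show (6:F) = 2 * 3 by norm_num, e, zero_mul])
  have h3 : (3:F) ≠ 0 := fun e => h6 (by rw [show (6:F) = 2 * 3 by norm_num, e, mul_zero])
  rcases P with _ | ⟨x, y, hp⟩
  · exact absurd rfl hP
  have hy : y ≠ W.toAffine.negY x y := fun e => h (Point.add_self_of_Y_eq e)
  have hη : y - W.toAffine.negY x y ≠ 0 := sub_ne_zero.2 hy
  have e2 : y - W.toAffine.negY x y = 2 * y + W.a₁ * x + W.a₃ := by simp only [negY]; ring
  refine ⟨by simp only [peta]; rwa [← e2], ?_⟩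
  rw [Point.add_self_of_Y_ne hy]
  simp only [pxx, peta, addX, slope_of_Y_ne rfl hy, b₂]
  rw [e2] at hη ⊢
  have key : (3 * x ^ 2 + 2 * W.a₂ * x + W.a₄ - W.a₁ * y) /
      (2 * y + W.a₁ * x + W.a₃) = (3 * (x + (W.a₁ ^ 2 + 4 * W.a₂) / 12) ^ 2 + -W.c₄ / 48) /
        (2 * y + W.a₁ * x + W.a₃) - W.a₁ / 2 := by
    rw [show (12:F) = 2^2*3 by norm_num, show (48:F) = 2^4*3 by norm_num]
    simp only [c₄, b₂, b₄]
    generalize hD : 2 * y + W.a₁ * x + W.a₃ = D at *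
    field_simp
    rw [← hD]
    ring
  rw [key]
  set l := (3 * (x + (W.a₁ ^ 2 + 4 * W.a₂) / 12) ^ 2 + -W.c₄ / 48) / (2 * y + W.a₁ * x + W.a₃)
  rw [show (12:F) = 2^2*3 by norm_num]
  field_simp
  ring

theorem pxx_XSys (h6 : (6:F) ≠ 0) : XSys (-W.c₄ / 48) (-W.c₆ / 864) (pxx W) := by
  have h2 : (2:F) ≠ 0 := fun e => h6 (by rw [show (6:F) = 2 * 3 by norm_num, e, zero_mul])
  refine ⟨pxx_neg W, pxx_inj W, ?_, ?_, ?_, ?_, ?_⟩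
  · intro P Q hP hQ h1 h3
    have hne : pxx W P ≠ pxx W Q := fun e => (pxx_inj W P Q hP hQ e).elim h1 h3
    have a1 := pxx_add W h6 P Q hP hQ hne
    have a2 := pxx_add W h6 P (-Q) hP (neg_ne_zero.2 hQ) (by rwa [pxx_neg])
    rw [pxx_neg, peta_neg, ← sub_eq_add_neg] at a2
    have s1 := peta_sq W h6 P hP
    have s2 := peta_sq W h6 Q hQ
    rw [a1, a2]
    have hd : pxx W P - pxx W Q ≠ 0 := sub_ne_zero.2 hne
    set d := pxx W P - pxx W Q with hdd
    field_simp
    rw [hdd] 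
    linear_combination 2 * s1 + 2 * s2
  · intro P Q hP hQ h1 h3
    have hne : pxx W P ≠ pxx W Q := fun e => (pxx_inj W P Q hP hQ e).elim h1 h3
    have a1 := pxx_add W h6 P Q hP hQ hne
    have a2 := pxx_add W h6 P (-Q) hP (neg_ne_zero.2 hQ) (by rwa [pxx_neg])
    rw [pxx_neg, peta_neg, ← sub_eq_add_neg] at a2
    have s1 := peta_sq W h6 P hP
    have s2 := peta_sq W h6 Q hQ
    rw [a1, a2]
    have hd : pxx W P - pxx W Q ≠ 0 := sub_ne_zero.2 hne
    generalize pxx W P = x at *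
    generalize pxx W Q = y at *
    generalize peta W P = e at *
    generalize peta W Q = f at *
    generalize -W.c₄/48 = A at *
    generalize -W.c₆/864 = B at *
    have : (x - y)^2 * ((((e - f) / (2 * (x - y))) ^ 2 - x - y) *
      (((e - -f) / (2 * (x - y))) ^ 2 - x - y)) = ((e^2 - f^2)^2 / (16 * (x-y)^2)
        - (x + y) * (e^2+f^2)/2 + (x+y)^2 * (x-y)^2) := by
      rw [show (16:F) = 2^4 by norm_num]
      field_simp
      ring
    rw [this, s1, s2]
    have : (4 * (x ^ 3 + A * x + B) - 4 * (y ^ 3 + A * y + B)) =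
      4 * (x - y) * (x^2+x*y+y^2+A) := by ring
    rw [this, show (16:F) = 2^4 by norm_num, show (4:F) = 2^2 by norm_num]
    field_simp
    ring
  · intro P hP h
    obtain ⟨h0, h1⟩ := pxx_dbl W h6 P hP h
    have s1 := peta_sq W h6 P hP
    rw [← s1, h1]
    field_simp
    linear_combination -2 * pxx W P * s1
  · intro P hP h e
    obtain ⟨h0, h1⟩ := pxx_dbl W h6 P hP h
    have s1 := peta_sq W h6 P hP
    rw [e, mul_zero] at s1
    exact h0 (by simpa using s1)
  · intro P hP
    exact ⟨_, peta_sq W h6 P hP⟩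

end

section
variable {F F' G G' : Type*} [Field F] [Field F'] [AddCommGroup G] [AddCommGroup G']
  {A B : F} {X : G → F}

theorem XSys.map (h : XSys A B X) (φ : F →+* F') :
    XSys (φ A) (φ B) (fun P => φ (X P)) := by
  refine ⟨fun P => by rw [h.neg], fun P Q hP hQ e => h.inj P Q hP hQ (φ.injective e), ?_, ?_, ?_,
    ?_, ?_⟩
  · intro P Q h1 h2 h3 h4
    have := congrArg φ (h.add_sum P Q h1 h2 h3 h4)
    simpa [map_ofNat] using this
  · intro P Q h1 h2 h3 h4
    have := congrArg φ (h.add_prod P Q h1 h2 h3 h4)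
    simpa [map_ofNat] using this
  · intro P h1 h2
    have := congrArg φ (h.dbl P h1 h2)
    simpa [map_ofNat] using this
  · intro P h1 h2 e
    apply h.f_ne P h1 h2
    apply φ.injective
    simpa using e
  · intro P h1
    obtain ⟨w, hw⟩ := h.sq P h1
    exact ⟨φ w, by simpa [map_ofNat] using congrArg φ hw⟩

theorem XSys.comp (h : XSys A B X) (e : G' →+ G) (he : Function.Injective e) :
    XSys A B (fun P => X (e P)) := by
  have e0 : ∀ P, P ≠ 0 → e P ≠ 0 := fun P hP => by
    rwa [Ne, map_eq_zero_iff e he]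
  refine ⟨fun P => by rw [map_neg, h.neg], ?_, ?_, ?_, ?_, ?_, ?_⟩
  · intro P Q h1 h2 h3
    rcases h.inj _ _ (e0 P h1) (e0 Q h2) h3 with r | r
    · exact Or.inl (he r)
    · exact Or.inr (he (by rw [r, map_neg]))
  · intro P Q h1 h2 h3 h4
    rw [map_add, map_sub]
    exact h.add_sum _ _ (e0 P h1) (e0 Q h2) (he.ne h3) (by rw [← map_neg]; exact he.ne h4)
  · intro P Q h1 h2 h3 h4
    rw [map_add, map_sub]
    exact h.add_prod _ _ (e0 P h1) (e0 Q h2) (he.ne h3) (by rw [← map_neg]; exact he.ne h4)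
  · intro P h1 h2
    rw [map_add]
    exact h.dbl _ (e0 P h1) (by rw [← map_add]; exact e0 _ h2)
  · intro P h1 h2
    exact h.f_ne _ (e0 P h1) (by rw [← map_add]; exact e0 _ h2)
  · intro P h1
    exact h.sq _ (e0 P h1)

theorem XSys.scale (h : XSys A B X) (u : F) (hu : u ≠ 0) :
    XSys (A / u ^ 4) (B / u ^ 6) (fun P => X P / u ^ 2) := by
  refine ⟨fun P => by rw [h.neg], fun P Q hP hQ e => h.inj P Q hP hQ ?_, ?_, ?_, ?_,
    ?_, ?_⟩
  · field_simp at e; exact e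
  · intro P Q h1 h2 h3 h4
    have := h.add_sum P Q h1 h2 h3 h4
    field_simp
    linear_combination this
  · intro P Q h1 h2 h3 h4
    have := h.add_prod P Q h1 h2 h3 h4
    field_simp
    linear_combination this
  · intro P h1 h2
    have := h.dbl P h1 h2
    field_simp
    linear_combination this
  · intro P h1 h2 e
    apply h.f_ne P h1 h2
    field_simp at e
    linear_combination e
  · intro P h1
    obtain ⟨w, hw⟩ := h.sq P h1
    refine ⟨w / u ^ 3, ?_⟩
    field_simp
    linear_combination hw
end
end

section
section
variable {K : Type*} [NormedField K] [IsUltrametricDist K]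

theorem na_le {x y : K} {r : ℝ} (hx : ‖x‖ ≤ r) (hy : ‖y‖ ≤ r) : ‖x + y‖ ≤ r :=
  (IsUltrametricDist.norm_add_le_max x y).trans (max_le hx hy)

theorem na_lt {x y : K} {r : ℝ} (hx : ‖x‖ < r) (hy : ‖y‖ < r) : ‖x + y‖ < r :=
  (IsUltrametricDist.norm_add_le_max x y).trans_lt (max_lt hx hy)

theorem na_sub_le {x y : K} {r : ℝ} (hx : ‖x‖ ≤ r) (hy : ‖y‖ ≤ r) : ‖x - y‖ ≤ r := by
  rw [sub_eq_add_neg]; exact na_le hx (by rwa [norm_neg])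

theorem na_sub_lt {x y : K} {r : ℝ} (hx : ‖x‖ < r) (hy : ‖y‖ < r) : ‖x - y‖ < r := by
  rw [sub_eq_add_neg]; exact na_lt hx (by rwa [norm_neg])

theorem na_eq {x y : K} (h : ‖y‖ < ‖x‖) : ‖x + y‖ = ‖x‖ := by
  rw [IsUltrametricDist.norm_add_eq_max_of_norm_ne_norm h.ne', max_eq_left h.le]

theorem na_eq_sub {x y : K} (h : ‖y‖ < ‖x‖) : ‖x - y‖ = ‖x‖ := by
  rw [sub_eq_add_neg]; exact na_eq (by rwa [norm_neg])

/-- closeness transports norms -/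
theorem na_eq' {x y : K} (h : ‖x - y‖ < ‖y‖) : ‖x‖ = ‖y‖ := by
  have := na_eq h
  rwa [add_sub_cancel] at this

theorem nm_le {x y : K} (hx : ‖x‖ ≤ 1) (hy : ‖y‖ ≤ 1) : ‖x * y‖ ≤ 1 := by
  rw [norm_mul]; exact mul_le_one₀ hx (norm_nonneg _) hy

theorem nm_lt {x y : K} (hx : ‖x‖ ≤ 1) (hy : ‖y‖ < 1) : ‖x * y‖ < 1 := by
  rw [norm_mul]
  calc ‖x‖ * ‖y‖ ≤ 1 * ‖y‖ := by gcongr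
    _ < 1 := by rwa [one_mul]

theorem nm_lt' {x y : K} (hx : ‖x‖ < 1) (hy : ‖y‖ ≤ 1) : ‖x * y‖ < 1 := by
  rw [mul_comm]; exact nm_lt hy hx

theorem np_le {x : K} (hx : ‖x‖ ≤ 1) (n : ℕ) : ‖x ^ n‖ ≤ 1 := by
  rw [norm_pow]; exact pow_le_one₀ (norm_nonneg _) hx

theorem nat_le (n : ℕ) : ‖(n : K)‖ ≤ 1 := IsUltrametricDist.norm_natCast_le_one K n

theorem ofNat_le (n : ℕ) [n.AtLeastTwo] : ‖(OfNat.ofNat n : K)‖ ≤ 1 := nat_le (K := K) n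

variable {G : Type*} [AddCommGroup G] {A B : K} {X : G → K}

theorem formal_dbl (h : XSys A B X) (hA : ‖A‖ ≤ 1) (hB : ‖B‖ ≤ 1) (h2 : ‖(2:K)‖ = 1)
    (P : G) (hP : P ≠ 0) (hP2 : P + P ≠ 0) (hf : 1 < ‖X P‖) : ‖X (P + P)‖ = ‖X P‖ := by
  have e := h.dbl P hP hP2
  set x := X P
  set r := ‖x‖
  have h4 : ‖(4:K)‖ = 1 := by
    rw [show (4:K) = 2 * 2 by norm_num, norm_mul, h2, one_mul]
  have hr : r < r ^ 3 := by
    have : r * 1 < r * r ^ 2 := by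
      have : 1 < r ^ 2 := by nlinarith
      gcongr
    nlinarith
  have hr4 : r ^ 2 < r ^ 4 := by nlinarith [mul_pos (show 0 < r by linarith) (sub_pos.2 hr)]
  have hAx : ‖A * x‖ ≤ r := by
    rw [norm_mul]; exact mul_le_of_le_one_left (norm_nonneg _) hA
  have f1 : ‖x ^ 3 + A * x + B‖ = r ^ 3 := by
    rw [add_assoc, na_eq, norm_pow]
    rw [norm_pow]
    exact (na_le hAx (hB.trans hf.le)).trans_lt hr
  have e' : (3 * x ^ 2 + A) ^ 2 - 8 * x * (x ^ 3 + A * x + B) = 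
    x ^ 4 + (A * (A - 2 * x ^ 2) - 8 * (B * x)) := by ring
  have f2 : ‖(3 * x ^ 2 + A) ^ 2 - 8 * x * (x ^ 3 + A * x + B)‖ = r ^ 4 := by
    rw [e', na_eq, norm_pow]
    rw [norm_pow]
    refine lt_of_le_of_lt ?_ hr4
    have hx1 : 1 ≤ r ^ 2 := by nlinarith
    apply na_sub_le
    · rw [norm_mul]
      have : ‖A - 2 * x ^ 2‖ ≤ r ^ 2 := na_sub_le (hA.trans hx1) (by
        rw [norm_mul, norm_pow, h2, one_mul])
      calc _ ≤ 1 * r ^ 2 := by gcongr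
        _ = _ := one_mul _
    · rw [norm_mul, norm_mul]
      have := ofNat_le (K := K) 8
      calc _ ≤ 1 * (1 * r) := by gcongr
        _ ≤ _ := by nlinarith
  have := congrArg norm e
  rw [f2, norm_mul, norm_mul, f1, h4, one_mul] at this
  have hr3 : (r ^ 3) ≠ 0 := by positivity
  apply mul_left_cancel₀ hr3
  rw [this]; ring

theorem formal_add (h : XSys A B X) (hA : ‖A‖ ≤ 1) (hB : ‖B‖ ≤ 1) 
    (P Q : G) (hP : P ≠ 0) (hQ : Q ≠ 0) (h1 : P ≠ Q) (h2 : P ≠ -Q) (hf : 1 < ‖X Q‖)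
    (hPQ : ‖X Q‖ ≤ ‖X P‖) : ‖X Q‖ ≤ ‖X (P + Q)‖ ∧ ‖X Q‖ ≤ ‖X (P - Q)‖ := by
  have e1 := h.add_sum P Q hP hQ h1 h2
  have e2 := h.add_prod P Q hP hQ h1 h2
  have hne : X P - X Q ≠ 0 := fun e => (h.inj P Q hP hQ (sub_eq_zero.1 e)).elim h1 h2
  set x := X P
  set y := X Q
  set a := X (P + Q)
  set b := X (P - Q)
  have h2 := ofNat_le (K := K) 2
  have h4 := ofNat_le (K := K) 4
  have hx1 : 1 < ‖x‖ := hf.trans_le hPQ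
  have hxy : 1 < ‖x‖ * ‖y‖ := by nlinarith
  have dpos : 0 < ‖x - y‖ := norm_pos_iff.2 hne
  have hxa : ‖x + y‖ ≤ ‖x‖ := na_le le_rfl hPQ
  have n2 : ‖(x * y - A) ^ 2 - 4 * B * (x + y)‖ = (‖x‖ * ‖y‖) ^ 2 := by
    have : ‖x * y - A‖ = ‖x‖ * ‖y‖ := by
      rw [na_eq_sub, norm_mul]
      rw [norm_mul]; linarith
    rw [na_eq_sub, norm_pow, this]
    rw [norm_pow, this, norm_mul, norm_mul]
    calc ‖(4:K)‖ * ‖B‖ * ‖x + y‖ ≤ 1 * 1 * ‖x‖ := by gcongr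
      _ < _ := by nlinarith
  have n1 : ‖2 * ((x + y) * (A + x * y) + 2 * B)‖ ≤ ‖x‖ ^ 2 * ‖y‖ := by
    have : ‖A + x * y‖ ≤ ‖x‖ * ‖y‖ := na_le (by linarith) (norm_mul _ _).le
    rw [norm_mul]
    have q : ‖(x + y) * (A + x * y) + 2 * B‖ ≤ ‖x‖ ^ 2 * ‖y‖ := by
      apply na_le
      · rw [norm_mul]
        calc _ ≤ ‖x‖ * (‖x‖ * ‖y‖) := by gcongr
          _ = _ := by ring
      · rw [norm_mul]
        have q1 : ‖(2:K)‖ * ‖B‖ ≤ 1 := mul_le_one₀ h2 (norm_nonneg _) hB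
        have q2 : 1 ≤ ‖x‖ ^ 2 * ‖y‖ := by nlinarith
        exact q1.trans q2
    calc _ ≤ 1 * (‖x‖ ^ 2 * ‖y‖) := by gcongr
      _ = _ := one_mul _
  rw [← e1, norm_mul, norm_pow] at n1
  rw [← e2, norm_mul, norm_pow, norm_mul] at n2
  have dle : ‖x - y‖ ≤ ‖x‖ := na_sub_le le_rfl hPQ
  have key : ∀ a b : K, ‖x - y‖ ^ 2 * ‖a + b‖ ≤ ‖x‖ ^ 2 * ‖y‖ →
      ‖x - y‖ ^ 2 * (‖a‖ * ‖b‖) = (‖x‖ * ‖y‖) ^ 2 → ‖y‖ ≤ ‖a‖ := by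
    intro a b n1 n2
    by_contra! hlt
    rcases lt_or_ge ‖a‖ ‖b‖ with hab | hab
    · rw [add_comm, na_eq hab] at n1
      have hb : 0 < ‖b‖ := (norm_nonneg a).trans_lt hab
      have : ‖x - y‖ ^ 2 * (‖a‖ * ‖b‖) ≤ ‖x‖ ^ 2 * ‖y‖ * ‖a‖ := by
        calc _ = (‖x - y‖ ^ 2 * ‖b‖) * ‖a‖ := by ring
          _ ≤ _ := by gcongr
      have q : ‖x‖ ^ 2 * ‖y‖ * ‖a‖ < ‖x‖ ^ 2 * ‖y‖ * ‖y‖ := by gcongr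
      nlinarith
    · have : ‖x - y‖ ^ 2 * (‖a‖ * ‖b‖) ≤ ‖x‖ ^ 2 * (‖a‖ * ‖a‖) := by gcongr
      have q : ‖x‖ ^ 2 * (‖a‖ * ‖a‖) < ‖x‖ ^ 2 * (‖y‖ * ‖y‖) := by gcongr
      nlinarith
  exact ⟨key a b n1 n2, key b a (by rwa [add_comm]) (by rwa [mul_comm ‖b‖])⟩

/-- the filtration subgroup -/
theorem formal_mem_add (h : XSys A B X) (hA : ‖A‖ ≤ 1) (hB : ‖B‖ ≤ 1) (h2 : ‖(2:K)‖ = 1)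
    {r : ℝ} (hr : 1 < r) (P Q : G) (hP : P = 0 ∨ r ≤ ‖X P‖) (hQ : Q = 0 ∨ r ≤ ‖X Q‖) :
    P + Q = 0 ∨ r ≤ ‖X (P + Q)‖ := by
  by_cases hP0 : P = 0
  · subst hP0; simpa using hQ
  by_cases hQ0 : Q = 0
  · subst hQ0; simpa using hP
  have hP := hP.resolve_left hP0
  have hQ := hQ.resolve_left hQ0
  by_cases h0 : P + Q = 0
  · exact Or.inl h0
  right
  by_cases h1 : P = Q
  · subst h1
    rw [formal_dbl h hA hB h2 P hP0 h0 (hr.trans_le hP)]; exact hP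
  have h3 : P ≠ -Q := fun e => h0 (by rw [e, neg_add_cancel])
  rcases le_total ‖X Q‖ ‖X P‖ with hle | hle
  · exact hQ.trans (formal_add h hA hB P Q hP0 hQ0 h1 h3 (hr.trans_le hQ) hle).1
  · rw [add_comm]
    exact hP.trans (formal_add h hA hB Q P hQ0 hP0 (Ne.symm h1)
      (fun e => h3 (by rw [e, neg_neg])) (hr.trans_le hP) hle).1

end

section
variable {K : Type*} [NormedField K] [IsUltrametricDist K]
variable {p : ℕ} [Fact p.Prime] {G : Type*} [AddCommGroup G] [Module (ZMod p) G] {A B : K} {X : G → K}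

/-- filtration as a submodule -/
def Fil (h : XSys A B X) (hA : ‖A‖ ≤ 1) (hB : ‖B‖ ≤ 1) (h2 : ‖(2:K)‖ = 1)
    (r : ℝ) (hr : 1 < r) : Submodule (ZMod p) G :=
  AddSubgroup.toZModSubmodule p
  { carrier := {P | P = 0 ∨ r ≤ ‖X P‖}
    zero_mem' := Or.inl rfl
    add_mem' := fun {a b} ha hb => formal_mem_add h hA hB h2 hr a b ha hb
    neg_mem' := fun {a} ha => by
      simp only [Set.mem_setOf_eq, neg_eq_zero, h.neg] at *; exact ha }

theorem mem_Fil (h : XSys A B X) (hA : ‖A‖ ≤ 1) (hB : ‖B‖ ≤ 1) (h2 : ‖(2:K)‖ = 1)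
    (r : ℝ) (hr : 1 < r) (P : G) :
    P ∈ Fil (p := p) h hA hB h2 r hr ↔ P = 0 ∨ r ≤ ‖X P‖ := Iff.rfl

theorem formal_smul (h : XSys A B X) (hA : ‖A‖ ≤ 1) (hB : ‖B‖ ≤ 1) (h2 : ‖(2:K)‖ = 1)
    (P : G) (hP : P ≠ 0) (hf : 1 < ‖X P‖) (c : ZMod p) (hc : c ≠ 0) : ‖X (c • P)‖ = ‖X P‖ := by
  have key : ∀ (P : G), P ≠ 0 → 1 < ‖X P‖ → ∀ c : ZMod p, c ≠ 0 → ‖X P‖ ≤ ‖X (c • P)‖ := by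
    intro P hP hf c hc
    have := (Fil (p := p) h hA hB h2 ‖X P‖ hf).smul_mem c
      ((mem_Fil h hA hB h2 _ hf P).2 (Or.inr le_rfl))
    rw [mem_Fil] at this
    exact this.resolve_left (smul_ne_zero hc hP)
  apply le_antisymm _ (key P hP hf c hc)
  have := key (c • P) (smul_ne_zero hc hP) (hf.trans_le (key P hP hf c hc)) c⁻¹ (inv_ne_zero hc)
  rwa [smul_smul, inv_mul_cancel₀ hc, one_smul] at this

theorem formal_of_smul (h : XSys A B X) (hA : ‖A‖ ≤ 1) (hB : ‖B‖ ≤ 1) (h2 : ‖(2:K)‖ = 1)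
    (P : G) (hP : P ≠ 0) (c : ZMod p) (hc : c ≠ 0) (hf : 1 < ‖X (c • P)‖) : 1 < ‖X P‖ := by
  have := formal_smul h hA hB h2 (c • P) (smul_ne_zero hc hP) hf c⁻¹ (inv_ne_zero hc)
  rw [smul_smul, inv_mul_cancel₀ hc, one_smul] at this
  rwa [this]

/-- a nonformal point does not reduce to a nonsingular two-torsion point -/
theorem nonformal_e (h : XSys A B X) (hA : ‖A‖ ≤ 1) (hB : ‖B‖ ≤ 1) (h2 : ‖(2:K)‖ = 1)
    (hp : p ≠ 2) (P : G) (hP : P ≠ 0) (hf : ‖X P‖ ≤ 1) (e : K) (he : ‖e‖ ≤ 1)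
    (he0 : e ^ 3 + A * e + B = 0) (he1 : ‖3 * e ^ 2 + A‖ = 1) : ‖e - X P‖ = 1 := by
  by_contra hne
  have hlt : ‖X P - e‖ < 1 := by
    rw [norm_sub_rev]; exact lt_of_le_of_ne (na_sub_le he hf) hne
  have hP2 : P + P ≠ 0 := by
    have : (2 : ZMod p) ≠ 0 := by
      intro e
      have : ((2:ℕ) : ZMod p) = 0 := by exact_mod_cast e
      rw [ZMod.natCast_eq_zero_iff] at this
      exact hp ((Nat.prime_dvd_prime_iff_eq Fact.out Nat.prime_two).1 this)
    rw [← two_smul (ZMod p)]; exact smul_ne_zero this hP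
  have h20 : (2 : ZMod p) ≠ 0 := by
    intro e; apply hP2; rw [← two_smul (ZMod p), e, zero_smul]
  have dd := h.dbl P hP hP2
  have hnf : ‖X (P + P)‖ ≤ 1 := by
    by_contra! hh
    rw [← two_smul (ZMod p)] at hh
    exact absurd (formal_of_smul h hA hB h2 P hP 2 h20 hh) (not_lt.2 hf)
  set x := X P
  have h3 := ofNat_le (K := K) 3
  have h4 := ofNat_le (K := K) 4
  have h8 := ofNat_le (K := K) 8
  have f1 : ‖x ^ 3 + A * x + B‖ < 1 := by
    have : x ^ 3 + A * x + B = (x^2 + x * e + e^2 + A) * (x - e) := by linear_combination he0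
    rw [this]
    exact nm_lt (na_le (na_le (na_le (np_le hf 2) (nm_le hf he)) (np_le he 2)) hA) hlt
  have f2 : ‖3 * x ^ 2 + A‖ = 1 := by
    rw [← he1]; apply na_eq'
    rw [he1, show 3 * x ^ 2 + A - (3 * e ^ 2 + A) = 3 * (x + e) * (x - e) by ring]
    exact nm_lt (nm_le h3 (na_le hf he)) hlt
  have : ‖(3 * x ^ 2 + A) ^ 2‖ < 1 := by
    rw [show (3 * x ^ 2 + A) ^ 2 = 4 * (x ^ 3 + A * x + B) * X (P + P) +
      8 * x * (x ^ 3 + A * x + B) by rw [dd]; ring]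
    exact na_lt (nm_lt' (nm_lt h4 f1) hnf) (nm_lt (nm_le h8 hf) f1)
  rw [norm_pow, f2] at this
  norm_num at this

end
end

section
section
variable {K : Type*} [NormedField K] [IsUltrametricDist K] 

theorem preNormEDS'_zero_norm {c d : K} (hc : ‖c‖ = 1) (n : ℕ) (hn : Odd n) :
    ‖preNormEDS' 0 c d n‖ = 1 := by
  induction n using Nat.strong_induction_on with
  | _ n ih =>
    obtain ⟨m, rfl⟩ := hn
    match m, ih with
    | 0, _ => simp
    | 1, _ => simpa using hc
    | (m+2), ih =>
      rw [preNormEDS'_odd]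
      rcases Nat.even_or_odd m with hm | hm
      · simp only [hm, if_true, mul_zero, zero_sub, mul_one, norm_neg, norm_mul, norm_pow]
        rw [ih (m+1) (by omega) hm.add_one, ih (m+3) (by omega) (hm.add_odd (by decide))]; norm_num
      · simp only [Nat.not_even_iff_odd.2 hm, if_false, mul_zero, sub_zero, mul_one, norm_mul, norm_pow]
        rw [ih (m+2) (by omega) (hm.add_even (by decide)), ih (m+4) (by omega) (hm.add_even (by decide))]
        norm_num

variable [IsAlgClosed K] {A B : K} 

theorem exists_e (hA : ‖A‖ ≤ 1) (hB : ‖B‖ ≤ 1) (hAB : ‖A‖ = 1 ∨ ‖B‖ = 1) (h3 : ‖(3:K)‖ = 1) :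
    ∃ e : K, ‖e‖ ≤ 1 ∧ e ^ 3 + A * e + B = 0 ∧ ‖3 * e ^ 2 + A‖ = 1 := by
  have hInteg : ∀ e : K, e ^ 3 + A * e + B = 0 → ‖e‖ ≤ 1 := by
    intro e he
    by_contra! h
    have : e ^ 3 = - (A * e + B) := by linear_combination he
    have h1 : ‖A * e + B‖ ≤ ‖e‖ := na_le (by
      rw [norm_mul]; exact mul_le_of_le_one_left (norm_nonneg _) hA) (hB.trans h.le)
    have := congrArg norm this
    rw [norm_neg, norm_pow] at this
    nlinarith [mul_pos (show 0 < ‖e‖ by linarith) (show 0 < ‖e‖^2 - 1 by nlinarith)]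
  obtain ⟨e1, he1⟩ : ∃ e : K, e ^ 3 + A * e + B = 0 := by
    open Polynomial in
    obtain ⟨e, he⟩ := IsAlgClosed.exists_root (Polynomial.X ^ 3 + C A * Polynomial.X + C B : K[X]) (by
      have : (Polynomial.X ^ 3 + C A * Polynomial.X + C B : K[X]).degree = 3 := by compute_degree!
      rw [this]; decide)
    exact ⟨e, by simpa using he⟩
  obtain ⟨e2, he2⟩ : ∃ e : K, e ^ 2 + e1 * e + (e1 ^ 2 + A) = 0 := by
    open Polynomial in
    obtain ⟨e, he⟩ := IsAlgClosed.exists_root (Polynomial.X ^ 2 + C e1 * Polynomial.X + C (e1 ^ 2 + A) : K[X]) (by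
      have : (Polynomial.X ^ 2 + C e1 * Polynomial.X + C (e1 ^ 2 + A) : K[X]).degree = 2 := by compute_degree!
      rw [this]; decide)
    exact ⟨e, by simpa using he⟩
  obtain ⟨e3, he3⟩ : ∃ e3, e3 = - e1 - e2 := ⟨_, rfl⟩
  have hA' : A = e1 * e2 + e1 * e3 + e2 * e3 := by rw [he3]; linear_combination he2
  have hB' : B = - (e1 * e2 * e3) := by rw [he3]; linear_combination he1 - e1 * he2
  have hf2 : e2 ^ 3 + A * e2 + B = 0 := by rw [hA', hB', he3]; ring
  have hf3 : e3 ^ 3 + A * e3 + B = 0 := by rw [hA', hB', he3]; ring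
  have n1 := hInteg e1 he1
  have n2 := hInteg e2 hf2
  have n3 := hInteg e3 hf3
  have key : ∀ a b c : K, ‖a‖ ≤ 1 → ‖b‖ ≤ 1 → ‖c‖ ≤ 1 → c = - a - b → A = a * b + a * c + b * c →
      B = - (a * b * c) → ‖a - b‖ < 1 → ‖3 * c ^ 2 + A‖ = 1 := by
    intro a b c ha hb hc hs hA' hB' hab
    by_contra hne
    have hall : ‖c - a‖ < 1 ∨ ‖c - b‖ < 1 := by
      by_contra! hh
      apply hne
      rw [show 3 * c ^ 2 + A = (c - a) * (c - b) by rw [hA', hs]; ring, norm_mul,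
        le_antisymm (na_sub_le hc ha) hh.1, le_antisymm (na_sub_le hc hb) hh.2, one_mul]
    have hca : ‖c - a‖ < 1 := by
      rcases hall with h | h
      · exact h
      · rw [show c - a = (c - b) - (a - b) by ring]; exact na_sub_lt h hab
    have ha' : ‖a‖ < 1 := by
      have : ‖3 * a‖ < 1 := by
        rw [show 3 * a = (a - b) - (c - a) by rw [hs]; ring]; exact na_sub_lt hab hca
      rwa [norm_mul, h3, one_mul] at this
    have hA1 : ‖A‖ < 1 := by
      have hb' : ‖b‖ < 1 := by
        rw [show b = a - (a - b) by ring]; exact na_sub_lt ha' hab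
      rw [hA']; exact na_lt (na_lt (nm_lt' ha' hb) (nm_lt' ha' hc)) (nm_lt' hb' hc)
    have hB1 : ‖B‖ < 1 := by
      rw [hB', norm_neg]; exact nm_lt' (nm_lt' ha' hb) hc
    rcases hAB with h | h <;> linarith
  by_cases h12 : ‖e1 - e2‖ < 1
  · exact ⟨e3, n3, hf3, key e1 e2 e3 n1 n2 n3 he3 hA' hB' h12⟩
  by_cases h13 : ‖e1 - e3‖ < 1
  · exact ⟨e2, n2, hf2, key e1 e3 e2 n1 n3 n2 (by rw [he3]; ring) (by rw [hA']; ring)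
      (by rw [hB']; ring) h13⟩
  refine ⟨e1, n1, he1, ?_⟩
  rw [show 3 * e1 ^ 2 + A = (e1 - e2) * (e1 - e3) by rw [hA', he3]; ring, norm_mul,
    le_antisymm (na_sub_le n1 n2) (not_lt.1 h12), le_antisymm (na_sub_le n1 n3) (not_lt.1 h13), one_mul]

end

section
variable {K : Type*} [Field K] [CharZero K]
variable {p : ℕ} [Fact p.Prime] {G : Type*} [AddCommGroup G] [Module (ZMod p) G] {A B : K} {X : G → K}

theorem two_ne_zmod (hp : 5 ≤ p) : (2 : ZMod p) ≠ 0 := by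
  intro e
  have : ((2:ℕ) : ZMod p) = 0 := by exact_mod_cast e
  rw [ZMod.natCast_eq_zero_iff] at this
  have := Nat.le_of_dvd (by norm_num) this
  omega

theorem neg_ne_of (hp : 5 ≤ p) {P : G} (hP : P ≠ 0) : P ≠ -P := by
  intro e
  have : (2 : ZMod p) • P = 0 := by rw [two_smul]; nth_rewrite 1 [e]; exact neg_add_cancel P
  exact smul_ne_zero (two_ne_zmod hp) hP this

open Classical in
theorem fiber_two (h : XSys A B X) (hp : 5 ≤ p) [Fintype G] (S : Finset G) (hS : ∀ P ∈ S, -P ∈ S) 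
    (h0 : (0:G) ∉ S) (P : G) (hP : P ∈ S) : (S.filter (fun Q => X Q = X P)).card = 2 := by
  have hP0 : P ≠ 0 := fun e => h0 (e ▸ hP)
  have : S.filter (fun Q => X Q = X P) = {P, -P} := by
    ext Q
    simp only [Finset.mem_filter, Finset.mem_insert, Finset.mem_singleton]
    constructor
    · rintro ⟨hQ, e⟩
      exact h.inj Q P (fun e => h0 (e ▸ hQ)) hP0 e
    · rintro (rfl | rfl)
      · exact ⟨hP, rfl⟩
      · exact ⟨hS _ hP, h.neg _⟩
  rw [this, Finset.card_pair (neg_ne_of hp hP0)]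

open Classical in
theorem eval_sq (h : XSys A B X) (hp : 5 ≤ p) [Fintype G] (hG : Fintype.card G = p ^ 2) (t : K) :
    (((⟨0, 0, 0, A, B⟩ : WeierstrassCurve K).preΨ' p).eval t) ^ 2 =
      (p:K) ^ 2 * ∏ v ∈ Finset.univ.erase (0:G), (t - X v) := by
  have hpp : p.Prime := Fact.out
  set Ψ := (⟨0, 0, 0, A, B⟩ : WeierstrassCurve K).preΨ' p with hΨ
  have hodd : Odd p := hpp.odd_of_ne_two (by omega)
  have hp0 : (p:K) ≠ 0 := by exact_mod_cast hpp.ne_zero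
  set T := Finset.univ.erase (0:G)
  have hT0 : (0:G) ∉ T := by simp [T]
  have hTn : ∀ P ∈ T, -P ∈ T := by simp [T]
  have hfib : ∀ s ∈ T.image X, (T.filter (fun Q => X Q = s)).card = 2 := by
    intro s hs
    obtain ⟨P, hP, rfl⟩ := Finset.mem_image.1 hs
    exact fiber_two h hp T hTn hT0 P hP
  have hcard : 2 * (T.image X).card = p ^ 2 - 1 := by
    have : T.card = p ^ 2 - 1 := by
      rw [Finset.card_erase_of_mem (Finset.mem_univ _), Finset.card_univ, hG]
    rw [← this, Finset.card_eq_sum_card_image X T, Finset.sum_congr rfl hfib]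
    simp [mul_comm]
  have hdeg : Ψ.natDegree = (T.image X).card := by
    rw [hΨ, WeierstrassCurve.natDegree_preΨ' _ hp0]
    simp only [Nat.not_even_iff_odd.2 hodd, if_false]
    omega
  have hlead : Ψ.leadingCoeff = p := by
    rw [hΨ, WeierstrassCurve.leadingCoeff_preΨ' _ hp0]
    simp [Nat.not_even_iff_odd.2 hodd]
  have hΨ0 : Ψ ≠ 0 := by
    intro e; rw [e] at hlead; simp at hlead; exact hp0 hlead.symm
  have hroots : (T.image X).val = Ψ.roots := by
    apply Multiset.eq_of_le_of_card_le
    · rw [Multiset.le_iff_subset (T.image X).nodup]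
      intro s hs
      obtain ⟨P, hP, rfl⟩ := Finset.mem_image.1 hs
      rw [Polynomial.mem_roots hΨ0]
      refine h.root (by norm_num) hpp hp P (fun e => hT0 (e ▸ hP)) ?_
      rw [← Nat.cast_smul_eq_nsmul (ZMod p), ZMod.natCast_self, zero_smul]
    · exact (Polynomial.card_roots' Ψ).trans hdeg.le
  have := Polynomial.C_leadingCoeff_mul_prod_multiset_X_sub_C (p := Ψ) (by
    rw [← hroots]; exact hdeg.symm)
  rw [← this, hlead, ← hroots]
  have e2 : ∏ v ∈ T, (t - X v) = ∏ s ∈ T.image X, (t - s) ^ 2 := by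
    rw [Finset.prod_comp (fun s => t - s) X]
    exact Finset.prod_congr rfl fun s hs => by rw [hfib s hs]
  rw [e2, Finset.prod_pow, ← mul_pow]
  congr 1
  simp only [Polynomial.eval_mul, Polynomial.eval_C, Polynomial.eval_multiset_prod, Multiset.map_map]
  congr 1
  simp [Finset.prod]

end

section
variable {K : Type*} [NormedField K] [IsUltrametricDist K] [IsAlgClosed K] [CharZero K]
variable {p : ℕ} [Fact p.Prime] {G : Type*} [AddCommGroup G] [Module (ZMod p) G] {A B : K} {X : G → K}

open Classical in
theorem prod_formal (h : XSys A B X) (hA : ‖A‖ ≤ 1) (hB : ‖B‖ ≤ 1) (hAB : ‖A‖ = 1 ∨ ‖B‖ = 1)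
    (h2 : ‖(2:K)‖ = 1) (h3 : ‖(3:K)‖ = 1) (hp : 5 ≤ p) [Fintype G] (hG : Fintype.card G = p ^ 2) :
    ‖(p:K)‖ ^ 2 * ∏ v ∈ Finset.univ.erase (0:G), max 1 ‖X v‖ = 1 := by
  obtain ⟨e, he, he0, he1⟩ := exists_e hA hB hAB h3
  have key := congrArg norm (eval_sq h hp hG e)
  rw [preΨ'_eval, he0, mul_zero, zero_pow two_ne_zero] at key
  have h1 : ‖3 * e ^ 4 + 6 * A * e ^ 2 + 12 * B * e - A ^ 2‖ = 1 := by
    rw [show 3 * e ^ 4 + 6 * A * e ^ 2 + 12 * B * e - A ^ 2 = - (3 * e ^ 2 + A) ^ 2 by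
      linear_combination 12 * e * he0, norm_neg, norm_pow, he1, one_pow]
  rw [norm_pow, preNormEDS'_zero_norm h1 p ((Fact.out : p.Prime).odd_of_ne_two (by omega)), one_pow,
    norm_mul, norm_pow, norm_prod] at key
  refine Eq.trans ?_ key.symm
  congr 1
  apply Finset.prod_congr rfl
  intro v hv
  have hv0 : v ≠ 0 := by simpa using hv
  rcases le_or_gt ‖X v‖ 1 with hle | hgt
  · rw [max_eq_left hle, nonformal_e (p := p) h hA hB h2 (by omega) v hv0 hle e he he0 he1]
  · rw [max_eq_right hgt.le, norm_sub_rev, na_eq_sub (by linarith)]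

end
end

section
section
variable {p : ℕ} [Fact p.Prime]

/-- log-norm -/
noncomputable def lv (x : PadicAlgCl p) : ℝ := Real.logb p ‖x‖

theorem p_one_lt : (1:ℝ) < p := by exact_mod_cast (Fact.out : p.Prime).one_lt

theorem lv_mul {x y : PadicAlgCl p} (hx : x ≠ 0) (hy : y ≠ 0) : lv (x * y) = lv x + lv y := by
  rw [lv, norm_mul, Real.logb_mul (norm_ne_zero_iff.2 hx) (norm_ne_zero_iff.2 hy)]; rfl

theorem lv_div {x y : PadicAlgCl p} (hx : x ≠ 0) (hy : y ≠ 0) : lv (x / y) = lv x - lv y := by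
  rw [lv, norm_div, Real.logb_div (norm_ne_zero_iff.2 hx) (norm_ne_zero_iff.2 hy)]; rfl

theorem lv_pow (x : PadicAlgCl p) (n : ℕ) : lv (x ^ n) = n * lv x := by
  rw [lv, norm_pow, Real.logb_pow]; rfl

theorem lv_prod {ι : Type*} (s : Finset ι) (f : ι → PadicAlgCl p) (hf : ∀ i ∈ s, f i ≠ 0) :
    lv (∏ i ∈ s, f i) = ∑ i ∈ s, lv (f i) := by
  rw [lv, norm_prod, Real.logb_prod]; rfl
  intro i hi; exact norm_ne_zero_iff.2 (hf i hi)

theorem norm_gal (σ : PadicAlgCl p ≃ₐ[ℚ_[p]] PadicAlgCl p) (x : PadicAlgCl p) : ‖σ x‖ = ‖x‖ :=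
  (spectralNorm_eq_of_equiv σ x).symm

theorem lv_coe (q : ℚ_[p]) (hq : q ≠ 0) : ∃ n : ℤ, lv (algebraMap ℚ_[p] (PadicAlgCl p) q) = n := by
  refine ⟨-q.valuation, ?_⟩
  rw [lv, show ‖algebraMap ℚ_[p] (PadicAlgCl p) q‖ = ‖q‖ from PadicAlgCl.norm_extends p q,
    Padic.norm_eq_zpow_neg_valuation hq, ← Real.rpow_intCast, Real.logb_rpow (by linarith [p_one_lt (p := p)])
    (p_one_lt (p := p)).ne']

theorem norm_p : ‖(p : PadicAlgCl p)‖ = (p:ℝ)⁻¹ := by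
  have := PadicAlgCl.norm_extends p (p : ℚ_[p])
  rw [Padic.norm_p] at this
  rw [← this]; congr 1

theorem norm_nat_one (n : ℕ) (hn : ¬ p ∣ n) : ‖(n : PadicAlgCl p)‖ = 1 := by
  have := PadicAlgCl.norm_extends p (n : ℚ_[p])
  rw [← map_natCast (algebraMap ℚ_[p] (PadicAlgCl p)) n]
  refine this.trans ?_
  rw [Padic.norm_natCast_eq_one_iff]
  exact (((Fact.out : p.Prime).coprime_iff_not_dvd).2 hn)

theorem exists_coe_of_fixed (x : PadicAlgCl p) (h : ∀ σ : PadicAlgCl p ≃ₐ[ℚ_[p]] PadicAlgCl p, σ x = x) :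
    ∃ q : ℚ_[p], algebraMap _ _ q = x := by
  have := (InfiniteGalois.mem_bot_iff_fixed (k := ℚ_[p]) x).2 h
  exact IntermediateField.mem_bot.1 this

theorem gal_sum (S : Finset (PadicAlgCl p)) (h0 : (0 : PadicAlgCl p) ∉ S)
    (hS : ∀ σ : PadicAlgCl p ≃ₐ[ℚ_[p]] PadicAlgCl p, ∀ s ∈ S, σ s ∈ S) :
    ∃ n : ℤ, ∑ s ∈ S, lv s = n := by
  classical
  have hne : ∀ s ∈ S, s ≠ 0 := fun s hs e => h0 (e ▸ hs)
  obtain ⟨q, hq⟩ := exists_coe_of_fixed (∏ s ∈ S, s) (by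
    intro σ
    rw [map_prod]
    have : S.image σ = S := Finset.eq_of_subset_of_card_le
      (fun y hy => by obtain ⟨s, hs, rfl⟩ := Finset.mem_image.1 hy; exact hS σ s hs)
      (by rw [Finset.card_image_of_injective _ σ.injective])
    conv_rhs => rw [← this]
    rw [Finset.prod_image (fun a _ b _ e => σ.injective e)])
  have hq0 : q ≠ 0 := by
    rintro rfl
    rw [map_zero] at hq
    exact Finset.prod_ne_zero_iff.2 hne hq.symm
  obtain ⟨n, hn⟩ := lv_coe q hq0
  exact ⟨n, by rw [← hn, hq, lv_prod _ _ hne]⟩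

theorem card_pow_one {H : Type*} [CommGroup H] [Fintype H] [IsCyclic H] [DecidableEq H] (d : ℕ)
    (hd : d ∣ Fintype.card H) : (Finset.univ.filter (fun a : H => a ^ d = 1)).card = d := by
  rw [← Nat.card_eq_fintype_card] at hd
  have h := IsCyclic.card_powMonoidHom_ker (G := H) d
  rw [Nat.gcd_eq_right hd] at h
  refine Eq.trans ?_ h
  rw [← Nat.card_eq_finsetCard]
  apply Nat.card_congr
  exact Equiv.subtypeEquivRight (fun a => by simp [MonoidHom.mem_ker])

theorem gal_sum6 {H : Type*} [CommGroup H] [Fintype H] [IsCyclic H] (h6 : 6 ∣ Fintype.card H)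
    (y : H → PadicAlgCl p) (hy : ∀ a b, y a = y b ↔ (a / b) ^ 6 = 1) (h0 : ∀ a, y a ≠ 0)
    (hS : ∀ σ : PadicAlgCl p ≃ₐ[ℚ_[p]] PadicAlgCl p, ∀ a, ∃ b, σ (y a) = y b) :
    ∃ n : ℤ, ∑ a, lv (y a) = 6 * n := by
  classical
  obtain ⟨n, hn⟩ := gal_sum (Finset.univ.image y) (by simpa using h0) (by
    intro σ s hs
    obtain ⟨a, -, rfl⟩ := Finset.mem_image.1 hs
    obtain ⟨b, hb⟩ := hS σ a
    rw [hb]; simp)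
  refine ⟨n, ?_⟩
  rw [Finset.sum_comp lv y, ← hn, Finset.mul_sum]
  apply Finset.sum_congr rfl
  intro s hs
  obtain ⟨b, -, rfl⟩ := Finset.mem_image.1 hs
  have : (Finset.univ.filter (fun a => y a = y b)).card = 6 := by
    rw [← card_pow_one (H := H) 6 h6]
    apply Finset.card_bij (fun a _ => a / b)
    · intro a ha; simpa [hy] using ha
    · intro a _ a' _ e; simpa using e
    · intro c hc
      refine ⟨c * b, ?_, by simp⟩
      simpa [hy] using hc
  rw [this]; simp

theorem sum_surj {A B : Type*} [Group A] [Group B] [Fintype A] [Fintype B] (θ : A →* B)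
    (hθ : Function.Surjective θ) (g : B → ℝ) :
    (Fintype.card B : ℝ) * ∑ a, g (θ a) = (Fintype.card A : ℝ) * ∑ b, g b := by
  classical
  set c := (Finset.univ.filter (fun a => θ a = 1)).card with hc
  have hf : ∀ b, (Finset.univ.filter (fun a => θ a = b)).card = c := fun b =>
    MonoidHom.card_fiber_eq_of_mem_range θ (hθ b) ⟨1, map_one θ⟩
  have h1 : ∀ g : B → ℝ, ∑ a, g (θ a) = c * ∑ b, g b := by
    intro g
    rw [Finset.sum_comp g θ, Finset.image_univ_of_surjective hθ, Finset.mul_sum]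
    exact Finset.sum_congr rfl fun b _ => by rw [hf, nsmul_eq_mul]
  have h2 := h1 (fun _ => 1)
  simp at h2
  rw [h1, h2]; ring

end
end

section
structure Core (p : ℕ) [Fact p.Prime] (L : Type) [Field L] [Fintype L] [Algebra (ZMod p) L]
    (x X : L → PadicAlgCl p) (k : ℕ) (q : ℚ_[p]) (t A B : PadicAlgCl p) : Prop where
  hp5 : 5 ≤ p
  card : Fintype.card L = p ^ 2
  gal : ∀ σ : PadicAlgCl p ≃ₐ[ℚ_[p]] PadicAlgCl p, ∃ c : L, c ≠ 0 ∧
    ((∀ u ≠ 0, σ (x u) = x (c ^ 3 * u)) ∨ (∀ u ≠ 0, σ (x u) = x ((c ^ 3 * u) ^ p)))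
  sys : XSys A B X
  hx : ∀ u, x u = X u * t
  ht : t ≠ 0
  htq : t ^ k = algebraMap ℚ_[p] (PadicAlgCl p) q
  hBq : ∃ b : ℚ_[p], B * t ^ 3 = algebraMap ℚ_[p] (PadicAlgCl p) b
  hk : (k = 2 ∧ A = 1 ∧ ‖B‖ ≤ 1) ∨ (k = 3 ∧ B = 1 ∧ ‖A‖ < 1)

namespace Core
variable {p : ℕ} [Fact p.Prime] {L : Type} [Field L] [Fintype L] [DecidableEq L] [Algebra (ZMod p) L]
    {x X : L → PadicAlgCl p} {k : ℕ} {q : ℚ_[p]} {t A B : PadicAlgCl p}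

theorem hA (h : Core p L x X k q t A B) : ‖A‖ ≤ 1 := by
  rcases h.hk with ⟨_, h, _⟩ | ⟨_, _, h⟩
  · rw [h, norm_one]
  · exact h.le

theorem hB (h : Core p L x X k q t A B) : ‖B‖ ≤ 1 := by
  rcases h.hk with ⟨_, _, h⟩ | ⟨_, h, _⟩
  · exact h
  · rw [h, norm_one]

theorem hAB (h : Core p L x X k q t A B) : ‖A‖ = 1 ∨ ‖B‖ = 1 := by
  rcases h.hk with ⟨_, h, _⟩ | ⟨_, h, _⟩
  · left; rw [h, norm_one]
  · right; rw [h, norm_one]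

theorem n2 (h : Core p L x X k q t A B) : ‖(2 : PadicAlgCl p)‖ = 1 := by
  have := h.hp5
  exact_mod_cast norm_nat_one (p := p) 2 (fun e => by have := Nat.le_of_dvd (by norm_num) e; omega)

theorem n3 (h : Core p L x X k q t A B) : ‖(3 : PadicAlgCl p)‖ = 1 := by
  have := h.hp5
  exact_mod_cast norm_nat_one (p := p) 3 (fun e => by have := Nat.le_of_dvd (by norm_num) e; omega)

theorem k_pos (h : Core p L x X k q t A B) : 0 < k := by
  rcases h.hk with ⟨h, _⟩ | ⟨h, _⟩ <;> omega

theorem hq (h : Core p L x X k q t A B) : q ≠ 0 := by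
  rintro rfl
  have := h.htq
  rw [map_zero] at this
  exact h.ht (pow_eq_zero_iff h.k_pos.ne' |>.1 this)

theorem lvt (h : Core p L x X k q t A B) : ∃ n : ℤ, k * lv t = n := by
  obtain ⟨n, hn⟩ := lv_coe q h.hq
  exact ⟨n, by rw [← hn, ← h.htq, lv_pow]⟩

theorem lvx (h : Core p L x X k q t A B) {u : L} (hu : X u ≠ 0) : lv (x u) = lv (X u) + lv t := by
  rw [h.hx, lv_mul hu h.ht]

theorem total (h : Core p L x X k q t A B) : ∑ v : Lˣ, Real.logb p (max 1 ‖X v‖) = 2 := by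

  have key : ‖(p : PadicAlgCl p)‖ ^ 2 * ∏ v ∈ Finset.univ.erase (0:L), max 1 ‖X v‖ = 1 := by
    convert! prod_formal h.sys h.hA h.hB h.hAB h.n2 h.n3 h.hp5 h.card
  have h1 : ∏ v ∈ Finset.univ.erase (0:L), max 1 ‖X v‖ = ∏ v : Lˣ, max 1 ‖X v‖ := by
    symm
    apply Finset.prod_bij (fun (v : Lˣ) _ => (v : L))
    · simp
    · intro a _ b _ e; exact Units.ext e
    · intro b hb
      exact ⟨Units.mk0 b (by simpa using hb), by simp, rfl⟩
    · simp
  have hp := p_one_lt (p := p)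
  rw [h1, norm_p, inv_pow, inv_mul_eq_one₀ (by positivity)] at key
  rw [← Real.logb_prod _ _ (fun v _ => by positivity), ← key, Real.logb_pow, Real.logb_self_eq_one hp]
  norm_num

theorem total_formal (h : Core p L x X k q t A B) (hf : ∀ u, u ≠ 0 → 1 < ‖X u‖) :
    ∑ v : Lˣ, lv (X v) = 2 := by
  rw [← h.total]
  exact Finset.sum_congr rfl fun v _ => by rw [max_eq_right (hf _ v.ne_zero).le]; rfl

theorem card_units (h : Core p L x X k q t A B) : Fintype.card Lˣ = p ^ 2 - 1 := by
  rw [Fintype.card_units, h.card]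

theorem galx (h : Core p L x X k q t A B) (σ : PadicAlgCl p ≃ₐ[ℚ_[p]] PadicAlgCl p) (u : Lˣ) :
    ∃ b : Lˣ, σ (x ((u:L) ^ 3)) = x ((b:L) ^ 3) := by
  obtain ⟨c, hc, h | h⟩ := h.gal σ
  · exact ⟨Units.mk0 c hc * u, by rw [h _ (pow_ne_zero _ u.ne_zero)]; simp [mul_pow]⟩
  · exact ⟨(Units.mk0 c hc * u) ^ p, by
      rw [h _ (pow_ne_zero _ u.ne_zero)]; simp [mul_pow]; congr 1; ring⟩

theorem x_eq (h : Core p L x X k q t A B) {u v : L} (hu : u ≠ 0) (hv : v ≠ 0) :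
    x u = x v ↔ u ^ 2 = v ^ 2 := by
  rw [h.hx, h.hx, mul_left_inj' h.ht, sq_eq_sq_iff_eq_or_eq_neg]
  constructor
  · exact h.sys.inj u v hu hv
  · rintro (rfl | rfl)
    · rfl
    · exact h.sys.neg v

theorem six_dvd (h : Core p L x X k q t A B) : 24 ∣ p ^ 2 - 1 := by
  have hp : p.Prime := Fact.out
  have h5 := h.hp5
  have h2 : ¬ 2 ∣ p := fun e => by
    have := (Nat.prime_dvd_prime_iff_eq Nat.prime_two hp).1 e; omega
  have h3 : ¬ 3 ∣ p := fun e => by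
    have := (Nat.prime_dvd_prime_iff_eq Nat.prime_three hp).1 e; omega
  have : p ^ 2 % 24 = 1 := by
    rw [Nat.pow_mod]
    have hlt : p % 24 < 24 := Nat.mod_lt _ (by norm_num)
    have a2 : (p % 24) % 2 ≠ 0 := by omega
    have a3 : (p % 24) % 3 ≠ 0 := by omega
    generalize p % 24 = r at *
    interval_cases r <;> simp_all
  omega

theorem sum_cubes (h : Core p L x X k q t A B) (h0 : ∀ u, u ≠ 0 → X u ≠ 0) :
    ∃ n : ℤ, ∑ u : Lˣ, lv (x ((u:L) ^ 3)) = 6 * n := by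
  apply gal_sum6
  · rw [h.card_units]; exact (show 6 ∣ 24 by norm_num).trans h.six_dvd
  · intro a b
    rw [h.x_eq (pow_ne_zero _ a.ne_zero) (pow_ne_zero _ b.ne_zero), div_pow, div_eq_one, Units.ext_iff]
    push_cast
    rw [← pow_mul, ← pow_mul]
  · intro a
    rw [h.hx]; exact mul_ne_zero (h0 _ (pow_ne_zero _ a.ne_zero)) h.ht
  · intro σ a; exact h.galx σ a

theorem sum_cubesX (h : Core p L x X k q t A B) (h0 : ∀ u, u ≠ 0 → X u ≠ 0) (hd : k * 6 ∣ p ^ 2 - 1) :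
    ∃ n : ℤ, ∑ u : Lˣ, lv (X ((u:L) ^ 3)) = 6 * n := by
  obtain ⟨n, hn⟩ := h.sum_cubes h0
  rw [Finset.sum_congr rfl (fun u _ => h.lvx (h0 _ (pow_ne_zero 3 (Units.ne_zero u)))),
    Finset.sum_add_distrib] at hn
  simp only [Finset.sum_const, Finset.card_univ, h.card_units, nsmul_eq_mul] at hn
  obtain ⟨d, hd⟩ := hd
  obtain ⟨m, hm⟩ := h.lvt
  refine ⟨n - d * m, ?_⟩
  rw [hd] at hn
  push_cast at hn ⊢
  linear_combination hn - 6 * d * hm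

/-- proper subspaces of `L` are at most lines -/
theorem line (h : Core p L x X k q t A B) (M : Submodule (ZMod p) L) (hM : M ≠ ⊤) :
    ∃ v0 ∈ M, ∀ w ∈ M, ∃ c : ZMod p, c • v0 = w := by
  have hfin : Module.finrank (ZMod p) L = 2 := by
    have := Module.card_eq_pow_finrank (K := ZMod p) (V := L)
    rw [h.card, ZMod.card] at this
    exact (Nat.pow_right_injective (Fact.out : p.Prime).two_le this).symm
  have := Submodule.finrank_lt hM
  have h1 : Module.finrank (ZMod p) M ≤ 1 := by omega
  obtain ⟨v, hv⟩ := finrank_le_one_iff.1 h1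
  refine ⟨v, v.2, fun w hw => ?_⟩
  obtain ⟨c, hc⟩ := hv ⟨w, hw⟩
  exact ⟨c, congrArg Subtype.val hc⟩

end Core
end

section
namespace Core
variable {p : ℕ} [Fact p.Prime] {L : Type} [Field L] [Fintype L] [DecidableEq L] [Algebra (ZMod p) L]
    {x X : L → PadicAlgCl p} {k : ℕ} {q : ℚ_[p]} {t A B : PadicAlgCl p}

theorem sum_cube_supp (h : Core p L x X k q t A B) (g : Lˣ → ℝ) (hg : ∀ v, g v ≠ 0 → ∃ c, v = c ^ 3) :
    ∑ u : Lˣ, g (u ^ 3) = 3 * ∑ u : Lˣ, g u := by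
  have key := sum_surj (powMonoidHom 3 : Lˣ →* Lˣ).rangeRestrict
    (MonoidHom.rangeRestrict_surjective _) (fun b => g b)
  have hc := IsCyclic.card_powMonoidHom_range (G := Lˣ) 3
  have h3 : 3 ∣ Nat.card Lˣ := by
    rw [Nat.card_eq_fintype_card, h.card_units]; exact (show 3 ∣ 24 by norm_num).trans h.six_dvd
  rw [Nat.gcd_eq_right h3] at hc
  have e1 : ∑ b : (powMonoidHom 3 : Lˣ →* Lˣ).range, g b = ∑ u : Lˣ, g u := by
    refine Fintype.sum_of_injective Subtype.val Subtype.val_injective _ _ ?_ (fun _ => rfl)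
    intro u hu
    by_contra hne
    obtain ⟨c, hc⟩ := hg u hne
    exact hu ⟨⟨u, ⟨c, hc.symm⟩⟩, rfl⟩
  rw [e1] at key
  obtain ⟨d, hd⟩ := h3
  rw [hd, Nat.mul_div_cancel_left _ (by norm_num)] at hc
  rw [← Nat.card_eq_fintype_card, ← Nat.card_eq_fintype_card, hc, hd] at key
  have hd0 : (d:ℝ) ≠ 0 := by
    have : 0 < Nat.card Lˣ := Nat.card_pos
    have : d ≠ 0 := by rintro rfl; omega
    exact_mod_cast this
  simp only [MonoidHom.coe_rangeRestrict, powMonoidHom_apply] at key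
  apply mul_left_cancel₀ hd0
  rw [key]; push_cast; ring

theorem cube_zmod (h3 : p % 3 = 2) (z : ZMod p) : ∃ y : ZMod p, z = y ^ 3 := by
  obtain ⟨m, hm⟩ : ∃ m, 3 * m = 2 * (p - 1) + 1 := ⟨(2 * (p-1) + 1) / 3, by omega⟩
  refine ⟨z ^ m, ?_⟩
  rw [← pow_mul, mul_comm m 3, hm, pow_succ, mul_comm 2, pow_mul]
  by_cases hz : z = 0
  · simp [hz]
  · rw [ZMod.pow_card_sub_one_eq_one hz]; simp

theorem case1 (h : Core p L x X k q t A B) (h9 : p % 9 = 8) (hf : ∀ u, u ≠ 0 → 1 < ‖X u‖) : False := by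
  have h0 : ∀ u, u ≠ 0 → X u ≠ 0 := fun u hu e => by
    have := hf u hu; rw [e, norm_zero] at this; linarith
  obtain ⟨n, hn⟩ := h.sum_cubesX h0 (by
    have h24 := h.six_dvd
    have : 9 ∣ p ^ 2 - 1 := by
      have : p ^ 2 % 9 = 1 := by rw [Nat.pow_mod, h9]
      omega
    rcases h.hk with ⟨h, _⟩ | ⟨h, _⟩ <;> rw [h] <;> omega)
  have tot := h.total_formal hf
  have hp1 := p_one_lt (p := p)
  obtain ⟨v0, hv0⟩ := Finite.exists_min (fun v : Lˣ => ‖X v‖)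
  set β := lv (X v0) with hβ
  have hβ0 : 0 < β := Real.logb_pos hp1 (hf _ v0.ne_zero)
  have hle : ∀ v : Lˣ, β ≤ lv (X v) := fun v => 
    Real.logb_le_logb_of_le hp1 (by linarith [hf _ v0.ne_zero]) (hv0 v)
  have hlt : ∀ v : Lˣ, lv (X v) - β ≠ 0 → ‖X v0‖ < ‖X v‖ := by
    intro v hv
    refine lt_of_le_of_ne (hv0 v) (fun e => hv ?_)
    rw [hβ, lv, lv, ← e, sub_self]
  have dich : (∀ v : Lˣ, ‖X v0‖ < ‖X v‖ → ∃ c, v = c ^ 3) ∨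
      (∀ v : Lˣ, ‖X v0‖ < ‖X v‖ → ¬ ∃ c, v = c ^ 3) := by
    by_contra! hh
    obtain ⟨⟨v, hv, hvc⟩, ⟨v', hv', c, hc⟩⟩ := hh
    set r := min ‖X v‖ ‖X v'‖
    have hr : 1 < r := lt_min (hf _ v.ne_zero) (hf _ v'.ne_zero)
    set M := Fil (p := p) h.sys h.hA h.hB h.n2 r hr
    have hM : M ≠ ⊤ := by
      intro e
      have : (v0:L) ∈ M := by rw [e]; trivial
      rcases (mem_Fil _ _ _ _ _ _ _).1 this with e | e
      · exact v0.ne_zero e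
      · exact absurd (lt_min hv hv') (not_lt.2 e)
    obtain ⟨w, -, hw⟩ := h.line M hM
    obtain ⟨a, ha⟩ := hw v ((mem_Fil _ _ _ _ _ _ _).2 (Or.inr (min_le_left _ _)))
    obtain ⟨b, hb⟩ := hw v' ((mem_Fil _ _ _ _ _ _ _).2 (Or.inr (min_le_right _ _)))
    have hb0 : b ≠ 0 := by rintro rfl; rw [zero_smul] at hb; exact v'.ne_zero hb.symm
    have hva : (v:L) = algebraMap (ZMod p) L (a / b) * v' := by
      rw [← ha, ← hb, ← Algebra.smul_def, smul_smul, div_mul_cancel₀ _ hb0]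
    obtain ⟨y, hy⟩ := cube_zmod (p := p) (by omega) (a / b)
    have hv3 : (v:L) = (algebraMap (ZMod p) L y * c) ^ 3 := by
      rw [hva, hy, hc, mul_pow, map_pow]; simp
    have hne : algebraMap (ZMod p) L y * c ≠ 0 := by
      intro e; rw [e] at hv3; simp at hv3
    exact hvc (Units.mk0 _ hne) (Units.ext (by simpa using hv3))
  have hN : (0:ℝ) < (Fintype.card Lˣ : ℝ) := by exact_mod_cast Fintype.card_pos
  have hbound : (Fintype.card Lˣ : ℝ) * β ≤ 2 := by
    rw [← tot]
    have := Finset.sum_le_sum (s := Finset.univ) (fun (v : Lˣ) _ => hle v)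
    simpa using this
  have hpos : 0 < (Fintype.card Lˣ : ℝ) * β := by positivity
  rcases dich with hd | hd
  · have := h.sum_cube_supp (fun v => lv (X v) - β) (fun v hv => hd v (hlt v hv))
    simp only [Finset.sum_sub_distrib, Finset.sum_const, Finset.card_univ, nsmul_eq_mul, tot,
      Units.val_pow_eq_pow_val, hn] at this
    have i1 : (0:ℝ) < n := by linarith
    have i2 : (n:ℝ) < 1 := by linarith
    have j1 : 0 < n := by exact_mod_cast i1
    have j2 : n < 1 := by exact_mod_cast i2
    omega
  · have : ∑ u : Lˣ, lv (X ((u:L) ^ 3)) = (Fintype.card Lˣ : ℝ) * β := by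
      rw [Finset.sum_congr rfl (g := fun _ => β)]
      · simp
      · intro u _
        by_contra hne
        have := hlt (u ^ 3) (by push_cast; exact sub_ne_zero.2 hne)
        exact hd _ this ⟨u, rfl⟩
    rw [hn] at this
    have i1 : (0:ℝ) < n := by linarith
    have i2 : (n:ℝ) < 1 := by linarith
    have j1 : 0 < n := by exact_mod_cast i1
    have j2 : n < 1 := by exact_mod_cast i2
    omega

theorem mem_prime (h : Core p L x X k q t A B) (a : L) (ha : a ^ p = a) : ∃ z : ZMod p, algebraMap _ L z = a := by
  have _ := h
  haveI : CharP L p := charP_of_injective_algebraMap (algebraMap (ZMod p) L).injective p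
  obtain ⟨z, hz⟩ := (_root_.mem_bot_iff_intCast p L).1 ((Subfield.mem_bot_iff_pow_eq_self L p).2 ha)
  exact ⟨z, by rw [← hz, map_intCast]⟩

theorem pow_sq (h : Core p L x X k q t A B) (v : L) : v ^ (p ^ 2) = v := by
  rw [← h.card]; exact FiniteField.pow_card v

theorem case2 (h : Core p L x X k q t A B) (h3 : p % 3 = 1) (hk : k = 2) (hf : ∀ u, u ≠ 0 → 1 < ‖X u‖) :
    False := by
  have h0 : ∀ u, u ≠ 0 → X u ≠ 0 := fun u hu e => by
    have := hf u hu; rw [e, norm_zero] at this; linarith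
  obtain ⟨n, hn⟩ := h.sum_cubesX h0 (by rw [hk]; exact (show 2 * 6 ∣ 24 by norm_num).trans h.six_dvd)
  have tot := h.total_formal hf
  let θ : (ZMod p)ˣ × Lˣ →* Lˣ :=
    ((Units.map (algebraMap (ZMod p) L).toMonoidHom).comp (MonoidHom.fst _ _)) *
      ((powMonoidHom 3).comp (MonoidHom.snd _ _))
  have hθ : ∀ z u, ((θ (z, u) : Lˣ) : L) = algebraMap (ZMod p) L z * (u:L) ^ 3 := by
    intro z u; rfl
  have surj : Function.Surjective θ := by
    intro v
    obtain ⟨m, hm⟩ : ∃ m, p + 2 = 3 * m := ⟨(p + 2) / 3, by omega⟩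
    obtain ⟨z, hz⟩ := h.mem_prime ((v:L) ^ (p + 1)) (by
      rw [← pow_mul, show (p + 1) * p = p ^ 2 + p by ring, pow_add, h.pow_sq]; ring)
    have hz0 : z ≠ 0 := by rintro rfl; rw [map_zero] at hz; exact pow_ne_zero _ v.ne_zero hz.symm
    refine ⟨((Units.mk0 z hz0)⁻¹, v ^ m), Units.ext ?_⟩
    rw [hθ]
    push_cast
    rw [← pow_mul, mul_comm m 3, ← hm]
    simp only [Units.val_mk0, map_inv₀, hz]
    rw [inv_mul_eq_iff_eq_mul₀ (pow_ne_zero _ v.ne_zero)]; ring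
  have key := sum_surj θ surj (fun v => lv (X v))
  have : ∑ a : (ZMod p)ˣ × Lˣ, lv (X (θ a)) = (Fintype.card (ZMod p)ˣ : ℝ) * (6 * n) := by
    rw [← hn, Fintype.sum_prod_type]
    rw [Finset.sum_congr rfl (g := fun _ => ∑ u : Lˣ, lv (X ((u:L) ^ 3)))]
    · simp
    · intro z _
      apply Finset.sum_congr rfl
      intro u _
      rw [hθ, ← Algebra.smul_def, lv, formal_smul h.sys h.hA h.hB h.n2 _ (pow_ne_zero _ u.ne_zero)
        (hf _ (pow_ne_zero _ u.ne_zero)) _ z.ne_zero]; rfl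
  rw [this, tot, Fintype.card_prod] at key
  have hN : (Fintype.card Lˣ : ℝ) ≠ 0 := by exact_mod_cast Fintype.card_ne_zero
  have hM : (Fintype.card (ZMod p)ˣ : ℝ) ≠ 0 := by exact_mod_cast Fintype.card_ne_zero
  push_cast at key
  have : (6:ℝ) * n = 2 := by
    apply mul_left_cancel₀ (mul_ne_zero hN hM)
    linear_combination key
  have : 6 * n = 2 := by exact_mod_cast this
  omega

end Core
end

section
theorem lucas_rep {p : ℕ} [Fact p.Prime] {a b : ℕ} (ha : a < p) (hb : b < p) (j : ℕ) :
    (((a * ∑ i ∈ Finset.range j, p ^ i).choose (b * ∑ i ∈ Finset.range j, p ^ i) : ℕ) : ZMod p) =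
      ((a.choose b : ℕ) : ZMod p) ^ j := by
  have hp0 : 0 < p := (Fact.out : p.Prime).pos
  induction j with
  | zero => simp
  | succ j ih =>
    have e : ∑ i ∈ Finset.range (j+1), p ^ i = p * ∑ i ∈ Finset.range j, p ^ i + 1 := by
      rw [Finset.sum_range_succ', Finset.mul_sum]; simp [pow_succ, mul_comm]
    have h := Choose.choose_modEq_choose_mod_mul_choose_div_nat (p := p)
      (n := a * ∑ i ∈ Finset.range (j+1), p ^ i) (k := b * ∑ i ∈ Finset.range (j+1), p ^ i)
    have h := (ZMod.natCast_eq_natCast_iff _ _ _).2 h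
    have key : ∀ c S : ℕ, c < p → (c * (p * S + 1)) % p = c ∧ (c * (p * S + 1)) / p = c * S := by
      intro c S hc
      rw [show c * (p * S + 1) = c + p * (c * S) by ring, Nat.add_mul_mod_self_left, Nat.mod_eq_of_lt hc,
        Nat.add_mul_div_left _ _ hp0, Nat.div_eq_of_lt hc, zero_add]
      exact ⟨rfl, rfl⟩
    rw [h, e, (key a _ ha).1, (key a _ ha).2, (key b _ hb).1, (key b _ hb).2]
    push_cast at ih ⊢
    rw [ih, pow_succ, mul_comm]

theorem choose_one {p : ℕ} [Fact p.Prime] (hp5 : 5 ≤ p) (h3 : p % 3 = 1) :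
    ((((p ^ (p-1) - 1) / 2).choose ((p ^ (p-1) - 1) / 3) : ℕ) : ZMod p) = 1 := by
  have hp : p.Prime := Fact.out
  have hodd : p % 2 = 1 := by
    rcases hp.eq_two_or_odd with h | h <;> omega
  have hS : (∑ i ∈ Finset.range (p-1), p ^ i) * (p - 1) = p ^ (p-1) - 1 :=
    geom_sum_mul_of_one_le hp.one_lt.le _
  set S := ∑ i ∈ Finset.range (p-1), p ^ i
  obtain ⟨a, ha⟩ : ∃ a, p - 1 = 2 * a := ⟨(p-1)/2, by omega⟩
  obtain ⟨b, hb⟩ : ∃ b, p - 1 = 3 * b := ⟨(p-1)/3, by omega⟩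
  have e1 : (p ^ (p-1) - 1) / 2 = a * S := by
    rw [← hS]; nth_rewrite 1 [ha]
    exact Nat.div_eq_of_eq_mul_left two_pos (by ring)
  have e2 : (p ^ (p-1) - 1) / 3 = b * S := by
    rw [← hS]; nth_rewrite 1 [hb]
    exact Nat.div_eq_of_eq_mul_left three_pos (by ring)
  rw [e1, e2, lucas_rep (by omega) (by omega)]
  apply ZMod.pow_card_sub_one_eq_one
  rw [Ne, ZMod.natCast_eq_zero_iff]
  intro hd
  have hd2 : p ∣ a.factorial := by
    rw [← Nat.choose_mul_factorial_mul_factorial (show b ≤ a by omega)]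
    exact Dvd.dvd.mul_right (Dvd.dvd.mul_right hd _) _
  have := (hp.dvd_factorial).1 hd2
  omega

theorem sum_pow_lt2 {F : Type*} [Field F] [Fintype F] [DecidableEq F] (i : ℕ)
    (hi : i < 2 * (Fintype.card F - 1)) :
    ∑ x : F, x ^ i = if i = Fintype.card F - 1 then -1 else 0 := by
  have hc : 1 < Fintype.card F := Fintype.one_lt_card
  rcases lt_or_ge i (Fintype.card F - 1) with h | h
  · rw [FiniteField.sum_pow_lt_card_sub_one F i h, if_neg h.ne]
  · have h1 : ∑ x : F, x ^ i = ∑ x : Fˣ, (x ^ i : F) := by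
      symm
      apply Finset.sum_of_injOn (fun x : Fˣ => (x:F))
      · intro a _ b _ e; exact Units.ext e
      · simp
      · intro z _ hz
        have : z = 0 := by
          by_contra h0
          exact hz ⟨Units.mk0 z h0, by simp, rfl⟩
        rw [this, zero_pow]; omega
      · intros; rfl
    rw [h1, FiniteField.sum_pow_units]
    congr 1
    rw [eq_iff_iff]
    constructor
    · rintro ⟨m, hm⟩
      have : m < 2 := by
        by_contra! h2
        have := Nat.mul_le_mul_left (Fintype.card F - 1) h2
        omega
      interval_cases m
      · omega
      · omega
    · rintro rfl; exact dvd_rfl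

theorem count_aff {F : Type*} [Field F] [Fintype F] [DecidableEq F] (h2 : ringChar F ≠ 2)
    (h3 : 3 ∣ Fintype.card F - 1) (hodd : Fintype.card F % 2 = 1) :
    ((Nat.card {xy : F × F // xy.2 ^ 2 = xy.1 ^ 3 + 1} : ℕ) : F) =
      - (((Fintype.card F - 1) / 2).choose ((Fintype.card F - 1) / 3) : ℕ) := by
  rw [Nat.card_eq_fintype_card]
  have e : Fintype.card {xy : F × F // xy.2 ^ 2 = xy.1 ^ 3 + 1} =
      ∑ x : F, (Set.toFinset {y : F | y ^ 2 = x ^ 3 + 1}).card := by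
    rw [Fintype.card_subtype, Finset.card_filter, Fintype.sum_prod_type]
    refine Finset.sum_congr rfl fun x _ => ?_
    rw [← Finset.card_filter]
    congr 1
    ext y; simp
  rw [e]
  push_cast
  have e2 : ∀ x : F, (((Set.toFinset {y : F | y ^ 2 = x ^ 3 + 1}).card : ℕ) : F) =
      (x ^ 3 + 1) ^ (Fintype.card F / 2) + 1 := by
    intro x
    rw [← quadraticChar_eq_pow_of_char_ne_two' h2]
    exact_mod_cast congrArg (Int.cast (R := F)) (quadraticChar_card_sqrts h2 (x ^ 3 + 1))
  simp_rw [e2]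
  rw [Finset.sum_add_distrib]
  simp only [Finset.sum_const, Finset.card_univ, nsmul_eq_mul, mul_one, FiniteField.cast_card_eq_zero, add_zero]
  have e3 : Fintype.card F / 2 = (Fintype.card F - 1) / 2 := by omega
  rw [e3]
  set n := (Fintype.card F - 1) / 2 with hn
  simp_rw [add_pow, one_pow, mul_one]
  rw [Finset.sum_comm]
  simp_rw [← Finset.sum_mul, ← pow_mul]
  have hc : 1 < Fintype.card F := Fintype.one_lt_card
  rw [Finset.sum_eq_single ((Fintype.card F - 1) / 3)]
  · rw [sum_pow_lt2 _ (by omega), if_pos (by omega), neg_one_mul]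
  · intro b hb hb2
    have : b < n + 1 := Finset.mem_range.1 hb
    rw [sum_pow_lt2 _ (by omega), if_neg (by omega), zero_mul]
  · intro h; exfalso; apply h; rw [Finset.mem_range]; omega

theorem exists_root_gen {p : ℕ} [Fact p.Prime] (hp5 : 5 ≤ p) (h3 : p % 3 = 1)
    {F : Type*} [Field F] [Fintype F] [DecidableEq F] [Algebra (ZMod p) F] [CharP F p]
    (hcard : Fintype.card F = p ^ (p-1)) :
    ∃ x : F, ((⟨0, 0, 0, 0, 1⟩ : WeierstrassCurve F).preΨ' p).eval x = 0 := by
  have hp : p.Prime := Fact.out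
  have hodd : p % 2 = 1 := by
    rcases hp.eq_two_or_odd with h | h <;> omega
  have natne : ∀ n : ℕ, 0 < n → n < 5 → (n : F) ≠ 0 := fun n h0 h1 e => by
    rw [CharP.cast_eq_zero_iff F p] at e
    have := Nat.le_of_dvd h0 e; omega
  have h2F : (2:F) ≠ 0 := by exact_mod_cast natne 2 (by norm_num) (by norm_num)
  have h3F : (3:F) ≠ 0 := by exact_mod_cast natne 3 (by norm_num) (by norm_num)
  set W : WeierstrassCurve F := ⟨0, 0, 0, 0, 1⟩ with hW
  have hΔ : W.Δ ≠ 0 := by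
    have : W.Δ = -(2^4*3^3) := by
      simp [hW, WeierstrassCurve.Δ, WeierstrassCurve.b₂, WeierstrassCurve.b₄, WeierstrassCurve.b₆, WeierstrassCurve.b₈]; norm_num
    rw [this]
    exact neg_ne_zero.2 (mul_ne_zero (pow_ne_zero _ h2F) (pow_ne_zero _ h3F))
  have hsub : ∀ xy : F × F, W.toAffine.Nonsingular xy.1 xy.2 ↔ xy.2 ^ 2 = xy.1 ^ 3 + 1 := by
    intro xy
    rw [← WeierstrassCurve.Affine.equation_iff_nonsingular_of_Δ_ne_zero hΔ, WeierstrassCurve.Affine.equation_iff]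
    simp [hW]
  let eqv : W.toAffine.Point ≃ Option {xy : F × F // xy.2 ^ 2 = xy.1 ^ 3 + 1} :=
    (WeierstrassCurve.Affine.nonsingularPointEquiv W.toAffine).trans
      (Equiv.optionCongr (Equiv.subtypeEquivRight hsub))
  letI : Fintype W.toAffine.Point := Fintype.ofEquiv _ eqv.symm
  have hcp : Fintype.card W.toAffine.Point =
      Nat.card {xy : F × F // xy.2 ^ 2 = xy.1 ^ 3 + 1} + 1 := by
    rw [Fintype.card_congr eqv, Fintype.card_option, Nat.card_eq_fintype_card]
  have hdvd : p ∣ Fintype.card W.toAffine.Point := by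
    rw [← CharP.cast_eq_zero_iff F p, hcp]
    push_cast
    rw [count_aff]
    · rw [hcard]
      have := congrArg (algebraMap (ZMod p) F) (choose_one hp5 h3)
      rw [map_natCast, map_one] at this
      rw [this]; ring
    · rw [← CharP.eq F ‹CharP F p› (ringChar.charP F)]; omega
    · rw [hcard]
      exact (show 3 ∣ p - 1 by omega).trans (by simpa using Nat.sub_dvd_pow_sub_pow p 1 (p-1))
    · rw [hcard, Nat.pow_mod, hodd]; simp
  obtain ⟨P, hP⟩ := exists_prime_addOrderOf_dvd_card p hdvd
  have hP0 : P ≠ 0 := by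
    rintro rfl
    rw [addOrderOf_zero] at hP; omega
  have hpP : p • P = 0 := by rw [← hP]; exact addOrderOf_nsmul_eq_zero P
  have sys := pxx_XSys W (by
    rw [show (6:F) = 2 * 3 by norm_num]; exact mul_ne_zero h2F h3F)
  have c4 : -W.c₄/48 = 0 := by
    simp [hW, WeierstrassCurve.c₄, WeierstrassCurve.b₂, WeierstrassCurve.b₄]
  have c6 : -W.c₆/864 = 1 := by
    have : W.c₆ = -864 := by
      simp [hW, WeierstrassCurve.c₆, WeierstrassCurve.b₂, WeierstrassCurve.b₄, WeierstrassCurve.b₆]; norm_num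
    rw [this, neg_neg, div_self]
    rw [show (864:F) = 2^5*3^3 by norm_num]
    exact (mul_ne_zero (pow_ne_zero _ h2F) (pow_ne_zero _ h3F))
  rw [c4, c6] at sys
  exact ⟨_, sys.root (by rw [show (4:F) = 2*2 by norm_num]; exact mul_ne_zero h2F h2F) hp hp5 P hP0 hpP⟩

theorem exists_root_bar {p : ℕ} [Fact p.Prime] (hp5 : 5 ≤ p) (h3 : p % 3 = 1) :
    ∃ x : GaloisField p (p-1),
      ((⟨0, 0, 0, 0, 1⟩ : WeierstrassCurve (GaloisField p (p-1))).preΨ' p).eval x = 0 := by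
  classical
  letI : Fintype (GaloisField p (p-1)) := Fintype.ofFinite _
  refine exists_root_gen hp5 h3 ?_
  rw [← Nat.card_eq_fintype_card]; exact GaloisField.card p (p-1) (by omega)
end

section
open Polynomial

theorem wmap {R S : Type*} [CommRing R] [CommRing S] (f : R →+* S) (a : R) (n : ℕ) :
    ((⟨0, 0, 0, a, 1⟩ : WeierstrassCurve R).preΨ' n).map f =
      (⟨0, 0, 0, f a, 1⟩ : WeierstrassCurve S).preΨ' n := by
  rw [← WeierstrassCurve.map_preΨ']
  simp [WeierstrassCurve.map]

theorem exists_small {p : ℕ} [Fact p.Prime] (hp5 : 5 ≤ p) (h3 : p % 3 = 1) (A : PadicAlgCl p) (hA : ‖A‖ < 1) :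
    ∃ t : PadicAlgCl p, ‖t‖ ≤ 1 ∧
      ‖((⟨0, 0, 0, A, 1⟩ : WeierstrassCurve (PadicAlgCl p)).preΨ' p).eval t‖ < 1 := by
  obtain ⟨x, hx⟩ := exists_root_bar hp5 h3
  set ΨZ := (⟨0, 0, 0, 0, 1⟩ : WeierstrassCurve ℤ).preΨ' p with hΨ
  set c := Int.castRingHom (ZMod p)
  have hx2 : aeval x (ΨZ.map c) = 0 := by
    rw [aeval_def, eval₂_eq_eval_map, Polynomial.map_map, hΨ, wmap, map_zero, hx]
  have hInteg : IsIntegral (ZMod p) x := Algebra.IsIntegral.isIntegral x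
  obtain ⟨h, hh⟩ := minpoly.dvd (ZMod p) x hx2
  have hsurj : Function.Surjective c := ZMod.intCast_surjective
  obtain ⟨G, hG1, hG2, hG3⟩ := lifts_and_natDegree_eq_and_monic (f := c)
    ((Polynomial.mem_lifts _).2 (Polynomial.map_surjective _ hsurj _)) (minpoly.monic hInteg)
  obtain ⟨H, hH⟩ := Polynomial.map_surjective _ hsurj h
  obtain ⟨R, hR⟩ : C (p:ℤ) ∣ ΨZ - G * H := by
    rw [Polynomial.C_dvd_iff_dvd_coeff]
    intro i
    have : (ΨZ - G * H).map c = 0 := by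
      rw [Polynomial.map_sub, Polynomial.map_mul, hG1, hH, hh, sub_self]
    have := congrArg (fun f => f.coeff i) this
    simp only [coeff_map, coeff_zero] at this
    exact (ZMod.intCast_zmod_eq_zero_iff_dvd _ p).1 this
  let K := PadicAlgCl p
  have hdeg : (G.map (Int.castRingHom K)).degree ≠ 0 := by
    rw [hG3.degree_map, degree_eq_natDegree hG3.ne_zero, hG2]
    exact_mod_cast (minpoly.natDegree_pos hInteg).ne'
  obtain ⟨t, ht⟩ := IsAlgClosed.exists_root _ hdeg
  rw [IsRoot.def, eval_map] at ht
  set v := NormedField.valuation (K := K)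
  have hmem : ∀ y : K, y ∈ v.integer ↔ ‖y‖ ≤ 1 := fun y => Iff.rfl
  have ht1 : ‖t‖ ≤ 1 := by
    rw [← hmem]
    apply (Valuation.integer.integers v).mem_of_integral
    have : IsIntegral ℤ t := ⟨G, hG3, ht⟩
    exact this.tower_top
  refine ⟨t, ht1, ?_⟩
  let A' : v.integer := ⟨A, (hmem A).2 hA.le⟩
  let t' : v.integer := ⟨t, (hmem t).2 ht1⟩
  let Q := Ideal.Quotient.mk (Ideal.span {A'})
  set y := ((⟨0, 0, 0, A', 1⟩ : WeierstrassCurve v.integer).preΨ' p).eval t' with hy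
  set y0 := (ΨZ.map (Int.castRingHom v.integer)).eval t' with hy0
  have hdiff : y - y0 ∈ Ideal.span {A'} := by
    rw [← Ideal.Quotient.eq_zero_iff_mem, map_sub, sub_eq_zero, hy, hy0, hΨ, wmap]
    change Q _ = Q _
    have hQ : Q A' = 0 := Ideal.Quotient.eq_zero_iff_mem.2 (Ideal.mem_span_singleton_self _)
    rw [← eval₂_hom, ← eval₂_hom, ← eval_map, ← eval_map, wmap, wmap, hQ, map_zero, map_zero]
  obtain ⟨z, hz⟩ := Ideal.mem_span_singleton.1 hdiff
  have ey : ((⟨0, 0, 0, A, 1⟩ : WeierstrassCurve K).preΨ' p).eval t = y := by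
    have := wmap v.integer.subtype A' p
    rw [show v.integer.subtype A' = A from rfl] at this
    rw [← this, eval_map, hy, show t = v.integer.subtype t' from rfl, eval₂_hom]
    rfl
  have ey0 : (ΨZ.map (Int.castRingHom K)).eval t = y0 := by
    rw [hy0, show Int.castRingHom K = v.integer.subtype.comp (Int.castRingHom v.integer) from
      RingHom.ext_int _ _, ← Polynomial.map_map, eval_map, show t = v.integer.subtype t' from rfl, eval₂_hom]
    rfl
  have hs0 : ‖(y0 : K)‖ < 1 := by
    rw [← ey0, show ΨZ = G * H + C (p:ℤ) * R by rw [← hR]; ring]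
    rw [Polynomial.map_add, Polynomial.map_mul, Polynomial.map_mul, map_C, eval_add, eval_mul, eval_map (p := G), ht, zero_mul,
      zero_add, eval_mul, eval_C]
    have : eval t (R.map (Int.castRingHom K)) = ((R.map (Int.castRingHom v.integer)).eval t' : v.integer) := by
      rw [show Int.castRingHom K = v.integer.subtype.comp (Int.castRingHom v.integer) from
        RingHom.ext_int _ _, ← Polynomial.map_map, eval_map, show t = v.integer.subtype t' from rfl, eval₂_hom]
      rfl
    rw [this]
    refine nm_lt' ?_ ((hmem _).1 (Subtype.prop _))
    rw [show (Int.castRingHom K) (p:ℤ) = (p:K) by simp, norm_p]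
    have : (1:ℝ) < p := by exact_mod_cast (Fact.out : p.Prime).one_lt
    exact inv_lt_one_of_one_lt₀ this
  rw [ey, show y = y0 + A' * z by rw [← hz]; ring]
  push_cast
  exact na_lt hs0 (nm_lt' hA ((hmem _).1 z.2))

namespace Core
variable {p : ℕ} [Fact p.Prime] {L : Type} [Field L] [Fintype L] [DecidableEq L] [Algebra (ZMod p) L]
    {x X : L → PadicAlgCl p} {k : ℕ} {q : ℚ_[p]} {t A B : PadicAlgCl p}

theorem case3 (h : Core p L x X k q t A B) (h3 : p % 3 = 1) (hk : k = 3) (hf : ∀ u, u ≠ 0 → 1 < ‖X u‖) :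
    False := by
  obtain ⟨hB, hA⟩ : B = 1 ∧ ‖A‖ < 1 := by
    rcases h.hk with h | h
    · omega
    · exact h.2
  subst hB
  obtain ⟨s, hs, hs2⟩ := exists_small h.hp5 h3 A hA
  have e1 := congrArg norm (eval_sq h.sys h.hp5 h.card s)
  have e2 := prod_formal h.sys h.hA h.hB h.hAB h.n2 h.n3 h.hp5 h.card
  rw [norm_pow, norm_mul, norm_pow, norm_prod] at e1
  rw [Finset.prod_congr rfl (g := fun v => max 1 ‖X v‖), e2] at e1
  · have : ‖((⟨0, 0, 0, A, 1⟩ : WeierstrassCurve (PadicAlgCl p)).preΨ' p).eval s‖ ^ 2 < 1 :=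
      pow_lt_one₀ (norm_nonneg _) hs2 two_ne_zero
    linarith
  · intro v hv
    have := hf v (by rintro rfl; simp at hv)
    rw [max_eq_right this.le, norm_sub_rev]
    exact na_eq_sub (hs.trans_lt this)
end Core
end

section
namespace Core
variable {p : ℕ} [Fact p.Prime] {L : Type} [Field L] [Fintype L] [DecidableEq L] [Algebra (ZMod p) L]
    {x X : L → PadicAlgCl p} {k : ℕ} {q : ℚ_[p]} {t A B : PadicAlgCl p}

theorem normX (h : Core p L x X k q t A B) (σ : PadicAlgCl p ≃ₐ[ℚ_[p]] PadicAlgCl p) {u v : L}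
    (e : σ (x u) = x v) : ‖X v‖ = ‖X u‖ := by
  have := norm_gal σ (x u)
  rw [e, h.hx, h.hx, norm_mul, norm_mul] at this
  exact mul_right_cancel₀ (norm_ne_zero_iff.2 h.ht) this

theorem cube_prime (h : Core p L x X k q t A B) (h3 : p % 3 = 1) (l : ZMod p) (hl : l ≠ 0) (d : L)
    (hd : algebraMap _ L l = d ^ 3) : ∃ e : ZMod p, l = e ^ 3 := by
  have hp : p.Prime := Fact.out
  have hd0 : d ≠ 0 := by
    rintro rfl
    rw [zero_pow three_ne_zero] at hd
    exact hl ((map_eq_zero _).1 hd)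
  have h1 : (d ^ (p-1)) ^ 3 = 1 := by
    rw [← pow_mul, mul_comm, pow_mul, ← hd, ← map_pow, ZMod.pow_card_sub_one_eq_one hl, map_one]
  have h2 : (d ^ (p-1)) ^ (p+1) = 1 := by
    have := h.pow_sq d
    rw [← pow_mul]
    apply mul_right_cancel₀ hd0
    rw [one_mul, ← pow_succ]
    convert! this using 2
    obtain ⟨m, rfl⟩ : ∃ m, p = m + 1 := ⟨p - 1, by have := hp.pos; omega⟩
    simp; ring
  have h4 : d ^ (p-1) = 1 := by
    have := pow_gcd_eq_one.2 ⟨h1, h2⟩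
    have hg : Nat.gcd 3 (p+1) = 1 := 
      (Nat.Prime.coprime_iff_not_dvd Nat.prime_three).2 (by omega)
    rwa [hg, pow_one] at this
  obtain ⟨e, he⟩ := h.mem_prime d (by
    rw [show p = (p-1) + 1 by have := hp.pos; omega, pow_succ, h4, one_mul])
  refine ⟨e, (algebraMap (ZMod p) L).injective ?_⟩
  rw [hd, map_pow, he]

theorem nonformal (h : Core p L x X k q t A B) (hn : ∃ v, v ≠ 0 ∧ ‖X v‖ ≤ 1) :
    ∃ P Q : L, P ≠ 0 ∧ Q ≠ 0 ∧ 
      (∀ c : ZMod p, c ≠ 0 → 1 < ‖X (c • P)‖ ∧ lv (X (c • P)) = 2 / (p - 1)) ∧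
      (∀ c : ZMod p, c ≠ 0 → ‖X (c • Q)‖ ≤ 1) ∧
      (∀ σ : PadicAlgCl p ≃ₐ[ℚ_[p]] PadicAlgCl p, ∃ l : ZMod p, l ≠ 0 ∧
        (p % 3 = 1 → ∃ d, l = d ^ 3) ∧ (∀ m : ZMod p, m ≠ 0 → σ (x (m • P)) = x ((l * m) • P)) ∧
        (∀ m : ZMod p, m ≠ 0 → σ (x (m • Q)) = x ((l * m) • Q))) := by
  have hp : p.Prime := Fact.out
  obtain ⟨v, hv0, hv⟩ := hn
  have hp1 := p_one_lt (p := p)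
  haveI : CharP L p := charP_of_injective_algebraMap (algebraMap (ZMod p) L).injective p
  obtain ⟨P, hP0, hP⟩ : ∃ P : L, P ≠ 0 ∧ 1 < ‖X P‖ := by
    by_contra! hh
    have := h.total
    rw [Finset.sum_eq_zero] at this
    · norm_num at this
    · intro w _
      rw [max_eq_left (hh _ w.ne_zero), Real.logb_one]
  have hline : ∀ w : L, w ≠ 0 → 1 < ‖X w‖ → ∃ c : ZMod p, c ≠ 0 ∧ w = c • P := by
    intro w hw0 hw
    set r := min ‖X P‖ ‖X w‖
    have hr : 1 < r := lt_min hP hw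
    set M := Fil (p := p) h.sys h.hA h.hB h.n2 r hr
    have hM : M ≠ ⊤ := by
      intro e
      have : v ∈ M := by rw [e]; trivial
      rcases (mem_Fil _ _ _ _ _ _ _).1 this with e | e
      · exact hv0 e
      · linarith
    obtain ⟨z, -, hz⟩ := h.line M hM
    obtain ⟨a, ha⟩ := hz P ((mem_Fil _ _ _ _ _ _ _).2 (Or.inr (min_le_left _ _)))
    obtain ⟨b, hb⟩ := hz w ((mem_Fil _ _ _ _ _ _ _).2 (Or.inr (min_le_right _ _)))
    have ha0 : a ≠ 0 := by rintro rfl; rw [zero_smul] at ha; exact hP0 ha.symm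
    have hb0 : b ≠ 0 := by rintro rfl; rw [zero_smul] at hb; exact hw0 hb.symm
    exact ⟨b / a, div_ne_zero hb0 ha0, by rw [← ha, smul_smul, div_mul_cancel₀ _ ha0, hb]⟩
  have hsm : ∀ c : ZMod p, c ≠ 0 → ‖X (c • P)‖ = ‖X P‖ := fun c hc =>
    formal_smul h.sys h.hA h.hB h.n2 P hP0 hP c hc
  have hlv : lv (X P) = 2 / (p - 1) := by
    have tot := h.total
    have e : ∑ v : Lˣ, Real.logb p (max 1 ‖X v‖) = ∑ c : (ZMod p)ˣ, lv (X P) := by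
      symm
      apply Finset.sum_of_injOn (fun c : (ZMod p)ˣ => Units.mk0 ((c : ZMod p) • P) (smul_ne_zero c.ne_zero hP0))
      · intro a _ b _ e
        have := congrArg Units.val e
        simp only [Units.val_mk0] at this
        exact Units.ext (smul_left_injective _ hP0 this)
      · simp
      · intro w _ hw
        rw [max_eq_left, Real.logb_one]
        by_contra! hlt
        obtain ⟨c, hc, e⟩ := hline w w.ne_zero hlt
        exact hw ⟨Units.mk0 c hc, by simp, Units.ext (by simp [e])⟩
      · intro c _
        simp only [Units.val_mk0]
        rw [hsm _ c.ne_zero, max_eq_right hP.le]; rfl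
    rw [e, Finset.sum_const, Finset.card_univ, ZMod.card_units_eq_totient, Nat.totient_prime hp, nsmul_eq_mul,
      Nat.cast_sub hp.one_le, Nat.cast_one] at tot
    rw [eq_div_iff (by linarith), mul_comm]; exact tot
  -- the conjugate line
  set a := v / P with ha
  have hafix : a ^ p ≠ a := by
    intro e
    obtain ⟨z, hz⟩ := h.mem_prime a e
    have hz0 : z ≠ 0 := by
      rintro rfl
      rw [map_zero] at hz
      exact div_ne_zero hv0 hP0 (ha ▸ hz.symm)
    have : v = z • P := by
      rw [Algebra.smul_def, hz, ha, div_mul_cancel₀ _ hP0]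
    rw [this, hsm z hz0] at hv
    linarith
  set j := a - a ^ p with hj
  have hj0 : j ≠ 0 := by rw [hj, sub_ne_zero]; exact hafix.symm
  have hjp : j ^ p = - j := by
    rw [hj, sub_pow_char, ← pow_mul, ← pow_two, h.pow_sq]; ring
  have hfrob : ∀ z : ZMod p, (algebraMap (ZMod p) L z) ^ p = algebraMap _ L z := by
    intro z; rw [← map_pow, ZMod.pow_card]
  have hQ : ∀ c : ZMod p, c ≠ 0 → ‖X (c • (j * P))‖ ≤ 1 := by
    intro c hc
    by_contra! hlt
    obtain ⟨d, hd, e⟩ := hline _ (smul_ne_zero hc (mul_ne_zero hj0 hP0)) hlt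
    rw [Algebra.smul_def, Algebra.smul_def, ← mul_assoc] at e
    have e := mul_right_cancel₀ hP0 e
    have e2 := congrArg (· ^ p) e
    simp only [mul_pow, hfrob, hjp] at e2
    rw [← e] at e2
    have hc' : algebraMap (ZMod p) L c ≠ 0 := (map_ne_zero _).2 hc
    exact neg_ne_of (p := p) h.hp5 hj0 (mul_left_cancel₀ hc' e2).symm
  refine ⟨P, j * P, hP0, mul_ne_zero hj0 hP0, fun c hc => ?_, hQ, fun σ => ?_⟩
  · refine ⟨by rw [hsm c hc]; exact hP, ?_⟩
    rw [lv, hsm c hc]; exact hlv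
  · obtain ⟨c, hc0, hc | hc⟩ := h.gal σ
    · obtain ⟨l, hl0, hl⟩ := hline (c ^ 3 * P) (mul_ne_zero (pow_ne_zero _ hc0) hP0)
        (by rw [h.normX σ (hc P hP0)]; exact hP)
      rw [Algebra.smul_def] at hl
      have hl := mul_right_cancel₀ hP0 hl
      refine ⟨l, hl0, fun h3 => h.cube_prime h3 l hl0 c hl.symm, fun m hm => ?_, fun m hm => ?_⟩
      · rw [hc _ (smul_ne_zero hm hP0), Algebra.smul_def, Algebra.smul_def, map_mul, hl, mul_assoc]
      · rw [hc _ (smul_ne_zero hm (mul_ne_zero hj0 hP0)), Algebra.smul_def, Algebra.smul_def, map_mul, hl, mul_assoc]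
    · obtain ⟨l, hl0, hl⟩ := hline ((c ^ 3 * P) ^ p) (pow_ne_zero _ (mul_ne_zero (pow_ne_zero _ hc0) hP0))
        (by rw [h.normX σ (hc P hP0)]; exact hP)
      rw [Algebra.smul_def] at hl
      refine ⟨l, hl0, fun h3 => ?_, fun m hm => ?_, fun m hm => ?_⟩
      · obtain ⟨w, hw⟩ : ∃ w, p = 3 * w + 1 := ⟨p / 3, by omega⟩
        refine h.cube_prime h3 l hl0 (c ^ p * P ^ w) ?_
        apply mul_right_cancel₀ hP0
        rw [← hl, mul_pow, mul_pow, ← pow_mul, ← pow_mul, ← pow_mul, mul_assoc, ← pow_succ, mul_comm w, ← hw, mul_comm 3]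
      · rw [hc _ (smul_ne_zero hm hP0), Algebra.smul_def, Algebra.smul_def, map_mul]
        congr 1
        calc (c ^ 3 * (algebraMap (ZMod p) L m * P)) ^ p = (algebraMap (ZMod p) L m) ^ p * (c ^ 3 * P) ^ p := by ring
          _ = _ := by rw [hl, hfrob]; ring
      · rw [hc _ (smul_ne_zero hm (mul_ne_zero hj0 hP0)), Algebra.smul_def, Algebra.smul_def, map_mul]
        have : (c ^ 3 * (algebraMap (ZMod p) L m * (j * P))) ^ p = 
          - (algebraMap (ZMod p) L l * algebraMap (ZMod p) L m * (j * P)) := by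
          calc (c ^ 3 * (algebraMap (ZMod p) L m * (j * P))) ^ p =
                (algebraMap (ZMod p) L m) ^ p * (c ^ 3 * P) ^ p * j ^ p := by ring
            _ = _ := by rw [hl, hfrob, hjp]; ring
        rw [this, h.hx, h.hx, h.sys.neg]

theorem lineSum (h : Core p L x X k q t A B) (h3 : p % 3 = 1) (P : L) (hP0 : P ≠ 0)
    (hg : ∀ σ : PadicAlgCl p ≃ₐ[ℚ_[p]] PadicAlgCl p, ∃ l : ZMod p, l ≠ 0 ∧
      (∃ d, l = d ^ 3) ∧ (∀ m : ZMod p, m ≠ 0 → σ (x (m • P)) = x ((l * m) • P))) (b : ℝ)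
    (h0 : ∀ m : ZMod p, m ≠ 0 → X (m ^ 3 • P) ≠ 0)
    (hb : ∀ m : ZMod p, m ≠ 0 → lv (X (m ^ 3 • P)) = b) :
    ∃ n : ℤ, (p - 1 : ℝ) * (b + lv t) = 6 * n := by
  have hp : p.Prime := Fact.out
  have h5 := h.hp5
  have hodd : p % 2 = 1 := by
    rcases hp.eq_two_or_odd with h | h <;> omega
  have hc : Fintype.card (ZMod p)ˣ = p - 1 := by
    rw [ZMod.card_units_eq_totient, Nat.totient_prime hp]
  obtain ⟨n, hn⟩ := gal_sum6 (p := p) (H := (ZMod p)ˣ) (by rw [hc]; omega)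
    (fun m => x (((m : ZMod p) ^ 3) • P)) (fun a b => by
      rw [h.x_eq (smul_ne_zero (pow_ne_zero _ a.ne_zero) hP0) (smul_ne_zero (pow_ne_zero _ b.ne_zero) hP0),
        smul_pow, smul_pow, div_pow, div_eq_one, Units.ext_iff]
      push_cast
      rw [(smul_left_injective _ (pow_ne_zero 2 hP0)).eq_iff, ← pow_mul, ← pow_mul])
    (fun a => by rw [h.hx]; exact mul_ne_zero (h0 _ a.ne_zero) h.ht)
    (fun σ a => by
      obtain ⟨l, hl, ⟨d, hd⟩, hl2⟩ := hg σ
      have hd0 : d ≠ 0 := by rintro rfl; exact hl (by rw [hd]; ring)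
      refine ⟨Units.mk0 d hd0 * a, ?_⟩
      rw [hl2 _ (pow_ne_zero _ a.ne_zero), hd]
      simp [mul_pow])
  refine ⟨n, ?_⟩
  rw [← hn, Finset.sum_congr rfl (fun m _ => by rw [h.lvx (h0 _ (Units.ne_zero m)), hb _ (Units.ne_zero m)]),
    Finset.sum_const, Finset.card_univ, hc, nsmul_eq_mul, Nat.cast_sub hp.one_le, Nat.cast_one]

theorem case4 (h : Core p L x X k q t A B) (h3 : p % 3 = 1) (hn : ∃ v, v ≠ 0 ∧ ‖X v‖ ≤ 1) : False := by
  have hp : p.Prime := Fact.out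
  have h5 := h.hp5
  have hp1 := p_one_lt (p := p)
  have hodd : p % 2 = 1 := by
    rcases hp.eq_two_or_odd with h | h <;> omega
  obtain ⟨P, Q, hP0, hQ0, hP, hQ, hg⟩ := h.nonformal hn
  obtain ⟨n, hn⟩ := h.lineSum h3 P hP0 (fun σ => by
    obtain ⟨l, h1, h2, h3', _⟩ := hg σ; exact ⟨l, h1, h2 h3, h3'⟩) (2 / (p - 1))
    (fun m hm e => by
      have := (hP (m^3) (pow_ne_zero _ hm)).1
      rw [e, norm_zero] at this; linarith)
    (fun m hm => (hP (m^3) (pow_ne_zero _ hm)).2)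
  rw [mul_add, mul_div_cancel₀ _ (by linarith)] at hn
  obtain ⟨w, hw⟩ : ∃ w, p = 6 * w + 1 := ⟨p / 6, by omega⟩
  have hw' : (p:ℝ) = 6 * w + 1 := by exact_mod_cast hw
  rw [hw'] at hn
  obtain ⟨m, hm⟩ := h.lvt
  rcases h.hk with ⟨hk, _⟩ | ⟨hk, hB, hA⟩
  · rw [hk] at hm
    have : (2:ℝ) + 3 * w * m = 6 * n := by rw [← hm, ← hn]; push_cast; ring
    have : (2:ℤ) + 3 * (w * m) = 6 * n := by rw [← mul_assoc]; exact_mod_cast this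
    omega
  · rw [hk] at hm
    have e1 : (2:ℝ) + 2 * w * m = 6 * n := by rw [← hm, ← hn]; push_cast; ring
    have e1 : (2:ℤ) + 2 * (w * m) = 6 * n := by rw [← mul_assoc]; exact_mod_cast e1
    by_cases hall : ∀ c : ZMod p, c ≠ 0 → ‖X (c ^ 3 • Q)‖ = 1
    · obtain ⟨n', hn'⟩ := h.lineSum h3 Q hQ0 (fun σ => by
        obtain ⟨l, h1, h2, _, h3'⟩ := hg σ; exact ⟨l, h1, h2 h3, h3'⟩) 0
        (fun m hm e => by
          have := hall m hm
          rw [e, norm_zero] at this; linarith)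
        (fun m hm => by rw [lv, hall m hm, Real.logb_one])
      rw [hw'] at hn'
      have e2 : (2:ℝ) * w * m = 6 * n' := by rw [← hm, ← hn']; push_cast; ring
      have e2 : (2:ℤ) * (w * m) = 6 * n' := by rw [← mul_assoc]; exact_mod_cast e2
      omega
    · push Not at hall
      obtain ⟨c, hc, hne⟩ := hall
      have hlt := lt_of_le_of_ne (hQ _ (pow_ne_zero 3 hc)) hne
      set R := c ^ 3 • Q with hR
      have hR0 : R ≠ 0 := smul_ne_zero (pow_ne_zero 3 hc) hQ0
      have h2z := two_ne_zmod (p := p) h5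
      have h3z : (3 : ZMod p) ≠ 0 := by
        intro e
        have : ((3:ℕ) : ZMod p) = 0 := by exact_mod_cast e
        rw [ZMod.natCast_eq_zero_iff] at this
        have := Nat.le_of_dvd (by norm_num) this
        omega
      have e2 : R + R = (2 : ZMod p) • R := (two_smul _ _).symm
      have e3 : R + R + R = (3 : ZMod p) • R := by
        rw [show (3 : ZMod p) = 2 + 1 by norm_num, add_smul, two_smul, one_smul]
      have n4 : ‖(4 : PadicAlgCl p)‖ = 1 := by
        rw [show (4 : PadicAlgCl p) = 2 * 2 by norm_num, norm_mul, h.n2, one_mul]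
      have tr := h.sys.triple R hR0 (by rw [e2]; exact smul_ne_zero h2z hR0)
        (by rw [e3]; exact smul_ne_zero h3z hR0)
        (norm_ne_zero_iff.1 (by rw [n4]; norm_num))
      have hX3 : ‖X (R + R + R)‖ ≤ 1 := by
        rw [e3, hR, smul_smul]; exact hQ _ (mul_ne_zero h3z (pow_ne_zero 3 hc))
      subst hB
      generalize X R = ξ at tr hlt
      generalize X (R + R + R) = η at tr hX3
      have hn := congrArg norm tr
      have l1 : ‖(ξ - η) * (3 * ξ ^ 4 + 6 * A * ξ ^ 2 + 12 * 1 * ξ - A ^ 2) ^ 2‖ < 1 := by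
        have hInteg : ∀ n : ℕ, ‖(n : PadicAlgCl p)‖ ≤ 1 := nat_le
        have : ‖3 * ξ ^ 4 + 6 * A * ξ ^ 2 + 12 * 1 * ξ - A ^ 2‖ < 1 := by
          rw [show 3 * ξ ^ 4 + 6 * A * ξ ^ 2 + 12 * 1 * ξ - A ^ 2 = 
            ξ * (3 * ξ ^ 3 + 6 * A * ξ + 12) + A * (- A) by ring]
          refine na_lt (nm_lt' hlt ?_) (nm_lt' hA (by rw [norm_neg]; exact hA.le))
          exact na_le (na_le (nm_le (ofNat_le 3) (np_le hlt.le _)) (nm_le (nm_le (ofNat_le 6) hA.le) hlt.le)) (ofNat_le 12)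
        refine nm_lt (na_sub_le hlt.le hX3) ?_
        rw [pow_two]
        exact nm_lt this.le this
      rw [hn] at l1
      have l2 : ‖ξ ^ 3 + A * ξ + 1‖ = 1 := by
        rw [show ξ ^ 3 + A * ξ + 1 = 1 + ξ * (ξ ^ 2 + A) by ring]
        rw [na_eq, norm_one]
        rw [norm_one]
        exact nm_lt' hlt (na_le (np_le hlt.le _) hA.le)
      have l3 : ‖2 * (ξ ^ 6 + 5 * A * ξ ^ 4 + 20 * 1 * ξ ^ 3 - 5 * A ^ 2 * ξ ^ 2 - 4 * A * 1 * ξ - 8 * 1 ^ 2 - A ^ 3)‖ = 1 := by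
        have n8 : ‖(-8 : PadicAlgCl p)‖ = 1 := by
          rw [norm_neg, show (8 : PadicAlgCl p) = 2 * 4 by norm_num, norm_mul, h.n2, n4, one_mul]
        rw [norm_mul, h.n2, one_mul, show ξ ^ 6 + 5 * A * ξ ^ 4 + 20 * 1 * ξ ^ 3 - 5 * A ^ 2 * ξ ^ 2 - 4 * A * 1 * ξ - 8 * 1 ^ 2 - A ^ 3 = -8 + (ξ * (ξ ^ 5 + 5 * (A * ξ ^ 3) + 20 * ξ ^ 2 - 5 * (A ^ 2 * ξ) - 4 * A) - A * A ^ 2) by ring]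
        rw [na_eq, n8]
        rw [n8]
        refine na_sub_lt (nm_lt' hlt ?_) (nm_lt' hA (np_le hA.le _))
        exact na_sub_le (na_sub_le (na_le (na_le (np_le hlt.le _) (nm_le (ofNat_le 5) (nm_le hA.le (np_le hlt.le _))))
          (nm_le (ofNat_le 20) (np_le hlt.le _))) (nm_le (ofNat_le 5) (nm_le (np_le hA.le _) hlt.le))) (nm_le (ofNat_le 4) hA.le)
      rw [norm_mul, l3, norm_mul, n4, l2] at l1
      norm_num at l1
end Core
end

section
open Polynomial

section
variable {K : Type*} [NormedField K] [IsUltrametricDist K]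

def Bd (t : K) (r : ℝ) (f : K[X]) : Prop := ∀ i, ‖f.coeff i‖ * ‖t‖ ^ i ≤ r

theorem na_sum {ι : Type*} (s : Finset ι) (f : ι → K) (r : ℝ) (hr : 0 ≤ r) (h : ∀ i ∈ s, ‖f i‖ ≤ r) :
    ‖∑ i ∈ s, f i‖ ≤ r := by
  classical
  induction s using Finset.induction_on with
  | empty => simpa
  | insert a s ha ih =>
    rw [Finset.sum_insert ha]
    exact na_le (h a (Finset.mem_insert_self _ _)) (ih fun i hi => h i (Finset.mem_insert_of_mem hi))

theorem Bd.mul {t : K} {r s : ℝ} {f g : K[X]} (hf : Bd t r f) (hg : Bd t s g) (ht : t ≠ 0) : Bd t (r * s) (f * g) := by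
  intro i
  have hr : 0 ≤ r := (by positivity : 0 ≤ ‖f.coeff 0‖ * ‖t‖ ^ 0).trans (hf 0)
  have hs : 0 ≤ s := (by positivity : 0 ≤ ‖g.coeff 0‖ * ‖t‖ ^ 0).trans (hg 0)
  have htn : 0 < ‖t‖ := norm_pos_iff.2 ht
  rw [coeff_mul, ← norm_pow, ← norm_mul, Finset.sum_mul]
  apply na_sum _ _ _ (mul_nonneg hr hs)
  rintro ⟨a, b⟩ hab
  have hab := Finset.HasAntidiagonal.mem_antidiagonal.1 hab
  simp only at hab ⊢
  rw [← hab, pow_add, norm_mul, norm_mul, norm_mul, norm_pow, norm_pow]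
  calc ‖f.coeff a‖ * ‖g.coeff b‖ * (‖t‖ ^ a * ‖t‖ ^ b) = (‖f.coeff a‖ * ‖t‖ ^ a) * (‖g.coeff b‖ * ‖t‖ ^ b) := by ring
    _ ≤ r * s := mul_le_mul (hf a) (hg b) (by positivity) hr

theorem Bd.sum {t : K} {r : ℝ} {ι : Type*} (s : Finset ι) (f : ι → K[X]) (hr : 0 ≤ r)
    (h : ∀ i ∈ s, Bd t r (f i)) : Bd t r (∑ i ∈ s, f i) := by
  intro i
  rw [finset_sum_coeff, ← norm_pow, ← norm_mul, Finset.sum_mul]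
  apply na_sum _ _ _ hr
  intro j hj
  rw [norm_mul, norm_pow]
  exact h j hj i

theorem Bd.prod {t : K} (ht : t ≠ 0) {ι : Type*} (s : Finset ι) (f : ι → K[X]) 
    (h : ∀ i ∈ s, Bd t 1 (f i)) : Bd t 1 (∏ i ∈ s, f i) := by
  classical
  induction s using Finset.induction_on with
  | empty =>
    intro i
    rw [Finset.prod_empty, coeff_one]
    split_ifs with h
    · simp [h]
    · simp
  | insert a s ha ih =>
    rw [Finset.prod_insert ha]
    have := (h a (Finset.mem_insert_self _ _)).mul (ih fun i hi => h i (Finset.mem_insert_of_mem hi)) ht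
    rwa [one_mul] at this

theorem Bd.C {t c : K} : Bd t ‖c‖ (C c) := by
  intro i
  rw [coeff_C]
  split_ifs with h
  · simp [h]
  · simp

theorem Bd.basisDivisor {t a b : K} (ht : t ≠ 0) (hb : ‖b‖ ≤ ‖t‖) (hab : ‖a - b‖ = ‖t‖) :
    Bd t 1 (Lagrange.basisDivisor a b) := by
  have htn : 0 < ‖t‖ := norm_pos_iff.2 ht
  intro i
  rw [Lagrange.basisDivisor, coeff_C_mul, norm_mul, norm_inv, hab, coeff_sub, coeff_X, coeff_C]
  match i with
  | 0 =>
    simp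
    rw [inv_mul_le_iff₀ htn]; linarith
  | 1 =>
    simp [htn.ne']
  | (n+2) => simp

end

theorem interp {p : ℕ} [Fact p.Prime] (S : Finset (PadicAlgCl p)) (π t : PadicAlgCl p) (hπ : π ∈ S) (hπ0 : π ≠ 0)
    (ht : t ≠ 0) (hS : ∀ σ : PadicAlgCl p ≃ₐ[ℚ_[p]] PadicAlgCl p, ∀ w ∈ S, σ w ∈ S)
    (v : PadicAlgCl p → PadicAlgCl p)
    (hv : ∀ σ : PadicAlgCl p ≃ₐ[ℚ_[p]] PadicAlgCl p, ∀ w ∈ S, v (σ w) = σ (v w))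
    (hN : ∀ w ∈ S, ‖w‖ = ‖π‖) (hv1 : ∀ w ∈ S, ‖v w‖ ≤ ‖t‖)
    (hsep : ∀ w ∈ S, ∀ w' ∈ S, w ≠ w' → ‖v w - v w'‖ = ‖t‖) :
    ∃ (i : ℕ) (c : ℚ_[p]), c ≠ 0 ∧ ‖algebraMap ℚ_[p] (PadicAlgCl p) c‖ * ‖t‖ ^ i = ‖π‖ := by
  classical
  have htn : 0 < ‖t‖ := norm_pos_iff.2 ht
  have hinj : Set.InjOn v S := by
    intro a ha b hb e
    by_contra hne
    have := hsep a ha b hb hne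
    rw [e, sub_self, norm_zero] at this
    linarith
  set g := Lagrange.interpolate S v id with hg
  have hbd : Bd t ‖π‖ g := by
    rw [hg, Lagrange.interpolate_apply]
    apply Bd.sum _ _ (norm_nonneg _)
    intro w hw
    have h1 : Bd t 1 (Lagrange.basis S v w) := by
      rw [Lagrange.basis]
      apply Bd.prod ht
      intro w' hw'
      rw [Finset.mem_erase] at hw'
      exact Bd.basisDivisor ht (hv1 _ hw'.2) (hsep _ hw _ hw'.2 hw'.1.symm)
    have := (Bd.C (t := t) (c := w)).mul h1 ht
    rw [mul_one, hN w hw] at this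
    exact this
  have hfix : ∀ σ : PadicAlgCl p ≃ₐ[ℚ_[p]] PadicAlgCl p, g.map (σ : PadicAlgCl p →+* PadicAlgCl p) = g := by
    intro σ
    refine Lagrange.eq_interpolate_of_eval_eq (r := id) hinj ?_ ?_
    · rw [degree_map]; exact Lagrange.degree_interpolate_lt _ hinj
    · intro w hw
      have hw' := hS σ.symm w hw
      have e : w = σ (σ.symm w) := (σ.apply_symm_apply w).symm
      have e2 : v w = (σ : PadicAlgCl p →+* PadicAlgCl p) (v (σ.symm w)) := by
        conv_lhs => rw [e]
        exact hv σ _ hw'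
      rw [e2, eval_map, eval₂_hom, Lagrange.eval_interpolate_at_node _ hinj hw']
      exact e.symm
  have hev : g.eval (v π) = π := Lagrange.eval_interpolate_at_node _ hinj hπ
  rw [eval_eq_sum_range] at hev
  obtain ⟨i, hi⟩ : ∃ i, ‖π‖ ≤ ‖g.coeff i‖ * ‖t‖ ^ i := by
    by_contra! hh
    have : ‖∑ i ∈ Finset.range (g.natDegree + 1), g.coeff i * v π ^ i‖ < ‖π‖ := by
      obtain ⟨j, hj, hj2⟩ := IsUltrametricDist.exists_norm_finsetSum_le_of_nonempty
        (Finset.nonempty_range_add_one (n := g.natDegree)) (fun i => g.coeff i * v π ^ i)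
      refine hj2.trans_lt (lt_of_le_of_lt ?_ (hh j))
      rw [norm_mul, norm_pow]
      gcongr
      exact hv1 _ hπ
    rw [hev] at this
    exact lt_irrefl _ this
  obtain ⟨c, hc⟩ := exists_coe_of_fixed (g.coeff i) (fun σ => by
    conv_rhs => rw [← hfix σ]
    rw [coeff_map]; rfl)
  have heq := le_antisymm (hbd i) hi
  refine ⟨i, c, ?_, by rw [hc]; exact heq⟩
  rintro rfl
  rw [map_zero] at hc
  rw [← hc, norm_zero, zero_mul] at heq
  exact hπ0 (norm_eq_zero.1 heq.symm)
end

section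
section
variable {K : Type*} [NormedField K] [IsUltrametricDist K]

theorem sing_of_close {A B ξ η s r : K} (h2 : ‖(2:K)‖ = 1) (hA : ‖A‖ ≤ 1) (hB : ‖B‖ ≤ 1) (hξ : ‖ξ‖ ≤ 1)
    (hd : ‖ξ - η‖ < 1) (hs : ‖s‖ ≤ 1) (hr : ‖r‖ ≤ 1)
    (e1 : (ξ - η) ^ 2 * s = 2 * ((ξ + η) * (A + ξ * η) + 2 * B))
    (e2 : (ξ - η) ^ 2 * r = (ξ * η - A) ^ 2 - 4 * B * (ξ + η)) :
    ‖ξ ^ 3 + A * ξ + B‖ < 1 ∧ ‖3 * ξ ^ 2 + A‖ < 1 := by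
  obtain ⟨d, rfl⟩ : ∃ d, η = ξ + d := ⟨η - ξ, by ring⟩
  have hd : ‖d‖ < 1 := by
    have e : ξ - (ξ + d) = -d := by ring
    rwa [e, norm_neg] at hd
  have n2 := ofNat_le (K := K) 2
  have n4 := ofNat_le (K := K) 4
  have n8 := ofNat_le (K := K) 8
  have f1 : ‖2 * 2 * (ξ ^ 3 + A * ξ + B)‖ < 1 := by
    have e : 2 * 2 * (ξ ^ 3 + A * ξ + B) = d * (d * s - (2 * (A + ξ ^ 2) + 4 * ξ ^ 2 + 2 * (ξ * d))) := by
      linear_combination -e1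
    rw [e]
    exact nm_lt' hd (na_sub_le (nm_le hd.le hs) (na_le (na_le (nm_le n2 (na_le hA (np_le hξ _)))
      (nm_le n4 (np_le hξ _))) (nm_le n2 (nm_le hξ hd.le))))
  rw [norm_mul, norm_mul, h2, one_mul, one_mul] at f1
  refine ⟨f1, ?_⟩
  have f2 : ‖(3 * ξ ^ 2 + A) ^ 2‖ < 1 := by
    have e : (3 * ξ ^ 2 + A) ^ 2 = 8 * ξ * (ξ ^ 3 + A * ξ + B) +
        d * (d * r - (2 * (ξ * (ξ ^ 2 - A)) + ξ ^ 2 * d - 4 * B)) := by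
      linear_combination -e2
    rw [e]
    exact na_lt (nm_lt (nm_le n8 hξ) f1) (nm_lt' hd (na_sub_le (nm_le hd.le hr)
      (na_sub_le (na_le (nm_le n2 (nm_le hξ (na_sub_le (np_le hξ _) hA))) (nm_le (np_le hξ _) hd.le)) (nm_le n4 hB))))
  rw [norm_pow] at f2
  by_contra! hge
  exact absurd f2 (not_lt.2 (one_le_pow₀ hge))

theorem sing_k3 {A ξ : K} (h3 : ‖(3:K)‖ = 1) (hA : ‖A‖ < 1) (hξ : ‖ξ‖ ≤ 1)
    (h : ‖ξ ^ 3 + A * ξ + 1‖ < 1 ∧ ‖3 * ξ ^ 2 + A‖ < 1) : False := by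
  have e1 : ‖3 * ξ ^ 2‖ < 1 := by
    have := na_sub_lt h.2 hA
    rwa [add_sub_cancel_right] at this
  rw [norm_mul, h3, one_mul] at e1
  have e2 : ‖(1:K)‖ < 1 := by
    have e : (1:K) = (ξ ^ 3 + A * ξ + 1) - (ξ ^ 2 * ξ + A * ξ) := by ring
    rw [e]
    exact na_sub_lt h.1 (na_lt (nm_lt' e1 hξ) (nm_lt' hA hξ))
  rw [norm_one] at e2
  exact lt_irrefl _ e2

theorem sing_k2 {B ξ : K} (h2 : ‖(2:K)‖ = 1) (hB : ‖B‖ ≤ 1) (hξ : ‖ξ‖ ≤ 1)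
    (h : ‖ξ ^ 3 + 1 * ξ + B‖ < 1 ∧ ‖3 * ξ ^ 2 + 1‖ < 1) :
    ‖ξ + 3 * B / 2‖ < 1 ∧ ‖27 * B ^ 2 / 4 + 1‖ < 1 := by
  have h20 : (2:K) ≠ 0 := norm_ne_zero_iff.1 (by rw [h2]; norm_num)
  have h40 : (4:K) ≠ 0 := by rw [show (4:K) = 2 * 2 by norm_num]; exact mul_ne_zero h20 h20
  have n3 := ofNat_le (K := K) 3
  have n9 := ofNat_le (K := K) 9
  have e1 : ‖2 * (ξ + 3 * B / 2)‖ < 1 := by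
    have e : 2 * (ξ + 3 * B / 2) = 3 * (ξ ^ 3 + 1 * ξ + B) - ξ * (3 * ξ ^ 2 + 1) := by
      field_simp; ring
    rw [e]
    exact na_sub_lt (nm_lt n3 h.1) (nm_lt hξ h.2)
  rw [norm_mul, h2, one_mul] at e1
  refine ⟨e1, ?_⟩
  have e : 27 * B ^ 2 / 4 + 1 = (3 * ξ ^ 2 + 1) - (ξ + 3 * B / 2) * (3 * (ξ + 3 * B / 2) - 9 * B) := by
    field_simp; ring
  rw [e]
  exact na_sub_lt h.2 (nm_lt' e1 (na_sub_le (nm_le n3 e1.le) (nm_le n9 hB)))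

theorem sing_contra {B b T1 T2 Tp Tm : K} (h2 : ‖(2:K)‖ = 1) (h3 : ‖(3:K)‖ = 1) (hB : ‖B‖ ≤ 1)
    (hbd : b = 27 * B ^ 2 / 4 + 1) (hb : ‖b‖ < 1) (hT : ‖T1‖ = ‖T2‖) (hT1 : ‖T1‖ < 1) (hT0 : T1 ≠ 0)
    (hp : ‖Tp‖ < 1) (hm : ‖Tm‖ < 1)
    (e1 : (T1 - T2) ^ 2 * (Tp + Tm) = 2 * (T1 + T2) * (b + T1 * T2) - 18 * B * (T1 * T2) - 2 * B * b)
    (e2 : (T1 - T2) ^ 2 * (Tp * Tm) = (T1 * T2 - b) ^ 2 + 2 * B * b * (T1 + T2) - 9 * B ^ 2 * b) : False := by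
  have n2 := ofNat_le (K := K) 2
  have h20 : (2:K) ≠ 0 := norm_ne_zero_iff.1 (by rw [h2]; norm_num)
  have h40 : (4:K) ≠ 0 := by rw [show (4:K) = 2 * 2 by norm_num]; exact mul_ne_zero h20 h20
  set τ := ‖T1‖ with hτ
  have hτ0 : 0 < τ := norm_pos_iff.2 hT0
  have hB1 : ‖B‖ = 1 := by
    by_contra hne
    have hlt := lt_of_le_of_ne hB hne
    have e : (4:K) = 4 * b - 27 * B * B := by rw [hbd]; field_simp; ring
    have e' : ‖(4:K)‖ < 1 := by
      rw [e]
      exact na_sub_lt (nm_lt (ofNat_le 4) hb) (nm_lt (nm_le (ofNat_le 27) hB) hlt)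
    rw [show (4:K) = 2 * 2 by norm_num, norm_mul, h2] at e'
    norm_num at e'
  have h9 : ‖(9:K)‖ = 1 := by rw [show (9:K) = 3 * 3 by norm_num, norm_mul, h3, one_mul]
  have h18 : ‖(18:K)‖ = 1 := by rw [show (18:K) = 2 * 9 by norm_num, norm_mul, h2, h9, one_mul]
  have hsq : ‖T1 * T2‖ = τ ^ 2 := by rw [norm_mul, ← hT, pow_two]
  have hd : ‖(T1 - T2) ^ 2‖ ≤ τ ^ 2 := by
    rw [norm_pow]
    gcongr
    exact na_sub_le le_rfl hT.symm.le
  have hsum : ‖T1 + T2‖ < 1 := na_lt hT1 (hT ▸ hT1)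
  have small : ∀ w : K, ‖w‖ < 1 → ‖(T1 - T2) ^ 2 * w‖ < τ ^ 2 := by
    intro w hw
    rw [norm_mul]
    calc _ ≤ τ ^ 2 * ‖w‖ := by gcongr
      _ < τ ^ 2 * 1 := by gcongr
      _ = _ := mul_one _
  have hl1 := small _ (na_lt hp hm)
  have hl2 := small _ (nm_lt hp.le hm)
  rcases lt_or_ge ‖b‖ (τ ^ 2) with hlt | hge
  · have e : T1 * T2 * (18 * B) = 2 * (T1 + T2) * (b + T1 * T2) - 2 * B * b - (T1 - T2) ^ 2 * (Tp + Tm) := by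
      linear_combination e1
    have l : ‖T1 * T2 * (18 * B)‖ < τ ^ 2 := by
      rw [e]
      refine na_sub_lt (na_sub_lt ?_ ?_) hl1
      · rw [norm_mul]
        have q1 : ‖2 * (T1 + T2)‖ < 1 := nm_lt n2 hsum
        have q2 : ‖b + T1 * T2‖ ≤ τ ^ 2 := na_le hlt.le hsq.le
        calc _ ≤ ‖2 * (T1 + T2)‖ * τ ^ 2 := by gcongr
          _ < 1 * τ ^ 2 := by gcongr
          _ = _ := one_mul _
      · rw [norm_mul, norm_mul, h2, hB1, one_mul, one_mul]; exact hlt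
    rw [norm_mul, hsq, norm_mul, h18, hB1, mul_one, mul_one] at l
    exact lt_irrefl _ l
  · have hb0 : 0 < ‖b‖ := lt_of_lt_of_le (by positivity) hge
    have e : 9 * B ^ 2 * b = (T1 * T2 - b) ^ 2 + 2 * B * b * (T1 + T2) - (T1 - T2) ^ 2 * (Tp * Tm) := by
      linear_combination e2
    have l : ‖9 * B ^ 2 * b‖ < ‖b‖ := by
      rw [e]
      refine na_sub_lt (na_lt ?_ ?_) (hl2.trans_le hge)
      · rw [norm_pow, pow_two]
        have q : ‖T1 * T2 - b‖ ≤ ‖b‖ := na_sub_le (hsq.le.trans hge) le_rfl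
        calc _ ≤ ‖b‖ * ‖b‖ := by gcongr
          _ < 1 * ‖b‖ := by gcongr
          _ = _ := one_mul _
      · rw [norm_mul, norm_mul, norm_mul, h2, hB1, one_mul, one_mul]
        calc _ < ‖b‖ * 1 := by gcongr
          _ = _ := mul_one _
    rw [norm_mul, norm_mul, norm_pow, h9, hB1, one_pow, one_mul, one_mul] at l
    exact lt_irrefl _ l
end

namespace Core
variable {p : ℕ} [Fact p.Prime] {L : Type} [Field L] [Fintype L] [DecidableEq L] [Algebra (ZMod p) L]
    {x X : L → PadicAlgCl p} {k : ℕ} {q : ℚ_[p]} {t A B : PadicAlgCl p}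

theorem x_smul (h : Core p L x X k q t A B) {P : L} (hP : P ≠ 0) {c d : ZMod p} (hc : c ≠ 0) (hd : d ≠ 0) :
    x (c • P) = x (d • P) ↔ c = d ∨ c = -d := by
  rw [h.x_eq (smul_ne_zero hc hP) (smul_ne_zero hd hP), smul_pow, smul_pow,
    (smul_left_injective _ (pow_ne_zero 2 hP)).eq_iff, sq_eq_sq_iff_eq_or_eq_neg]

theorem x_pm (h : Core p L x X k q t A B) {c d : ZMod p} (e : c = d ∨ c = -d) (m : ZMod p) (Q : L) :
    x ((c * m) • Q) = x ((d * m) • Q) := by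
  rcases e with rfl | rfl
  · rfl
  · rw [neg_mul, neg_smul, h.hx, h.sys.neg, ← h.hx]

theorem noint (h : Core p L x X k q t A B) (h17 : 17 ≤ p) (N : ℤ) : (k:ℝ) * (2 / (p - 1)) ≠ N := by
  intro e
  have hp : (17:ℝ) ≤ p := by exact_mod_cast h17
  have hk : (k:ℝ) = 2 ∨ (k:ℝ) = 3 := by
    rcases h.hk with ⟨h, _⟩ | ⟨h, _⟩ <;> simp [h]
  have e' : (N:ℝ) * (p - 1) = 2 * k := by
    rw [← e]; field_simp [show (p:ℝ) - 1 ≠ 0 by linarith]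
  rcases le_or_gt N 0 with hN | hN
  · have : (N:ℝ) ≤ 0 := by exact_mod_cast hN
    have : (N:ℝ) * (p - 1) ≤ 0 := mul_nonpos_of_nonpos_of_nonneg this (by linarith)
    rcases hk with hk | hk <;> rw [hk] at e' <;> linarith
  · have : (1:ℝ) ≤ N := by exact_mod_cast hN
    have : 1 * ((p:ℝ) - 1) ≤ N * (p - 1) := by gcongr; linarith
    rcases hk with hk | hk <;> rw [hk] at e' <;> linarith

theorem close (h : Core p L x X k q t A B) (h17 : 17 ≤ p) {P Q : L} (hP0 : P ≠ 0) 
    (hP : ∀ c : ZMod p, c ≠ 0 → 1 < ‖X (c • P)‖ ∧ lv (X (c • P)) = 2 / (p - 1))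
    (hQ : ∀ c : ZMod p, c ≠ 0 → ‖X (c • Q)‖ ≤ 1)
    (hg : ∀ σ : PadicAlgCl p ≃ₐ[ℚ_[p]] PadicAlgCl p, ∃ l : ZMod p, l ≠ 0 ∧
        (∀ m : ZMod p, m ≠ 0 → σ (x (m • P)) = x ((l * m) • P)) ∧
        (∀ m : ZMod p, m ≠ 0 → σ (x (m • Q)) = x ((l * m) • Q))) (m0 : ZMod p) (hm0 : m0 ≠ 0) :
    ∃ c c' : ZMod p, c ≠ 0 ∧ c' ≠ 0 ∧ ¬ (c = c' ∨ c = -c') ∧ 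
      (∃ σ : PadicAlgCl p ≃ₐ[ℚ_[p]] PadicAlgCl p, σ (x (m0 • Q)) = x ((c * m0) • Q)) ∧
      ‖X ((c * m0) • Q) - X ((c' * m0) • Q)‖ < 1 := by
  classical
  by_contra! hcon
  set Λ : ZMod p → Prop := fun c => c ≠ 0 ∧ ∃ σ : PadicAlgCl p ≃ₐ[ℚ_[p]] PadicAlgCl p, σ (x P) = x (c • P) with hΛ
  set S : Finset (PadicAlgCl p) := (Finset.univ.filter Λ).image (fun c => x (c • P)) with hS
  have memS : ∀ w, w ∈ S ↔ ∃ c, Λ c ∧ x (c • P) = w := by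
    intro w; simp [hS]
  have hex : ∀ w : PadicAlgCl p, ∃ c, w ∈ S → Λ c ∧ x (c • P) = w := by
    intro w
    by_cases hw : w ∈ S
    · obtain ⟨c, hc⟩ := (memS w).1 hw
      exact ⟨c, fun _ => hc⟩
    · exact ⟨0, fun h => absurd h hw⟩
  choose f hf using hex
  set v : PadicAlgCl p → PadicAlgCl p := fun w => x ((f w * m0) • Q) with hv
  have hvc : ∀ c, Λ c → v (x (c • P)) = x ((c * m0) • Q) := by
    intro c hc
    have := hf (x (c • P)) ((memS _).2 ⟨c, hc, rfl⟩)
    exact h.x_pm ((h.x_smul hP0 this.1.1 hc.1).1 this.2) _ _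
  have hΛσ : ∀ c, Λ c → ∃ σ : PadicAlgCl p ≃ₐ[ℚ_[p]] PadicAlgCl p, σ (x (m0 • Q)) = x ((c * m0) • Q) := by
    rintro c ⟨hc, σ, hσ⟩
    obtain ⟨l, hl, h1, h2⟩ := hg σ
    refine ⟨σ, ?_⟩
    rw [h2 m0 hm0]
    apply h.x_pm
    apply (h.x_smul hP0 hl hc).1
    have := h1 1 one_ne_zero
    rw [one_smul, mul_one] at this
    rw [← this, hσ]
  have hmul : ∀ (σ : PadicAlgCl p ≃ₐ[ℚ_[p]] PadicAlgCl p), ∃ l, (∀ c, Λ c → Λ (l * c) ∧ σ (x (c • P)) = x ((l * c) • P)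
      ∧ σ (x ((c * m0) • Q)) = x ((l * c * m0) • Q)) := by
    intro σ
    obtain ⟨l, hl, h1, h2⟩ := hg σ
    refine ⟨l, ?_⟩
    rintro c ⟨hc, s, hs⟩
    refine ⟨⟨mul_ne_zero hl hc, s.trans σ, ?_⟩, h1 c hc, ?_⟩
    · rw [AlgEquiv.trans_apply, hs, h1 c hc]
    · rw [h2 _ (mul_ne_zero hc hm0), mul_assoc]
  have hΛ1 : Λ 1 := ⟨one_ne_zero, AlgEquiv.refl, by simp⟩
  have hnx : ∀ c : ZMod p, c ≠ 0 → X (c • P) ≠ 0 := by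
    intro c hc e
    have := (hP c hc).1
    rw [e, norm_zero] at this; linarith
  have hp1 := p_one_lt (p := p)
  obtain ⟨i, c0, hc0, hi⟩ := interp S (x ((1 : ZMod p) • P)) t ((memS _).2 ⟨1, hΛ1, rfl⟩)
    (by rw [h.hx]; exact mul_ne_zero (hnx 1 one_ne_zero) h.ht) h.ht
    (by
      intro σ w hw
      obtain ⟨c, hc, rfl⟩ := (memS w).1 hw
      obtain ⟨l, hl⟩ := hmul σ
      exact (memS _).2 ⟨l * c, (hl c hc).1, (hl c hc).2.1.symm⟩) v
    (by
      intro σ w hw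
      obtain ⟨c, hc, rfl⟩ := (memS w).1 hw
      obtain ⟨l, hl⟩ := hmul σ
      obtain ⟨a1, a2, a3⟩ := hl c hc
      rw [a2, hvc _ a1, hvc _ hc, a3])
    (by
      intro w hw
      obtain ⟨c, hc, rfl⟩ := (memS w).1 hw
      have e : lv (X (c • P)) = lv (X ((1 : ZMod p) • P)) := by
        rw [(hP c hc.1).2, (hP 1 one_ne_zero).2]
      rw [h.hx, h.hx, norm_mul, norm_mul]
      congr 1
      exact Real.logb_injOn_pos hp1 (norm_pos_iff.2 (hnx c hc.1)) (norm_pos_iff.2 (hnx 1 one_ne_zero)) e)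
    (by
      intro w hw
      obtain ⟨c, hc, rfl⟩ := (memS w).1 hw
      rw [hvc c hc, h.hx, norm_mul]
      exact mul_le_of_le_one_left (norm_nonneg _) (hQ _ (mul_ne_zero hc.1 hm0)))
    (by
      intro w hw w' hw' hne
      obtain ⟨c, hc, rfl⟩ := (memS w).1 hw
      obtain ⟨c', hc', rfl⟩ := (memS w').1 hw'
      rw [hvc c hc, hvc c' hc', h.hx, h.hx, ← sub_mul, norm_mul]
      have hge := hcon c c' hc.1 hc'.1 (by rw [← not_or]; exact fun e => hne ((h.x_smul hP0 hc.1 hc'.1).2 e)) (hΛσ c hc)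
      have hle : ‖X ((c * m0) • Q) - X ((c' * m0) • Q)‖ ≤ 1 :=
        na_sub_le (hQ _ (mul_ne_zero hc.1 hm0)) (hQ _ (mul_ne_zero hc'.1 hm0))
      rw [le_antisymm hle hge, one_mul])
  have hc0' : algebraMap ℚ_[p] (PadicAlgCl p) c0 ≠ 0 := (map_ne_zero _).2 hc0
  rw [← norm_pow, ← norm_mul] at hi
  have hi2 : lv (algebraMap ℚ_[p] (PadicAlgCl p) c0 * t ^ i) = lv (x ((1 : ZMod p) • P)) := by
    rw [lv, hi]; rfl
  rw [lv_mul hc0' (pow_ne_zero _ h.ht), lv_pow, h.lvx (hnx 1 one_ne_zero), (hP 1 one_ne_zero).2] at hi2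
  obtain ⟨n, hn⟩ := lv_coe c0 hc0
  obtain ⟨m, hm⟩ := h.lvt
  rw [hn] at hi2
  apply h.noint h17 (k * n + i * m - m)
  push_cast
  linear_combination (-(k:ℝ)) * hi2 + (i - 1) * hm

theorem case5 (h : Core p L x X k q t A B) (h9 : p % 9 = 8) (hn : ∃ v, v ≠ 0 ∧ ‖X v‖ ≤ 1) : False := by
  have hp : p.Prime := Fact.out
  have h5 := h.hp5
  have h17 : 17 ≤ p := by
    by_contra! hlt
    have : p = 8 := by omega
    rw [this] at hp; norm_num at hp
  obtain ⟨P, Q, hP0, hQ0, hP, hQ, hg⟩ := h.nonformal hn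
  have hg : ∀ σ : PadicAlgCl p ≃ₐ[ℚ_[p]] PadicAlgCl p, ∃ l : ZMod p, l ≠ 0 ∧
        (∀ m : ZMod p, m ≠ 0 → σ (x (m • P)) = x ((l * m) • P)) ∧
        (∀ m : ZMod p, m ≠ 0 → σ (x (m • Q)) = x ((l * m) • Q)) := fun σ => by
    obtain ⟨l, h1, _, h2, h3⟩ := hg σ; exact ⟨l, h1, h2, h3⟩
  have hcl := h.close h17 hP0 hP hQ hg
  -- addition for multiples of Q
  have hadd : ∀ c c' : ZMod p, c ≠ 0 → c' ≠ 0 → ¬ (c = c' ∨ c = -c') →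
      (c + c' ≠ 0 ∧ c - c' ≠ 0) ∧
      (X (c • Q) - X (c' • Q)) ^ 2 * (X ((c + c') • Q) + X ((c - c') • Q)) =
        2 * ((X (c • Q) + X (c' • Q)) * (A + X (c • Q) * X (c' • Q)) + 2 * B) ∧
      (X (c • Q) - X (c' • Q)) ^ 2 * (X ((c + c') • Q) * X ((c - c') • Q)) =
        (X (c • Q) * X (c' • Q) - A) ^ 2 - 4 * B * (X (c • Q) + X (c' • Q)) := by
    intro c c' hc hc' hne
    push Not at hne
    have a1 : c • Q ≠ c' • Q := fun e => hne.1 (smul_left_injective _ hQ0 e)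
    have a2 : c • Q ≠ -(c' • Q) := fun e => hne.2 (smul_left_injective _ hQ0 (by simpa [neg_smul] using e))
    refine ⟨⟨fun e => hne.2 (eq_neg_of_add_eq_zero_left e), sub_ne_zero.2 hne.1⟩, ?_, ?_⟩
    · rw [add_smul, sub_smul]
      exact h.sys.add_sum _ _ (smul_ne_zero hc hQ0) (smul_ne_zero hc' hQ0) a1 a2
    · rw [add_smul, sub_smul]
      exact h.sys.add_prod _ _ (smul_ne_zero hc hQ0) (smul_ne_zero hc' hQ0) a1 a2
  have hsing : ∀ m0 : ZMod p, m0 ≠ 0 → ∃ c : ZMod p, c ≠ 0 ∧ 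
      (∃ σ : PadicAlgCl p ≃ₐ[ℚ_[p]] PadicAlgCl p, σ (x (m0 • Q)) = x ((c * m0) • Q)) ∧
      ‖X ((c * m0) • Q) ^ 3 + A * X ((c * m0) • Q) + B‖ < 1 ∧ ‖3 * X ((c * m0) • Q) ^ 2 + A‖ < 1 := by
    intro m0 hm0
    obtain ⟨c, c', hc, hc', hne, hσ, hlt⟩ := hcl m0 hm0
    refine ⟨c, hc, hσ, ?_⟩
    have hne' : ¬ (c * m0 = c' * m0 ∨ c * m0 = -(c' * m0)) := by
      rintro (e | e)
      · exact hne (Or.inl (mul_right_cancel₀ hm0 e))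
      · rw [← neg_mul] at e
        exact hne (Or.inr (mul_right_cancel₀ hm0 e))
    obtain ⟨⟨b1, b2⟩, e1, e2⟩ := hadd _ _ (mul_ne_zero hc hm0) (mul_ne_zero hc' hm0) hne'
    exact sing_of_close h.n2 h.hA h.hB (hQ _ (mul_ne_zero hc hm0)) hlt
      (na_le (hQ _ b1) (hQ _ b2)) (nm_le (hQ _ b1) (hQ _ b2)) e1 e2
  rcases h.hk with ⟨hk, hA, _⟩ | ⟨hk, hB, hA⟩
  swap
  · subst hB
    obtain ⟨c, hc, _, hs⟩ := hsing 1 one_ne_zero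
    exact sing_k3 h.n3 hA (hQ _ (mul_ne_zero hc one_ne_zero)) hs
  subst hA
  set T : L → PadicAlgCl p := fun u => X u + 3 * B / 2 with hT
  have hTgal : ∀ (σ : PadicAlgCl p ≃ₐ[ℚ_[p]] PadicAlgCl p) (u v : L), σ (x u) = x v → ‖T v‖ = ‖T u‖ := by
    intro σ u v e
    obtain ⟨b, hb⟩ := h.hBq
    have htq := h.htq
    rw [hk] at htq
    have hq0 : algebraMap ℚ_[p] (PadicAlgCl p) q ≠ 0 := (map_ne_zero _).2 h.hq
    have hBt : B * t = algebraMap ℚ_[p] (PadicAlgCl p) (b / q) := by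
      rw [map_div₀, ← hb, eq_div_iff hq0, ← htq]; ring
    have ht : ∀ u, T u * t = x u + 3 * (algebraMap ℚ_[p] (PadicAlgCl p) (b / q)) / 2 := by
      intro u
      rw [← hBt, h.hx, hT]; ring
    have : σ (T u * t) = T v * t := by
      rw [ht, ht, map_add, e, map_div₀, map_mul, AlgEquiv.commutes, map_ofNat, map_ofNat]
    have := congrArg norm this
    rw [norm_gal, norm_mul, norm_mul] at this
    exact (mul_right_cancel₀ (norm_ne_zero_iff.2 h.ht) this).symm
  have hb : ‖27 * B ^ 2 / 4 + 1‖ < 1 := by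
    obtain ⟨c, hc, _, hs⟩ := hsing 1 one_ne_zero
    exact (sing_k2 h.n2 h.hB (hQ _ (mul_ne_zero hc one_ne_zero)) hs).2
  have hTall : ∀ m : ZMod p, m ≠ 0 → ‖T (m • Q)‖ < 1 := by
    intro m hm
    obtain ⟨c, hc, ⟨σ, hσ⟩, hs⟩ := hsing m hm
    rw [← hTgal σ _ _ hσ]
    exact (sing_k2 h.n2 h.hB (hQ _ (mul_ne_zero hc hm)) hs).1
  obtain ⟨σ, l, hl, hl1, hσ⟩ : ∃ (σ : PadicAlgCl p ≃ₐ[ℚ_[p]] PadicAlgCl p) (l : ZMod p), l ≠ 0 ∧ ¬ (l = 1 ∨ l = -1) ∧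
      σ (x ((1:ZMod p) • Q)) = x (l • Q) := by
    by_contra! hcon
    have hX0 : X ((1:ZMod p) • P) ≠ 0 := by
      intro e
      have := (hP 1 one_ne_zero).1
      rw [e, norm_zero] at this; linarith
    obtain ⟨c0, hc0⟩ := exists_coe_of_fixed (x ((1:ZMod p) • P)) (by
      intro σ
      obtain ⟨l, hl, h1, h2⟩ := hg σ
      rw [h1 1 one_ne_zero]
      have : l = 1 ∨ l = -1 := by
        by_contra hne
        exact hcon σ l hl (not_or.1 hne) (by rw [h2 1 one_ne_zero, mul_one])
      rw [mul_one, h.x_smul hP0 hl one_ne_zero]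
      exact this)
    have hc00 : c0 ≠ 0 := by
      rintro rfl
      rw [map_zero, h.hx] at hc0
      exact mul_ne_zero hX0 h.ht hc0.symm
    obtain ⟨n, hn⟩ := lv_coe c0 hc00
    obtain ⟨m, hm⟩ := h.lvt
    rw [hc0, h.lvx hX0, (hP 1 one_ne_zero).2] at hn
    apply h.noint h17 (k * n - m)
    push_cast
    linear_combination (k:ℝ) * hn - hm
  obtain ⟨⟨b1, b2⟩, e1, e2⟩ := hadd l 1 hl one_ne_zero hl1
  have hTT : ‖T (l • Q)‖ = ‖T ((1:ZMod p) • Q)‖ := hTgal σ _ _ hσ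
  have h20 : (2:PadicAlgCl p) ≠ 0 := two_ne_zero
  refine sing_contra (B := B) (b := 27 * B ^ 2 / 4 + 1) h.n2 h.n3 h.hB rfl hb hTT (hTall l hl) ?_ (hTall _ b1) (hTall _ b2) ?_ ?_
  · intro e
    rw [e, norm_zero] at hTT
    have e' := norm_eq_zero.1 hTT.symm
    have : X (l • Q) = X ((1:ZMod p) • Q) := add_right_cancel (e.trans e'.symm)
    exact hl1 ((h.x_smul hQ0 hl one_ne_zero).1 (by rw [h.hx, h.hx, this]))
  · simp only [hT]
    linear_combination e1
  · simp only [hT]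
    linear_combination e2 + 3 * B / 2 * e1
end Core
end

section
open WeierstrassCurve WeierstrassCurve.Affine Matrix

theorem nsEps_nonsq (p : ℕ) [hp : Fact p.Prime] (hp2 : p ≠ 2) (r : ZMod p) : r ^ 2 ≠ nsEps p := by
  have hne : {n : ℕ | 0 < n ∧ ¬∃ x : ZMod p, x ^ 2 = (n : ZMod p)}.Nonempty := by
    obtain ⟨a, ha⟩ := FiniteField.exists_nonsquare (F := ZMod p) (by rwa [ZMod.ringChar_zmod_n])
    refine ⟨a.val, ?_, ?_⟩
    · rw [ZMod.val_pos]
      rintro rfl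
      exact ha (IsSquare.zero)
    · rintro ⟨x, hx⟩
      rw [ZMod.natCast_zmod_val] at hx
      exact ha ⟨x, by rw [← hx, pow_two]⟩
  have := Nat.sInf_mem hne
  intro e
  exact this.2 ⟨r, e⟩

instance nsFact (p : ℕ) [hp : Fact p.Prime] [h2 : Fact (p ≠ 2)] :
    Fact (∀ r : ZMod p, r ^ 2 ≠ nsEps p + 0 * r) :=
  ⟨fun r => by rw [zero_mul, add_zero]; exact nsEps_nonsq p h2.out r⟩

abbrev LL (p : ℕ) : Type := QuadraticAlgebra (ZMod p) (nsEps p) 0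

noncomputable instance (p : ℕ) [hp : Fact p.Prime] : Fintype (LL p) :=
  Fintype.ofEquiv _ (QuadraticAlgebra.equivProd (nsEps p) (0 : ZMod p)).symm

theorem LL_card (p : ℕ) [hp : Fact p.Prime] : Fintype.card (LL p) = p ^ 2 := by
  rw [Fintype.card_congr (QuadraticAlgebra.equivProd (nsEps p) (0 : ZMod p)), Fintype.card_prod, ZMod.card, pow_two]

theorem LL_star (p : ℕ) [hp : Fact p.Prime] [h2 : Fact (p ≠ 2)] (u : LL p) : star u = u ^ p := by
  haveI : CharP (LL p) p := charP_of_injective_algebraMap (algebraMap (ZMod p) (LL p)).injective p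
  have hodd : p = 2 * (p / 2) + 1 := by
    rcases hp.out.eq_two_or_odd with h | h
    · exact absurd h h2.out
    · omega
  have he0 : nsEps p ≠ 0 := by
    have := nsEps_nonsq p h2.out 0
    intro e; rw [e] at this; simp at this
  have heps : nsEps p ^ (p / 2) = -1 := by
    rcases ZMod.pow_div_two_eq_neg_one_or_one p he0 with h | h
    · exfalso
      obtain ⟨y, hy⟩ := (ZMod.euler_criterion p he0).2 h
      exact nsEps_nonsq p h2.out y (by rw [hy, pow_two])
    · exact h
  have hω : (QuadraticAlgebra.omega : LL p) ^ p = - QuadraticAlgebra.omega := by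
    have e : (QuadraticAlgebra.omega : LL p) ^ p = QuadraticAlgebra.omega ^ (2 * (p / 2) + 1) := congrArg _ hodd
    rw [e, pow_succ, pow_mul, pow_two, QuadraticAlgebra.omega_mul_omega_eq_algebraMap]
    simp only [zero_smul, add_zero, map_zero, zero_mul]
    rw [← map_pow, heps, map_neg, map_one, neg_one_mul]
  obtain ⟨a, b⟩ := u
  rw [QuadraticAlgebra.mk_eq_add_smul_omega, add_pow_char, smul_pow, ZMod.pow_card, hω, ← map_pow, ZMod.pow_card]
  ext <;> simp

open scoped Classical in
theorem galAct_mem (E : WeierstrassCurve ℚ) (p : ℕ) (σ : Qbar ≃ₐ[ℚ] Qbar) (P : pTorsion E p) :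
    galAct E σ P.1 ∈ pTorsion E p := by
  have hP : p • P.1 = 0 := P.2
  change p • (galAct E σ P.1) = 0
  rw [← map_nsmul, hP, map_zero]

open scoped Classical in
theorem exists_psi (E : WeierstrassCurve ℚ) (p : ℕ) [Fact p.Prime] [Fact (p ≠ 2)]
    (ρ : (Qbar ≃ₐ[ℚ] Qbar) →* GL (Fin 2) (ZMod p)) (hρ : IsModPRep E p ρ)
    (himg : ImageConjTo ρ (Gset p)) :
    ∃ ψ : LL p →+ (E.baseChange Qbar).toAffine.Point, Function.Injective ψ ∧ 
      ∀ σ : Qbar ≃ₐ[ℚ] Qbar, ∃ c : LL p, c ≠ 0 ∧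
        ((∀ u, galAct E σ (ψ u) = ψ (c ^ 3 * u)) ∨ (∀ u, galAct E σ (ψ u) = ψ ((c ^ 3 * u) ^ p))) := by
  obtain ⟨e, he⟩ := hρ
  obtain ⟨g, hg⟩ := himg
  let T : LL p ≃ₗ[ZMod p] (Fin 2 → ZMod p) := QuadraticAlgebra.linearEquivTuple (nsEps p) 0
  have hT : ∀ u, T u = ![u.re, u.im] := fun u => by
    simp [T]
  let mg : (Fin 2 → ZMod p) →+ (Fin 2 → ZMod p) := (Matrix.mulVecLin (g : Matrix (Fin 2) (Fin 2) (ZMod p))).toAddMonoidHom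
  have hmg : Function.Injective mg := Matrix.mulVec_injective_of_isUnit g.isUnit
  let ψ0 : LL p →+ pTorsion E p := e.symm.toAddMonoidHom.comp (mg.comp T.toLinearMap.toAddMonoidHom)
  have hψe : ∀ u, e (ψ0 u) = (g : Matrix (Fin 2) (Fin 2) (ZMod p)) *ᵥ (T u) := by
    intro u
    change e (e.symm _) = _
    rw [e.apply_symm_apply]; rfl
  have hψ0 : Function.Injective ψ0 := e.symm.injective.comp (hmg.comp T.injective)
  refine ⟨(pTorsion E p).subtype.comp ψ0, Subtype.val_injective.comp hψ0, fun σ => ?_⟩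
  have hmem : ρ σ ∈ (fun x => g * x * g⁻¹) '' Gset p := hg ▸ ⟨σ, rfl⟩
  obtain ⟨s, hs, hsσ⟩ := hmem
  have key : ∀ u w, (s : Matrix (Fin 2) (Fin 2) (ZMod p)) *ᵥ (T u) = T w →
      galAct E σ ((pTorsion E p).subtype.comp ψ0 u) = (pTorsion E p).subtype.comp ψ0 w := by
    intro u w h
    have h1 := he σ (ψ0 u) (galAct_mem E p σ _)
    have h2 : e ⟨galAct E σ (ψ0 u).1, galAct_mem E p σ _⟩ = e (ψ0 w) := by
      rw [h1, hψe, hψe, ← h, ← hsσ, Matrix.mulVec_mulVec, Matrix.mulVec_mulVec, ← Units.val_mul, ← Units.val_mul]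
      congr 2
      group
    exact congrArg Subtype.val (e.injective h2)
  have hC : ∀ (a b : ZMod p) (u : LL p), !![a, nsEps p * b; b, a] *ᵥ (T u) = T ((⟨a, b⟩ : LL p) * u) := by
    intro a b u
    rw [hT, hT]
    ext i
    fin_cases i
    · simp [Matrix.mulVec, dotProduct]
    · simp [Matrix.mulVec, dotProduct]; ring
  have hC3 : ∀ (a b : ZMod p) (u : LL p), !![a, nsEps p * b; b, a] ^ 3 *ᵥ (T u) = T ((⟨a, b⟩ : LL p) ^ 3 * u) := by
    intro a b u
    rw [pow_succ, pow_two, ← Matrix.mulVec_mulVec, ← Matrix.mulVec_mulVec, hC, hC, hC]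
    congr 1; ring
  have hD : ∀ u : LL p, !![1, 0; 0, -1] *ᵥ (T u) = T (u ^ p) := by
    intro u
    rw [← LL_star, hT, hT]
    ext i
    fin_cases i
    · simp [Matrix.mulVec, dotProduct]
    · simp [Matrix.mulVec, dotProduct]
  have hne : ∀ (m : GL (Fin 2) (ZMod p)) (a b : ZMod p),
      (m : Matrix (Fin 2) (Fin 2) (ZMod p)) = !![a, nsEps p * b; b, a] → (⟨a, b⟩ : LL p) ≠ 0 := by
    intro m a b hm e
    have ha : a = 0 := congrArg QuadraticAlgebra.re e
    have hb : b = 0 := congrArg QuadraticAlgebra.im e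
    have hd : IsUnit (m : Matrix (Fin 2) (Fin 2) (ZMod p)).det := (Matrix.isUnit_iff_isUnit_det _).1 m.isUnit
    rw [hm, ha, hb, Matrix.det_fin_two_of] at hd
    simp at hd
  rcases hs with ⟨m, ⟨a, b, hm⟩, rfl⟩ | ⟨m, ⟨a, b, hm⟩, hs⟩
  · refine ⟨⟨a, b⟩, hne m a b hm, Or.inl fun u => key _ _ ?_⟩
    rw [Units.val_pow_eq_pow_val, hm, hC3]
  · refine ⟨⟨a, b⟩, hne m a b hm, Or.inr fun u => key _ _ ?_⟩
    rw [hs, hm, ← Matrix.mulVec_mulVec, hC3, hD]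

theorem pxx_gal (E : WeierstrassCurve ℚ) (σ : Qbar ≃ₐ[ℚ] Qbar) (P : (E.baseChange Qbar).toAffine.Point) :
    pxx (E.baseChange Qbar) (galAct E σ P) = σ (pxx (E.baseChange Qbar) P) := by
  have hb : σ (E.baseChange Qbar).b₂ = (E.baseChange Qbar).b₂ := by
    have e : (E.baseChange Qbar).b₂ = algebraMap ℚ Qbar E.b₂ := WeierstrassCurve.map_b₂ _ _
    rw [e, AlgEquiv.commutes]
  rcases P with _ | ⟨x, y, h⟩
  · change (0 : Qbar) = σ 0
    rw [map_zero]
  · change σ x + (E.baseChange Qbar).b₂ / 12 = σ (x + (E.baseChange Qbar).b₂ / 12)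
    rw [map_add, map_div₀, hb, map_ofNat]

/-- transport of Galois automorphisms along the embedding into `ℚ_p`-bar -/
theorem exists_embed (p : ℕ) [Fact p.Prime] : ∃ ι : Qbar →+* PadicAlgCl p,
    ∀ σ : PadicAlgCl p ≃ₐ[ℚ_[p]] PadicAlgCl p, ∃ τ : Qbar ≃ₐ[ℚ] Qbar, ∀ y, σ (ι y) = ι (τ y) := by
  haveI hal : Algebra.IsAlgebraic ℚ Qbar := by
    convert! AlgebraicClosure.isAlgebraic ℚ
  haveI : Normal ℚ Qbar := by
    haveI : IsAlgClosure ℚ Qbar := ⟨inferInstance, hal⟩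
    exact IsAlgClosure.normal ℚ Qbar
  let ι : Qbar →ₐ[ℚ] PadicAlgCl p := IsAlgClosed.lift
  refine ⟨ι, fun σ => ?_⟩
  letI : Algebra Qbar (PadicAlgCl p) := ι.toRingHom.toAlgebra
  haveI : IsScalarTower ℚ Qbar (PadicAlgCl p) := IsScalarTower.of_algebraMap_eq fun r => (ι.commutes r).symm
  let σ' : PadicAlgCl p ≃ₐ[ℚ] PadicAlgCl p := σ.restrictScalars ℚ
  exact ⟨σ'.restrictNormal Qbar, fun y => (σ'.restrictNormal_commutes Qbar y).symm⟩
end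

section
open WeierstrassCurve WeierstrassCurve.Affine Matrix

theorem exists_core (p : ℕ) [Fact p.Prime] (L : Type) [Field L] [Fintype L] [Algebra (ZMod p) L]
    (x : L → PadicAlgCl p) (hp5 : 5 ≤ p) (hcard : Fintype.card L = p ^ 2)
    (gal : ∀ σ : PadicAlgCl p ≃ₐ[ℚ_[p]] PadicAlgCl p, ∃ c : L, c ≠ 0 ∧
      ((∀ u ≠ 0, σ (x u) = x (c ^ 3 * u)) ∨ (∀ u ≠ 0, σ (x u) = x ((c ^ 3 * u) ^ p))))
    (a b : ℚ_[p]) (hab : a ≠ 0 ∨ b ≠ 0)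
    (sys : XSys (algebraMap ℚ_[p] (PadicAlgCl p) a) (algebraMap ℚ_[p] (PadicAlgCl p) b) x) :
    ∃ (X : L → PadicAlgCl p) (k : ℕ) (q : ℚ_[p]) (t A B : PadicAlgCl p), Core p L x X k q t A B := by
  set A₀ := algebraMap ℚ_[p] (PadicAlgCl p) a with hA₀
  set B₀ := algebraMap ℚ_[p] (PadicAlgCl p) b with hB₀
  have inj : Function.Injective (algebraMap ℚ_[p] (PadicAlgCl p)) := (algebraMap ℚ_[p] (PadicAlgCl p)).injective
  by_cases hc : ‖B₀‖ ^ 2 ≤ ‖A₀‖ ^ 3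
  · have hA : A₀ ≠ 0 := by
      intro e
      rw [e, norm_zero] at hc
      have hB : ‖B₀‖ = 0 := by
        have : ‖B₀‖ ^ 2 = 0 := le_antisymm (by simpa using hc) (by positivity)
        exact pow_eq_zero_iff (two_ne_zero) |>.1 this
      rw [norm_eq_zero] at hB
      rcases hab with h | h
      · exact h ((map_eq_zero_iff _ inj).1 e)
      · exact h ((map_eq_zero_iff _ inj).1 hB)
    obtain ⟨u, hu⟩ := IsAlgClosed.exists_pow_nat_eq A₀ (n := 4) (by norm_num)
    have hu0 : u ≠ 0 := by rintro rfl; exact hA (by rw [← hu]; simp)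
    refine ⟨fun v => x v / u ^ 2, 2, a, u ^ 2, A₀ / u ^ 4, B₀ / u ^ 6, hp5, hcard, gal, sys.scale u hu0, ?_, ?_, ?_, ⟨b, ?_⟩, Or.inl ⟨rfl, ?_, ?_⟩⟩
    · intro v; field_simp
    · positivity
    · rw [← hA₀, ← hu]; ring
    · rw [← hB₀]; field_simp
    · rw [hu]; exact div_self hA
    · rw [norm_div, norm_pow]
      have hn : 0 < ‖u‖ := norm_pos_iff.2 hu0
      rw [div_le_one (by positivity)]
      refine le_of_sq_le_sq ?_ (by positivity)
      calc ‖B₀‖ ^ 2 ≤ ‖A₀‖ ^ 3 := hc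
        _ = _ := by rw [← hu, norm_pow]; ring
  · push Not at hc
    have hB : B₀ ≠ 0 := by
      intro e
      rw [e, norm_zero] at hc
      have : 0 ≤ ‖A₀‖ ^ 3 := by positivity
      norm_num at hc
      linarith
    obtain ⟨u, hu⟩ := IsAlgClosed.exists_pow_nat_eq B₀ (n := 6) (by norm_num)
    have hu0 : u ≠ 0 := by rintro rfl; exact hB (by rw [← hu]; simp)
    refine ⟨fun v => x v / u ^ 2, 3, b, u ^ 2, A₀ / u ^ 4, B₀ / u ^ 6, hp5, hcard, gal, sys.scale u hu0, ?_, ?_, ?_, ⟨b, ?_⟩, Or.inr ⟨rfl, ?_, ?_⟩⟩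
    · intro v; field_simp
    · positivity
    · rw [← hB₀, ← hu]; ring
    · rw [← hB₀]; field_simp
    · rw [hu]; exact div_self hB
    · rw [norm_div, norm_pow]
      have hn : 0 < ‖u‖ := norm_pos_iff.2 hu0
      rw [div_lt_one (by positivity)]
      refine lt_of_pow_lt_pow_left₀ 3 (by positivity) ?_
      calc ‖A₀‖ ^ 3 < ‖B₀‖ ^ 2 := hc
        _ = _ := by rw [← hu, norm_pow]; ring

open scoped Classical in
theorem exists_core_curve (E : WeierstrassCurve ℚ) [E.IsElliptic] (p : ℕ) [Fact p.Prime] [Fact (p ≠ 2)] (hp5 : 5 ≤ p)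
    (ρ : (Qbar ≃ₐ[ℚ] Qbar) →* GL (Fin 2) (ZMod p)) (hρ : IsModPRep E p ρ)
    (himg : ImageConjTo ρ (Gset p)) :
    ∃ (x X : LL p → PadicAlgCl p) (k : ℕ) (q : ℚ_[p]) (t A B : PadicAlgCl p), Core p (LL p) x X k q t A B := by
  obtain ⟨ψ, hψ, hgal⟩ := exists_psi E p ρ hρ himg
  obtain ⟨ι, hι⟩ := exists_embed p
  have hsys := ((pxx_XSys (E.baseChange Qbar) (by norm_num)).comp ψ hψ).map ι
  have e4 : (E.baseChange Qbar).c₄ = algebraMap ℚ Qbar E.c₄ := WeierstrassCurve.map_c₄ _ _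
  have e6 : (E.baseChange Qbar).c₆ = algebraMap ℚ Qbar E.c₆ := WeierstrassCurve.map_c₆ _ _
  have eA : ι (-(E.baseChange Qbar).c₄ / 48) = algebraMap ℚ_[p] (PadicAlgCl p) (-(E.c₄ : ℚ_[p]) / 48) := by
    rw [e4, eq_ratCast]
    simp only [map_div₀, map_neg, map_ratCast]
    rw [map_ofNat, map_ofNat]
  have eB : ι (-(E.baseChange Qbar).c₆ / 864) = algebraMap ℚ_[p] (PadicAlgCl p) (-(E.c₆ : ℚ_[p]) / 864) := by
    rw [e6, eq_ratCast]
    simp only [map_div₀, map_neg, map_ratCast]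
    rw [map_ofNat, map_ofNat]
  rw [eA, eB] at hsys
  refine ⟨fun u => ι (pxx (E.baseChange Qbar) (ψ u)), exists_core p (LL p) _ hp5 (LL_card p) ?_ _ _ ?_ hsys⟩
  · intro σ
    obtain ⟨τ, hτ⟩ := hι σ
    obtain ⟨c, hc, h⟩ := hgal τ
    refine ⟨c, hc, h.imp (fun h u _ => ?_) (fun h u _ => ?_)⟩
    · rw [hτ, ← pxx_gal, h]
    · rw [hτ, ← pxx_gal, h]
  · by_contra! hh
    have h4 : E.c₄ = 0 := by simpa using hh.1
    have h6 : E.c₆ = 0 := by simpa using hh.2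
    have := E.c_relation
    rw [h4, h6] at this
    have hΔ : E.Δ ≠ 0 := E.isUnit_Δ.ne_zero
    apply hΔ
    linarith

theorem main_mod (E : WeierstrassCurve ℚ) [E.IsElliptic]
    (p : ℕ) (hp : p.Prime) (hp2 : p ≠ 2) (hp3 : p ≠ 3)
    (ρ : (Qbar ≃ₐ[ℚ] Qbar) →* GL (Fin 2) (ZMod p)) (hρ : IsModPRep E p ρ)
    (himg : ImageConjTo ρ (Gset p)) :
    p % 3 = 2 ∧ p % 9 ≠ 8 ∧ (p % 9 = 2 ∨ p % 9 = 5) := by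
  classical
  haveI : Fact p.Prime := ⟨hp⟩
  haveI : Fact (p ≠ 2) := ⟨hp2⟩
  have h30 : p % 3 ≠ 0 := fun h => hp3 ((Nat.prime_dvd_prime_iff_eq Nat.prime_three hp).1 (Nat.dvd_of_mod_eq_zero h)).symm
  have h4 : p ≠ 4 := by rintro rfl; norm_num at hp
  have hp5 : 5 ≤ p := by have := hp.two_le; omega
  obtain ⟨x, X, k, q, t, A, B, h⟩ := exists_core_curve E p hp5 ρ hρ himg
  have H : (∀ u, u ≠ 0 → 1 < ‖X u‖) ∨ ∃ v, v ≠ 0 ∧ ‖X v‖ ≤ 1 := by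
    by_cases H : ∀ u, u ≠ 0 → 1 < ‖X u‖
    · exact Or.inl H
    · push Not at H; exact Or.inr H
  have h31 : p % 3 ≠ 1 := by
    intro h3
    rcases H with hf | hn
    · rcases h.hk with hk | hk
      · exact h.case2 h3 hk.1 hf
      · exact h.case3 h3 hk.1 hf
    · exact h.case4 h3 hn
  have h98 : p % 9 ≠ 8 := by
    intro h9
    rcases H with hf | hn
    · exact h.case1 h9 hf
    · exact h.case5 h9 hn
  omega
end

/-- **Theorem `-1 mod 9`**: if `E/ℚ` is a non-CM elliptic curve and `p ∉ {2, 3}` is a prime such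
that the image of `ρ_{E,p}` is conjugate in `GL₂(𝔽_p)` to `G(p)`, then `p ≡ 2 (mod 3)` and
`p ≢ -1 (mod 9)`; hence `p ≡ 2` or `5 (mod 9)`. -/
theorem p_mod_nine_of_Gp_image (E : WeierstrassCurve ℚ) [E.IsElliptic]
    (hE : E.j ∉ CMjInvariants) (p : ℕ) (hp : p.Prime) (hp2 : p ≠ 2) (hp3 : p ≠ 3)
    (ρ : (Qbar ≃ₐ[ℚ] Qbar) →* GL (Fin 2) (ZMod p)) (hρ : IsModPRep E p ρ)
    (himg : ImageConjTo ρ (Gset p)) :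
    p % 3 = 2 ∧ p % 9 ≠ 8 ∧ (p % 9 = 2 ∨ p % 9 = 5) := by
  exact main_mod E p hp hp2 hp3 ρ hρ himg
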